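/- Let N ≥ 1 and m ≥ 1 be integers, let I ⊂ ℤ[1/N][y₁,…,y_m] be a prime ideal such that the quotient R := ℤ[1/N][y₁,…,y_m]/I is a domain whose fraction field has transcendence degree t ≥ 1 over ℚ, and let F be the algebraic closure of ℚ inside Frac(R). Then there exist constants C and p₀ with the following property: for every prime number p > p₀ that splits completely in F, every integer D ≥ 1, and every polynomial f ∈ ℤ[1/N][y₁,…,y_m] of total degree at most D whose image r ∈ R is such that the image of r ⊗ 1 in R ⊗_ℤ 𝔽_p is not a zero divisor, the number of ring homomorphisms φ : R → 𝔽_p with φ(r) = 0 is less than (C·D/p) times the total number of ring homomorphisms R → 𝔽_p. -/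

import Mathlib

open scoped TensorProduct

/-- `ℤ[1/N]` regarded as a subring of `ℚ`: the subring generated by `1/N`
(this is the localization of `ℤ` at the powers of `N`). -/
def ZInvN (N : ℕ) : Subring ℚ := Subring.closure {((N : ℚ))⁻¹}

/-- A prime number `p` splits completely in a number field `F` if the number of ring
homomorphisms from the ring of integers of `F` (the integral closure of `ℤ` in `F`)
to `𝔽_p` equals the degree `[F : ℚ]`. -/
def SplitsCompletely (F : Type*) [Field F] [Algebra ℚ F] (p : ℕ) : Prop :=
  Nat.card ((integralClosure ℤ F) →+* ZMod p) = Module.finrank ℚ F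

namespace PointCount
open Polynomial

section Fil

variable {K C : Type*} [Field K] [CommRing C] [Algebra K C]

/-- The span of the monomials `x ^ i * y ^ j` of weight `i + w * j ≤ m`. -/
def fil (K : Type*) {C : Type*} [Field K] [CommRing C] [Algebra K C] (x y : C) (w m : ℕ) :
    Submodule K C :=
  Submodule.span K {z | ∃ i j, i + w * j ≤ m ∧ z = x ^ i * y ^ j}

variable {x y : C} {w m n : ℕ}

lemma monomial_mem_fil {i j : ℕ} (h : i + w * j ≤ m) : x ^ i * y ^ j ∈ fil K x y w m :=
  Submodule.subset_span ⟨i, j, h, rfl⟩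

lemma fil_mono (h : m ≤ n) : fil K x y w m ≤ fil K x y w n := by
  refine Submodule.span_mono ?_
  rintro _ ⟨i, j, hij, rfl⟩
  exact ⟨i, j, hij.trans h, rfl⟩

lemma one_mem_fil : (1 : C) ∈ fil K x y w m := by
  simpa using monomial_mem_fil (K := K) (x := x) (y := y) (w := w) (m := m) (i := 0) (j := 0) (by simp)

lemma mul_mem_fil {a b : C} (ha : a ∈ fil K x y w m) (hb : b ∈ fil K x y w n) :
    a * b ∈ fil K x y w (m + n) := by
  induction ha using Submodule.span_induction with
  | mem a ha =>
    obtain ⟨i, j, hij, rfl⟩ := ha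
    induction hb using Submodule.span_induction with
    | mem b hb =>
      obtain ⟨i', j', hij', rfl⟩ := hb
      have : x ^ i * y ^ j * (x ^ i' * y ^ j') = x ^ (i + i') * y ^ (j + j') := by ring
      rw [this]
      exact monomial_mem_fil (by rw [mul_add]; omega)
    | zero => simp
    | add b b' _ _ h h' => rw [mul_add]; exact add_mem h h'
    | smul c b _ h => rw [mul_smul_comm]; exact Submodule.smul_mem _ _ h
  | zero => simp
  | add b b' _ _ h h' => rw [add_mul]; exact add_mem h h'
  | smul c b _ h => rw [smul_mul_assoc]; exact Submodule.smul_mem _ _ h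

lemma pow_mem_fil {a : C} (ha : a ∈ fil K x y w m) (k : ℕ) : a ^ k ∈ fil K x y w (k * m) := by
  induction k with
  | zero => simpa using one_mem_fil
  | succ k ih => rw [pow_succ, add_mul, one_mul]; exact mul_mem_fil ih ha

lemma aeval_mem_fil {q : K[X]} (hq : q.natDegree ≤ m) : aeval x q ∈ fil K x y w m := by
  rw [aeval_eq_sum_range]
  refine sum_mem fun i hi => Submodule.smul_mem _ _ ?_
  have := monomial_mem_fil (K := K) (x := x) (y := y) (w := w) (m := m) (i := i) (j := 0)
    (by simp at hi ⊢; omega)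
  simpa using this

lemma left_mem_fil (h : 1 ≤ m) : x ∈ fil K x y w m := by
  simpa using monomial_mem_fil (K := K) (x := x) (y := y) (w := w) (m := m) (i := 1) (j := 0)
    (by simpa using h)

lemma right_mem_fil (h : w ≤ m) : y ∈ fil K x y w m := by
  simpa using monomial_mem_fil (K := K) (x := x) (y := y) (w := w) (m := m) (i := 0) (j := 1)
    (by simpa using h)

end Fil

section Curve

variable {K : Type*} [Field K] (f : K[X][X])

/-- The image of the first coordinate in `K[x,y]/(f)`. -/
noncomputable abbrev cx : AdjoinRoot f := AdjoinRoot.of f X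

/-- The image of the second coordinate in `K[x,y]/(f)`. -/
noncomputable abbrev cy : AdjoinRoot f := AdjoinRoot.root f

variable {f} {w : ℕ}

lemma mk_monomial (i j : ℕ) : AdjoinRoot.mk f (C (X ^ i) * X ^ j) = cx f ^ i * cy f ^ j := by
  simp [AdjoinRoot.mk_C]

lemma of_eq_aeval (q : K[X]) : AdjoinRoot.of f q = aeval (cx f) q := by
  induction q using Polynomial.induction_on' with
  | add p q hp hq => simp [hp, hq]
  | monomial n a =>
    rw [aeval_monomial, ← C_mul_X_pow_eq_monomial]
    simp only [map_mul, map_pow]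
    rfl

lemma pow_root_eq (hf : f.Monic) (j : ℕ) (hj : f.natDegree ≤ j) :
    cy f ^ j = - ∑ l ∈ Finset.range f.natDegree,
      AdjoinRoot.of f (f.coeff l) * cy f ^ (j - f.natDegree + l) := by
  have h : AdjoinRoot.mk f f = 0 := AdjoinRoot.mk_self
  conv at h => lhs; arg 2; rw [hf.as_sum]
  simp only [map_add, map_pow, map_sum, map_mul, AdjoinRoot.mk_X, AdjoinRoot.mk_C] at h
  have h2 := eq_neg_of_add_eq_zero_left h
  have : j = j - f.natDegree + f.natDegree := by omega
  conv_lhs => rw [this, pow_add, h2]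
  rw [mul_neg, Finset.mul_sum]
  congr 1
  exact Finset.sum_congr rfl fun l _ => by rw [pow_add]; ring

lemma monomial_mem_reduced (hf : f.Monic) (hw : ∀ i, (f.coeff i).natDegree ≤ w) {m : ℕ} (j : ℕ) :
    ∀ i, i + w * j ≤ m → cx f ^ i * cy f ^ j ∈
      Submodule.span K {z | ∃ i j, i ≤ m ∧ j < f.natDegree ∧ z = cx f ^ i * cy f ^ j} := by
  induction j using Nat.strong_induction_on with
  | _ j ih =>
    intro i hij
    by_cases hj : j < f.natDegree
    · exact Submodule.subset_span ⟨i, j, by omega, hj, rfl⟩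
    push Not at hj
    rw [pow_root_eq hf j hj, mul_neg, Finset.mul_sum]
    refine neg_mem (sum_mem fun l hl => ?_)
    rw [of_eq_aeval, aeval_eq_sum_range, Finset.sum_mul, Finset.mul_sum]
    refine sum_mem fun e he => ?_
    have h1 : cx f ^ i * ((f.coeff l).coeff e • cx f ^ e * cy f ^ (j - f.natDegree + l)) =
      (f.coeff l).coeff e • (cx f ^ (i + e) * cy f ^ (j - f.natDegree + l)) := by
      rw [smul_mul_assoc, mul_smul_comm, pow_add (cx f) i e, mul_assoc]
    rw [h1]
    refine Submodule.smul_mem _ _ ?_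
    simp only [Finset.mem_range] at hl he
    refine ih _ (by omega) _ ?_
    have h2 := hw l
    have h3 : w * (j - f.natDegree + l) + w ≤ w * j := by
      rw [← Nat.mul_succ]; exact Nat.mul_le_mul_left _ (by omega)
    omega

lemma fil_le_reduced (hf : f.Monic) (hw : ∀ i, (f.coeff i).natDegree ≤ w) (m : ℕ) :
    fil K (cx f) (cy f) w m ≤
      Submodule.span K {z | ∃ i j, i ≤ m ∧ j < f.natDegree ∧ z = cx f ^ i * cy f ^ j} := by
  refine Submodule.span_le.2 ?_
  rintro _ ⟨i, j, hij, rfl⟩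
  exact monomial_mem_reduced hf hw j i hij

lemma finrank_fil_le (hf : f.Monic) (hw : ∀ i, (f.coeff i).natDegree ≤ w) (m : ℕ) :
    FiniteDimensional K (fil K (cx f) (cy f) w m) ∧
    Module.finrank K (fil K (cx f) (cy f) w m) ≤ (m + 1) * f.natDegree := by
  classical
  have h := fil_le_reduced hf hw m
  let s : Finset (AdjoinRoot f) := (Finset.range (m + 1) ×ˢ Finset.range f.natDegree).image
    fun ij => cx f ^ ij.1 * cy f ^ ij.2
  have hs : {z | ∃ i j, i ≤ m ∧ j < f.natDegree ∧ z = cx f ^ i * cy f ^ j} = (s : Set _) := by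
    ext z
    simp only [Set.mem_ofPred_eq, s, Finset.coe_image, Set.mem_image, Finset.mem_coe,
      Finset.mem_product, Finset.mem_range, Prod.exists]
    constructor
    · rintro ⟨i, j, hi, hj, rfl⟩; exact ⟨i, j, ⟨by omega, hj⟩, rfl⟩
    · rintro ⟨i, j, ⟨hi, hj⟩, rfl⟩; exact ⟨i, j, by omega, hj, rfl⟩
  rw [hs] at h
  have : FiniteDimensional K (Submodule.span K (s : Set (AdjoinRoot f))) :=
    FiniteDimensional.span_finset K s
  refine ⟨Submodule.finiteDimensional_of_le h, (Submodule.finrank_mono h).trans ?_⟩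
  refine (finrank_span_finset_le_card s).trans (Finset.card_image_le.trans ?_)
  simp

lemma natDegree_coeff_modByMonicHom_le (hf : f.Monic) (hw : ∀ i, (f.coeff i).natDegree ≤ w)
    {m : ℕ} {z : AdjoinRoot f} (hz : z ∈ fil K (cx f) (cy f) w m) (j : ℕ) :
    ((AdjoinRoot.modByMonicHom hf z).coeff j).natDegree ≤ m := by
  have h := fil_le_reduced hf hw m hz
  clear hz
  induction h using Submodule.span_induction with
  | mem z hz =>
    obtain ⟨i, l, hi, hl, rfl⟩ := hz
    rw [← mk_monomial, AdjoinRoot.modByMonicHom_mk, (modByMonic_eq_self_iff hf).2]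
    · rw [coeff_C_mul, coeff_X_pow]
      split_ifs <;> simp [hi]
    · refine (degree_C_mul_X_pow_le _ _).trans_lt ?_
      rw [degree_eq_natDegree hf.ne_zero]
      exact_mod_cast hl
  | zero => simp
  | add b b' _ _ h h' =>
    rw [map_add, coeff_add]; exact (natDegree_add_le _ _).trans (max_le h h')
  | smul c b _ h =>
    have : c • b = (C c : K[X]) • b := by
      rw [Algebra.smul_def, Algebra.smul_def]; rfl
    rw [this, map_smul, coeff_smul, smul_eq_mul]
    exact (natDegree_C_mul_le _ _).trans h

end Curve
end PointCount

namespace PointCount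
open Polynomial

section Derivation

/-- Transport of a derivation along an algebra isomorphism. -/
noncomputable def conjDerivation {R A B : Type*} [CommRing R] [CommRing A] [CommRing B]
    [Algebra R A] [Algebra R B]
    (e : A ≃ₐ[R] B) (d : Derivation R B B) : Derivation R A A :=
  Derivation.mk' (e.symm.toLinearMap ∘ₗ d.toLinearMap ∘ₗ e.toLinearMap) fun a b => by
    simp

lemma conjDerivation_apply {R A B : Type*} [CommRing R] [CommRing A] [CommRing B]
    [Algebra R A] [Algebra R B] (e : A ≃ₐ[R] B) (d : Derivation R B B) (a : A) :
    conjDerivation e d a = e.symm (d (e a)) := rfl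

variable {K : Type*} [Field K]

lemma C_eq_aeval (q : K[X]) : C q = aeval (C X : K[X][X]) q := by
  induction q using Polynomial.induction_on' with
  | add p q hp hq => simp [hp, hq]
  | monomial n a =>
    rw [aeval_monomial, ← C_mul_X_pow_eq_monomial]
    simp only [map_mul, map_pow]
    rfl

variable (K) in
lemma exists_partial_derivations : ∃ dX dY : Derivation K K[X][X] K[X][X],
    dX (C X) = 1 ∧ dX X = 0 ∧ dY (C X) = 0 ∧ dY X = 1 := by
  refine ⟨conjDerivation (Bivariate.equivMvPolynomial K) (MvPolynomial.pderiv 0),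
    conjDerivation (Bivariate.equivMvPolynomial K) (MvPolynomial.pderiv 1), ?_, ?_, ?_, ?_⟩ <;>
  rw [conjDerivation_apply] <;> simp [MvPolynomial.pderiv_X]

lemma derivation_C (d : Derivation K K[X][X] K[X][X]) (q : K[X]) :
    d (C q) = C (derivative q) * d (C X) := by
  rw [C_eq_aeval, C_eq_aeval (derivative q), Derivation.map_aeval, smul_eq_mul]

lemma derivation_apply (d : Derivation K K[X][X] K[X][X]) (P : K[X][X]) :
    d P = derivative P * d X + (∑ i ∈ Finset.range (P.natDegree + 1),
      C (derivative (P.coeff i)) * X ^ i) * d (C X) := by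
  conv_lhs => rw [P.as_sum_range_C_mul_X_pow]
  rw [map_sum]
  have h2 : derivative P = ∑ i ∈ Finset.range (P.natDegree + 1),
      C (P.coeff i) * ((i : K[X][X]) * X ^ (i - 1)) := by
    conv_lhs => rw [P.as_sum_range_C_mul_X_pow]
    rw [derivative_sum]
    refine Finset.sum_congr rfl fun i _ => ?_
    simp [derivative_X_pow]
  rw [h2, Finset.sum_mul, Finset.sum_mul, ← Finset.sum_add_distrib]
  refine Finset.sum_congr rfl fun i _ => ?_
  rw [Derivation.leibniz, derivation_C, Derivation.leibniz_pow]
  simp only [smul_eq_mul, nsmul_eq_mul]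
  ring

/-- The derivation of `K[x,y]/(f)` induced by `f_y ∂_x - f_x ∂_y`. -/
lemma exists_derivation (f : K[X][X]) : ∃ D : Derivation K (AdjoinRoot f) (AdjoinRoot f),
    D (cx f) = AdjoinRoot.mk f (derivative f) ∧
    D (cy f) = - AdjoinRoot.mk f (∑ i ∈ Finset.range (f.natDegree + 1),
      C (derivative (f.coeff i)) * X ^ i) := by
  obtain ⟨dX, dY, h1, h2, h3, h4⟩ := exists_partial_derivations K
  have hs : Function.Surjective (AdjoinRoot.mkₐ (R := K[X]) f |>.restrictScalars K) :=
    AdjoinRoot.mk_surjective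
  have hf1 : dX f = ∑ i ∈ Finset.range (f.natDegree + 1),
      C (derivative (f.coeff i)) * X ^ i := by rw [derivation_apply, h1, h2]; simp
  have hf2 : dY f = derivative f := by rw [derivation_apply, h3, h4]; simp
  have hd : ∀ z, (AdjoinRoot.mkₐ (R := K[X]) f |>.restrictScalars K) z = 0 →
      (AdjoinRoot.mkₐ (R := K[X]) f |>.restrictScalars K) ((dY f • dX - dX f • dY) z) = 0 := by
    intro z hz
    change AdjoinRoot.mk f z = 0 at hz
    change AdjoinRoot.mk f _ = 0
    rw [AdjoinRoot.mk_eq_zero] at hz ⊢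
    obtain ⟨c, rfl⟩ := hz
    refine ⟨dY f * dX c - dX f * dY c, ?_⟩
    simp only [Derivation.coe_sub, Derivation.coe_smul, Pi.sub_apply, Pi.smul_apply,
      Derivation.leibniz, smul_eq_mul]
    ring
  refine ⟨Derivation.liftOfSurjective hs hd, ?_, ?_⟩
  · have := Derivation.liftOfSurjective_apply hs hd (C X)
    refine this.trans ?_
    change AdjoinRoot.mk f _ = _
    rw [← hf2]; simp [h1, h3]
  · have := Derivation.liftOfSurjective_apply hs hd X
    refine this.trans ?_
    change AdjoinRoot.mk f _ = _
    rw [← hf1]; simp [h2, h4]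

variable {f : K[X][X]} {w : ℕ}

lemma derivation_mem_fil {D : Derivation K (AdjoinRoot f) (AdjoinRoot f)} {e : ℕ}
    (hx : D (cx f) ∈ fil K (cx f) (cy f) w e) (hy : D (cy f) ∈ fil K (cx f) (cy f) w e)
    {m : ℕ} {z : AdjoinRoot f} (hz : z ∈ fil K (cx f) (cy f) w m) :
    D z ∈ fil K (cx f) (cy f) w (m + e) := by
  induction hz using Submodule.span_induction with
  | mem z hz =>
    obtain ⟨i, j, hij, rfl⟩ := hz
    have h1 : D (cx f ^ i * cy f ^ j) = (j : ℕ) • (cx f ^ i * cy f ^ (j - 1) * D (cy f)) +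
        (i : ℕ) • (cx f ^ (i - 1) * cy f ^ j * D (cx f)) := by
      rw [Derivation.leibniz, Derivation.leibniz_pow, Derivation.leibniz_pow]
      simp only [smul_eq_mul, nsmul_eq_mul]
      ring
    rw [h1]
    refine add_mem (nsmul_mem (mul_mem_fil (monomial_mem_fil ?_) hy) _)
      (nsmul_mem (mul_mem_fil (monomial_mem_fil ?_) hx) _)
    · have : w * (j - 1) ≤ w * j := Nat.mul_le_mul_left _ (by omega)
      omega
    · omega
  | zero => simp
  | add a b _ _ h h' => rw [map_add]; exact add_mem h h'
  | smul c b _ h => rw [Derivation.map_smul]; exact Submodule.smul_mem _ _ h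

lemma iterate_derivation_mem_fil {D : Derivation K (AdjoinRoot f) (AdjoinRoot f)} {e : ℕ}
    (hx : D (cx f) ∈ fil K (cx f) (cy f) w e) (hy : D (cy f) ∈ fil K (cx f) (cy f) w e)
    {m : ℕ} {z : AdjoinRoot f} (hz : z ∈ fil K (cx f) (cy f) w m) (j : ℕ) :
    D^[j] z ∈ fil K (cx f) (cy f) w (m + j * e) := by
  induction j with
  | zero => simpa using hz
  | succ j ih =>
    rw [Function.iterate_succ_apply']
    have := derivation_mem_fil hx hy ih
    rwa [add_assoc, ← Nat.succ_mul] at this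

lemma mk_mem_fil {P : K[X][X]} {d : ℕ} (hw : ∀ i, (P.coeff i).natDegree ≤ w)
    (hd : P.degree < d) : AdjoinRoot.mk f P ∈ fil K (cx f) (cy f) w (w * d) := by
  by_cases hP : P = 0
  · simp [hP]
  rw [degree_eq_natDegree hP, Nat.cast_lt] at hd
  rw [P.as_sum_range_C_mul_X_pow, map_sum]
  refine sum_mem fun i hi => ?_
  rw [map_mul, map_pow, AdjoinRoot.mk_X, AdjoinRoot.mk_C, of_eq_aeval]
  rw [Finset.mem_range] at hi
  have h1 : w * i + w ≤ w * d := by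
    rw [← Nat.mul_succ]; exact Nat.mul_le_mul_left _ (by omega)
  have h2 : w + i * w ≤ w * d := by rw [mul_comm i]; omega
  exact fil_mono h2 (mul_mem_fil (aeval_mem_fil (hw i)) (pow_mem_fil (right_mem_fil le_rfl) i))

lemma exists_derivation_fil (hf : f.Monic) (hw : ∀ i, (f.coeff i).natDegree ≤ w) :
    ∃ D : Derivation K (AdjoinRoot f) (AdjoinRoot f),
    D (cx f) = AdjoinRoot.mk f (derivative f) ∧
    ∀ m, ∀ z ∈ fil K (cx f) (cy f) w m, ∀ j,
      D^[j] z ∈ fil K (cx f) (cy f) w (m + j * (w * f.natDegree)) := by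
  obtain ⟨D, h1, h2⟩ := exists_derivation f
  refine ⟨D, h1, fun m z hz j => iterate_derivation_mem_fil ?_ ?_ hz j⟩
  · rw [h1]
    refine mk_mem_fil (fun i => ?_) ?_
    · rw [coeff_derivative]
      refine (natDegree_mul_le).trans ?_
      have : ((i : K[X]) + 1).natDegree = 0 := by
        exact_mod_cast natDegree_natCast (R := K) (i + 1)
      rw [this]; exact hw _
    · exact (degree_derivative_lt hf.ne_zero).trans_le degree_le_natDegree
  · rw [h2]
    refine neg_mem (mk_mem_fil (fun i => ?_) ?_)
    · rw [finsetSum_coeff]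
      simp only [coeff_C_mul, coeff_X_pow, mul_ite, mul_one, mul_zero]
      rw [Finset.sum_ite_eq]
      split_ifs
      · exact (natDegree_derivative_le _).trans ((Nat.sub_le _ _).trans (hw i))
      · simp
    · rw [Finset.sum_range_succ]
      simp only [coeff_natDegree, hf.leadingCoeff, derivative_one, map_zero, zero_mul, add_zero]
      refine (degree_sum_le _ _).trans_lt ?_
      rw [Finset.sup_lt_iff (WithBot.bot_lt_coe _)]
      intro i hi
      refine (degree_C_mul_X_pow_le _ _).trans_lt ?_
      exact_mod_cast Finset.mem_range.1 hi

end Derivation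

section Order

variable {K A : Type*} [Field K] [CommRing A] [Algebra K A] (D : Derivation K A A)

lemma iterate_derivation_pow_mul (g b : A) (i : ℕ) :
    ∃ e, D^[i] (g ^ i * b) = (i.factorial : A) * D g ^ i * b + g * e := by
  suffices h : ∀ i n : ℕ, ∀ b, ∃ e, D^[i] (g ^ (i + n) * b) =
      ((i + n).descFactorial i : A) * D g ^ i * g ^ n * b + g ^ (n + 1) * e by
    obtain ⟨e, he⟩ := h i 0 b
    exact ⟨e, by simpa [Nat.descFactorial_self] using he⟩
  clear b i
  intro i
  induction i with
  | zero => intro n b; exact ⟨0, by simp⟩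
  | succ i ih =>
    intro n b
    have h1 : D (g ^ (i + 1 + n) * b) = g ^ (i + n) * (((i + 1 + n : ℕ) : A) * D g * b + g * D b) := by
      rw [Derivation.leibniz, Derivation.leibniz_pow]
      have : i + 1 + n = (i + n) + 1 := by ring
      rw [this]
      simp only [smul_eq_mul, nsmul_eq_mul, Nat.add_sub_cancel]
      ring
    rw [Function.iterate_succ_apply, h1]
    obtain ⟨e, he⟩ := ih n (((i + 1 + n : ℕ) : A) * D g * b + g * D b)
    rw [he]
    refine ⟨e + ((i + n).descFactorial i : A) * D g ^ i * D b, ?_⟩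
    have : i + 1 + n = (i + n) + 1 := by ring
    rw [this, Nat.succ_descFactorial_succ]
    push_cast
    ring

lemma pow_dvd_of_iterate_derivation {g a : A} (hg : IsCoprime g (D g)) (M : ℕ)
    (hM : IsUnit (M.factorial : A)) (h : ∀ j < M, g ∣ D^[j] a) : g ^ M ∣ a := by
  induction M with
  | zero => simp
  | succ M ih =>
    rw [Nat.factorial_succ, Nat.cast_mul] at hM
    obtain ⟨b, rfl⟩ := ih (isUnit_of_mul_isUnit_right hM) fun j hj => h j (by omega)
    rw [pow_succ]
    refine mul_dvd_mul_left _ ?_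
    obtain ⟨e, he⟩ := iterate_derivation_pow_mul D g b M
    have h1 := h M (by omega)
    rw [he, dvd_add_left (Dvd.intro _ rfl)] at h1
    have h2 : g ∣ D g ^ M * b := by
      rw [mul_assoc] at h1
      exact ((isUnit_of_mul_isUnit_right hM).dvd_mul_left).1 h1
    exact (hg.pow_right).dvd_of_dvd_mul_left h2

end Order
end PointCount

namespace PointCount
open Polynomial

section Coeff

variable {K C : Type*} [Field K] [CommRing C] [Algebra K C] {x y : C} {w m n : ℕ}

lemma coeff_prod_mem_fil {ι : Type*} (s : Finset ι) (r : ι → C[X])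
    (h : ∀ k ∈ s, ∀ i, (r k).coeff i ∈ fil K x y w m) (i : ℕ) :
    (∏ k ∈ s, r k).coeff i ∈ fil K x y w (s.card * m) := by
  classical
  induction s using Finset.induction_on generalizing i with
  | empty =>
    rw [Finset.prod_empty, coeff_one]
    split_ifs
    · exact one_mem_fil
    · exact zero_mem _
  | insert k s hk ih =>
    rw [Finset.prod_insert hk, Finset.card_insert_of_notMem hk, add_mul, one_mul, add_comm,
      coeff_mul]
    exact sum_mem fun q _ => mul_mem_fil (h k (by simp) _)
      (ih (fun j hj => h j (by simp [hj])) _)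

lemma coeff_det_mem_fil {N : ℕ} (M : Matrix (Fin N) (Fin N) C[X])
    (h : ∀ a b i, (M a b).coeff i ∈ fil K x y w m) (i : ℕ) :
    M.det.coeff i ∈ fil K x y w (N * m) := by
  rw [Matrix.det_apply, finsetSum_coeff]
  refine sum_mem fun σ _ => ?_
  rw [coeff_smul]
  have := coeff_prod_mem_fil Finset.univ (fun i => M (σ i) i) (fun k _ => h _ _) i
  rw [Finset.card_univ, Fintype.card_fin] at this
  rcases Int.units_eq_one_or (Equiv.Perm.sign σ) with h | h <;> simp [h, this]

lemma coeff_resultant_mem_fil (P Q : C[X][X])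
    (hP : ∀ l i, (P.coeff l).coeff i ∈ fil K x y w m)
    (hQ : ∀ l i, (Q.coeff l).coeff i ∈ fil K x y w m) (i : ℕ) :
    (resultant P Q).coeff i ∈ fil K x y w ((P.natDegree + Q.natDegree) * m) := by
  refine coeff_det_mem_fil _ (fun a b i => ?_) i
  rw [sylvester, Matrix.of_apply]
  refine Fin.addCases (fun b => ?_) (fun b => ?_) b
  · rw [Fin.addCases_left]
    split_ifs
    · exact hQ _ _
    · simp
  · rw [Fin.addCases_right]
    split_ifs
    · exact hP _ _
    · simp

end Coeff

lemma resultant_ne_zero_of_irreducible {E : Type*} [Field E] {P Q : E[X][X]} (hP : P.Monic)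
    (hirr : Irreducible P) (hQ : Q ≠ 0) (hdeg : Q.natDegree < P.natDegree) :
    resultant P Q ≠ 0 := by
  let F := FractionRing E[X]
  have hi : Function.Injective (algebraMap E[X] F) := IsFractionRing.injective _ _
  have h1 := (hP.irreducible_iff_irreducible_map_fraction_map (K := F)).1 hirr
  have h2 : resultant (P.map (algebraMap E[X] F)) (Q.map (algebraMap E[X] F)) ≠ 0 := by
    refine resultant_ne_zero _ _ ((EuclideanDomain.dvd_or_coprime _ _ h1).resolve_left fun h => ?_)
    have := natDegree_le_of_dvd h (by rwa [Ne, Polynomial.map_eq_zero_iff hi])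
    rw [natDegree_map_eq_of_injective hi, natDegree_map_eq_of_injective hi] at this
    omega
  rw [resultant_map_map, natDegree_map_eq_of_injective hi, natDegree_map_eq_of_injective hi] at h2
  exact fun h => h2 (by rw [h, map_zero])

section Nonvanishing

variable {K : Type} [Field K] {f : K[X][X]} {w : ℕ}

lemma sum_mul_pow_cx_eq_zero (hf : f.Monic) (hw : ∀ i, (f.coeff i).natDegree ≤ w) {m p : ℕ}
    (hmp : m < p) (r : (AdjoinRoot f)[X]) (hr : ∀ i, r.coeff i ∈ fil K (cx f) (cy f) w m)
    (h : r.eval (cx f ^ p) = 0) : r = 0 := by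
  rw [eval_eq_sum_range] at h
  have h2 : ∑ i ∈ Finset.range (r.natDegree + 1),
      (X ^ (p * i) : K[X]) • AdjoinRoot.modByMonicHom hf (r.coeff i) = 0 := by
    rw [← map_zero (AdjoinRoot.modByMonicHom hf), ← h, map_sum]
    refine Finset.sum_congr rfl fun i _ => ?_
    rw [← map_smul, Algebra.smul_def, mul_comm, ← pow_mul]
    simp [AdjoinRoot.algebraMap_eq]
  have h3 : ∀ i, AdjoinRoot.modByMonicHom hf (r.coeff i) = 0 := by
    intro i
    by_cases hi : i < r.natDegree + 1
    swap
    · rw [coeff_eq_zero_of_natDegree_lt (by omega), map_zero]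
    ext j e
    by_cases he : e ≤ m
    swap
    · rw [coeff_eq_zero_of_natDegree_lt (n := e)]
      · simp
      · exact (natDegree_coeff_modByMonicHom_le hf hw (hr i) j).trans_lt (by omega)
    have h4 := congr_arg (fun q => (q.coeff j).coeff (e + p * i)) h2
    simp only [finsetSum_coeff, coeff_smul, smul_eq_mul, coeff_zero, coeff_X_pow_mul'] at h4
    rw [Finset.sum_eq_single_of_mem i (Finset.mem_range.2 hi)] at h4
    · simpa using h4
    · intro i' _ hne
      split_ifs with hle
      · refine coeff_eq_zero_of_natDegree_lt
          ((natDegree_coeff_modByMonicHom_le hf hw (hr i') j).trans_lt ?_)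
        have : i' < i := by
          rcases lt_or_gt_of_ne hne with h | h
          · exact h
          · exfalso
            have : p * (i + 1) ≤ p * i' := Nat.mul_le_mul_left _ h
            rw [mul_add] at this
            omega
        have : p * (i' + 1) ≤ p * i := Nat.mul_le_mul_left _ this
        rw [mul_add] at this
        omega
      · rfl
  ext i
  rw [← AdjoinRoot.mk_leftInverse hf (r.coeff i), h3 i]
  simp

lemma frobenius_sum_ne_zero (hf : f.Monic) (hw : ∀ i, (f.coeff i).natDegree ≤ w)
    (hirr : ∀ (E : Type) [Field E] [Algebra K E],
      Irreducible (f.map (mapRingHom (algebraMap K E)))) [IsDomain (AdjoinRoot f)] {m p B : ℕ}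
    (hmp : 2 * f.natDegree * m < p)
    (hfrob : f.eval₂ (aeval (cx f ^ p) : K[X] →ₐ[K] AdjoinRoot f).toRingHom (cy f ^ p) = 0)
    (a : ℕ → ℕ → AdjoinRoot f) (ha : ∀ i l, a i l ∈ fil K (cx f) (cy f) w m)
    (hne : ∃ i < B, ∃ l < f.natDegree, a i l ≠ 0) :
    ∑ l ∈ Finset.range f.natDegree, ∑ i ∈ Finset.range B, a i l * cx f ^ (p * i) * cy f ^ (p * l)
      ≠ 0 := by
  let O := AdjoinRoot f
  let α : O[X][X] := ∑ l ∈ Finset.range f.natDegree, C (∑ i ∈ Finset.range B, C (a i l) * X ^ i) * X ^ l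
  let φ : K[X] →+* O[X] := mapRingHom (algebraMap K O)
  have hα : ∀ l i, (α.coeff l).coeff i = if l < f.natDegree ∧ i < B then a i l else 0 := by
    intro l i
    simp only [α, finsetSum_coeff, coeff_C_mul, coeff_X_pow, mul_ite, mul_one, mul_zero,
      Finset.sum_ite_eq, Finset.mem_range, apply_ite (fun q : O[X] => q.coeff i), coeff_zero]
    split_ifs <;> first | rfl | (exfalso; omega)
  have hα0 : α ≠ 0 := by
    obtain ⟨i, hi, l, hl, h⟩ := hne
    intro h0
    have := hα l i
    rw [h0, if_pos ⟨hl, hi⟩] at this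
    exact h (by simpa using this.symm)
  have hαd : α.natDegree < f.natDegree := by
    rw [natDegree_lt_iff_degree_lt hα0]
    refine (degree_sum_le _ _).trans_lt ?_
    rw [Finset.sup_lt_iff (WithBot.bot_lt_coe _)]
    intro i hi
    refine (degree_C_mul_X_pow_le _ _).trans_lt ?_
    exact_mod_cast Finset.mem_range.1 hi
  have hfm : (f.map φ).natDegree = f.natDegree := hf.natDegree_map _
  have hres : resultant (f.map φ) α ≠ 0 := by
    let E := FractionRing O
    have hi : Function.Injective (algebraMap O E) := IsFractionRing.injective _ _
    let ψ : O[X] →+* E[X] := mapRingHom (algebraMap O E)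
    have hψ : Function.Injective ψ := map_injective _ hi
    have hirrE := hirr E
    have hcomp : ψ.comp φ = mapRingHom (algebraMap K E) := by
      ext z <;> simp [ψ, φ, ← IsScalarTower.algebraMap_apply K O E]
    have h1 := resultant_ne_zero_of_irreducible (hf.map (mapRingHom (algebraMap K E))) hirrE
      (Q := α.map ψ) (by rwa [Ne, Polynomial.map_eq_zero_iff hψ])
      (by rw [natDegree_map_eq_of_injective hψ, hf.natDegree_map]; exact hαd)
    rw [← hcomp, ← Polynomial.map_map, resultant_map_map, natDegree_map_eq_of_injective hψ,
      natDegree_map_eq_of_injective hψ] at h1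
    exact fun h => h1 (by rw [h, map_zero])
  have hfil : ∀ i, (resultant (f.map φ) α).coeff i ∈ fil K (cx f) (cy f) w (2 * f.natDegree * m) := by
    intro i
    refine fil_mono (Nat.mul_le_mul_right m ?_)
      (coeff_resultant_mem_fil (K := K) (x := cx f) (y := cy f) (w := w) (m := m) _ _ ?_ ?_ i)
    · omega
    · intro l i
      rw [coeff_map, coe_mapRingHom, coeff_map]
      rw [Algebra.algebraMap_eq_smul_one]
      exact Submodule.smul_mem _ _ one_mem_fil
    · intro l i
      rw [hα]
      split_ifs
      · exact ha _ _
      · simp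
  intro h0
  refine hres (sum_mul_pow_cx_eq_zero hf hw hmp _ hfil ?_)
  obtain ⟨P, Q, -, -, hPQ⟩ := exists_mul_add_mul_eq_C_resultant (f.map φ) α le_rfl le_rfl
    (by left; rw [hfm]; omega)
  have h5 := congr_arg (fun q => (q.eval (C (cy f ^ p))).eval (cx f ^ p)) hPQ
  simp only [eval_add, eval_mul, eval_C] at h5
  rw [← h5]
  have e1 : (((f.map φ).eval (C (cy f ^ p))).eval (cx f ^ p)) = 0 := by
    rw [← hfrob, eval_map, ← coe_evalRingHom (cx f ^ p), hom_eval₂]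
    congr 1
    · ext z
      · simp [φ, O]
      · simp [φ]
    · simp
  have e2 : ((α.eval (C (cy f ^ p))).eval (cx f ^ p)) = 0 := by
    rw [← h0]
    simp only [α, eval_finsetSum, eval_mul, eval_C, eval_pow, eval_X, Finset.sum_mul, ← pow_mul]
  rw [e1, e2]; simp

end Nonvanishing
end PointCount

namespace PointCount
open Polynomial

section Frobenius

variable {p : ℕ} [Fact p.Prime]

lemma X_pow_sub_X_eq_prod : (X ^ p - X : (ZMod p)[X]) = ∏ c : ZMod p, (X - C c) := by
  have hp : 1 < p := (Fact.out : p.Prime).one_lt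
  have h1 : (X ^ p - X : (ZMod p)[X]).roots = Finset.univ.val := by
    simpa using FiniteField.roots_X_pow_card_sub_X (ZMod p)
  have h2 := prod_multiset_X_sub_C_of_monic_of_roots_card_eq (p := (X ^ p - X : (ZMod p)[X]))
    (monic_X_pow_sub (by rw [degree_X]; exact_mod_cast hp)) (by
      rw [h1, FiniteField.X_pow_card_sub_X_natDegree_eq _ hp]; simp)
  rw [h1] at h2
  exact h2.symm

lemma pow_sub_self_eq_prod {C : Type*} [CommRing C] [Algebra (ZMod p) C] (z : C) :
    z ^ p - z = ∏ c : ZMod p, (z - algebraMap (ZMod p) C c) := by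
  have := congr_arg (aeval z) (X_pow_sub_X_eq_prod (p := p))
  simpa [map_prod] using this

lemma prod_dvd_X_pow_sub_X (S : Finset (ZMod p)) :
    ∏ s ∈ S, (X - C s : (ZMod p)[X]) ∣ X ^ p - X := by
  rw [X_pow_sub_X_eq_prod]
  exact Finset.prod_dvd_prod_of_subset _ _ _ (Finset.subset_univ S)

lemma eval₂_frobenius (f : (ZMod p)[X][X]) :
    f.eval₂ (aeval (cx f ^ p) : (ZMod p)[X] →ₐ[ZMod p] AdjoinRoot f).toRingHom (cy f ^ p) = 0 := by
  have hch : CharP (AdjoinRoot f) p ∨ Subsingleton (AdjoinRoot f) := by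
    rcases subsingleton_or_nontrivial (AdjoinRoot f) with h | h
    · exact Or.inr h
    · exact Or.inl (charP_of_injective_algebraMap (algebraMap (ZMod p) (AdjoinRoot f)).injective p)
  rcases hch with h | h
  swap
  · exact Subsingleton.elim _ _
  have h1 : (frobenius (AdjoinRoot f) p) (f.eval₂ (AdjoinRoot.of f) (cy f)) = 0 := by
    rw [AdjoinRoot.eval₂_root, map_zero]
  rw [hom_eval₂] at h1
  rw [← h1]
  congr 1
  ext z
  · have hz : AdjoinRoot.of f (C z) = algebraMap (ZMod p) (AdjoinRoot f) z := rfl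
    simp [frobenius_def, hz, ← map_pow]
  · simp [frobenius_def]

end Frobenius

section Relation

variable {K : Type*} [Field K] (f : K[X][X]) {w : ℕ}

/-- The coefficients of `f(x,W) / (W - y)` as a polynomial in `W`. -/
noncomputable def quotCoeff (l : ℕ) : AdjoinRoot f :=
  ((f.map (AdjoinRoot.of f)) /ₘ (X - C (cy f))).coeff l

variable {f}

lemma quotCoeff_eq (hf : f.Monic) (l : ℕ) : quotCoeff f l =
    ∑ i ∈ Finset.Icc (l + 1) f.natDegree, cy f ^ (i - (l + 1)) * AdjoinRoot.of f (f.coeff i) := by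
  nontriviality (AdjoinRoot f)
  rw [quotCoeff, coeff_divByMonic_X_sub_C, hf.natDegree_map]
  simp

lemma quotCoeff_last (hf : f.Monic) (hd : 1 ≤ f.natDegree) : quotCoeff f (f.natDegree - 1) = 1 := by
  rw [quotCoeff_eq hf]
  have : f.natDegree - 1 + 1 = f.natDegree := by omega
  simp [this, hf.leadingCoeff]

lemma quotCoeff_mem_fil (hf : f.Monic) (hw : ∀ i, (f.coeff i).natDegree ≤ w) (l : ℕ) :
    quotCoeff f l ∈ fil K (cx f) (cy f) w (w * f.natDegree) := by
  rw [quotCoeff_eq hf]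
  refine sum_mem fun i hi => ?_
  rw [Finset.mem_Icc] at hi
  rw [of_eq_aeval]
  refine fil_mono ?_ (mul_mem_fil (pow_mem_fil (right_mem_fil le_rfl) _) (aeval_mem_fil (hw i)))
  have : (i - (l + 1) + 1) * w ≤ f.natDegree * w := Nat.mul_le_mul_right _ (by omega)
  rw [add_mul, one_mul] at this
  rwa [mul_comm w]

lemma sum_quotCoeff_mul (hf : f.Monic) (z : AdjoinRoot f) :
    (∑ l ∈ Finset.range f.natDegree, quotCoeff f l * z ^ l) * (z - cy f) =
      f.eval₂ (AdjoinRoot.of f) z := by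
  nontriviality (AdjoinRoot f)
  have h : (X - C (cy f)) * (f.map (AdjoinRoot.of f) /ₘ (X - C (cy f))) = f.map (AdjoinRoot.of f) := by
    rw [mul_divByMonic_eq_iff_isRoot, IsRoot, eval_map, AdjoinRoot.eval₂_root]
  have h2 := congr_arg (eval z) h
  rw [eval_mul, eval_map] at h2
  rw [← h2, mul_comm]
  congr 1
  · simp
  · rw [eval_eq_sum_range' (n := f.natDegree)]
    · rfl
    rw [natDegree_divByMonic _ (monic_X_sub_C _), hf.natDegree_map, natDegree_X_sub_C]
    have : f.natDegree ≠ 0 := by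
      intro h0
      rw [hf.natDegree_eq_zero] at h0
      subst h0
      have := AdjoinRoot.mk_self (f := (1 : K[X][X]))
      rw [map_one] at this
      exact one_ne_zero this
    omega

end Relation

end PointCount

namespace PointCount
open Polynomial

variable {p : ℕ} [Fact p.Prime]

/-- The data entering the auxiliary polynomial argument: `S` is a set of abscissae over which the
curve `f = 0` has no rational point and is unramified. -/
structure Pointless (f : (ZMod p)[X][X]) (ρ : (ZMod p)[X]) (S : Finset (ZMod p)) : Prop where
  dvd : ∃ U V : (ZMod p)[X][X], f * U + derivative f * V = C ρ
  unram : ∀ s ∈ S, ρ.eval s ≠ 0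
  noroot : ∀ s ∈ S, ∀ c, (f.eval (C c)).eval s ≠ 0

variable {f : (ZMod p)[X][X]} {ρ : (ZMod p)[X]} {S : Finset (ZMod p)}

lemma isCoprime_prod_of_eval_ne_zero (q : (ZMod p)[X]) (h : ∀ s ∈ S, q.eval s ≠ 0) :
    IsCoprime (∏ s ∈ S, (X - C s)) q := by
  refine IsCoprime.prod_left fun s hs => ?_
  refine ((EuclideanDomain.dvd_or_coprime _ _ (irreducible_X_sub_C s)).resolve_left fun hd => ?_)
  exact h s hs (dvd_iff_isRoot.1 hd)

lemma isCoprime_derivation (hS : Pointless f ρ S) (D : Derivation (ZMod p) (AdjoinRoot f) (AdjoinRoot f))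
    (hD : D (cx f) = AdjoinRoot.mk f (derivative f)) :
    IsCoprime (AdjoinRoot.of f (∏ s ∈ S, (X - C s))) (D (AdjoinRoot.of f (∏ s ∈ S, (X - C s)))) := by
  have h1 : D (AdjoinRoot.of f (∏ s ∈ S, (X - C s))) =
      AdjoinRoot.of f (derivative (∏ s ∈ S, (X - C s))) * AdjoinRoot.mk f (derivative f) := by
    rw [of_eq_aeval, of_eq_aeval, Derivation.map_aeval, hD, smul_eq_mul]
  rw [h1]
  refine IsCoprime.mul_right ?_ ?_
  · exact IsCoprime.map (separable_prod_X_sub_C_iff' (s := S) (f := id).2 (by simp)) (AdjoinRoot.of f)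
  · obtain ⟨U, V, h⟩ := hS.dvd
    have h2 : AdjoinRoot.mk f (derivative f) * AdjoinRoot.mk f V = AdjoinRoot.of f ρ := by
      rw [← AdjoinRoot.mk_C, ← h, map_add, map_mul _ f U, AdjoinRoot.mk_self, zero_mul, zero_add, map_mul]
    have h3 := IsCoprime.map (isCoprime_prod_of_eval_ne_zero ρ hS.unram) (AdjoinRoot.of f)
    rw [← h2] at h3
    exact IsCoprime.of_mul_right_left h3

lemma dvd_sum_quotCoeff (hf : f.Monic) (hS : Pointless f ρ S) :
    AdjoinRoot.of f (∏ s ∈ S, (X - C s)) ∣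
      ∑ l ∈ Finset.range f.natDegree, quotCoeff f l * (cy f ^ p) ^ l := by
  set g := AdjoinRoot.of f (∏ s ∈ S, (X - C s)) with hg
  have h1 : IsCoprime g (cy f ^ p - cy f) := by
    rw [pow_sub_self_eq_prod]
    refine IsCoprime.prod_right fun c _ => ?_
    have h2 : (cy f - algebraMap (ZMod p) (AdjoinRoot f) c) ∣ AdjoinRoot.of f (f.eval (C c)) := by
      have := sub_dvd_eval_sub (X : (ZMod p)[X][X]) (C (C c)) (f.map C)
      have := map_dvd (AdjoinRoot.mk f) this
      rw [map_sub, map_sub, AdjoinRoot.mk_X, ← neg_dvd, ← dvd_neg] at this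
      have e1 : eval X (map C f) = f := by rw [eval_map]; exact eval₂_C_X
      have e2 : eval (C (C c)) (map C f) = C (f.eval (C c)) := by
        rw [eval_map, eval₂_at_apply]
      rw [e1, AdjoinRoot.mk_self, e2, AdjoinRoot.mk_C, zero_sub, neg_neg, neg_dvd,
        AdjoinRoot.mk_C] at this
      exact this
    have h3 := IsCoprime.map (isCoprime_prod_of_eval_ne_zero (f.eval (C c))
      fun s hs => hS.noroot s hs c) (AdjoinRoot.of f)
    exact h3.of_isCoprime_of_dvd_right h2
  refine h1.dvd_of_dvd_mul_right ?_
  rw [sum_quotCoeff_mul hf]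
  rw [← Ideal.mem_span_singleton, ← Ideal.Quotient.eq_zero_iff_mem]
  have h4 := congr_arg (Ideal.Quotient.mk (Ideal.span {g})) (eval₂_frobenius f)
  rw [hom_eval₂, map_zero] at h4
  rw [hom_eval₂, ← h4]
  congr 1
  ext z
  · have hz : AdjoinRoot.of f (C z) = algebraMap (ZMod p) (AdjoinRoot f) z := rfl
    simp [hz]
  · simp only [RingHom.comp_apply, AlgHom.toRingHom_eq_coe, AlgHom.coe_toRingHom, aeval_X]
    rw [eq_comm, Ideal.Quotient.eq, Ideal.mem_span_singleton]
    have := map_dvd (AdjoinRoot.of f) (prod_dvd_X_pow_sub_X S)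
    rwa [map_sub, map_pow] at this

variable {w : ℕ}

/-- Existence of the coefficients of the auxiliary function. -/
lemma exists_auxiliary (hf : f.Monic) (hw : ∀ i, (f.coeff i).natDegree ≤ w)
    (D : Derivation (ZMod p) (AdjoinRoot f) (AdjoinRoot f))
    (hD : ∀ m, ∀ z ∈ fil (ZMod p) (cx f) (cy f) w m, ∀ j,
      D^[j] z ∈ fil (ZMod p) (cx f) (cy f) w (m + j * (w * f.natDegree))) {A B M : ℕ}
    (hAB : M * ((f.natDegree - 1) * ((A + w * f.natDegree + M * (w * f.natDegree) + B
      + w * f.natDegree + 1) * f.natDegree)) < A * f.natDegree * (B * f.natDegree)) :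
    ∃ a : ℕ → ℕ → AdjoinRoot f, (∀ i l, a i l ∈ fil (ZMod p) (cx f) (cy f) w (A + w * f.natDegree)) ∧
      (∃ i < B, ∃ l < f.natDegree, a i l ≠ 0) ∧
      ∀ j < M, ∀ l < f.natDegree - 1, ∑ i ∈ Finset.range B, cx f ^ i * (D^[j] (a i l) -
        quotCoeff f l * D^[j] (a i (f.natDegree - 1))) = 0 := by
  set d := f.natDegree with hd_def
  let O := AdjoinRoot f
  let V := (Fin A × Fin d) × (Fin B × Fin d) → ZMod p
  let α : ℕ → ℕ → V →ₗ[ZMod p] O := fun i l =>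
    if h : i < B ∧ l < d then
      ∑ q : Fin A × Fin d, (LinearMap.toSpanSingleton (ZMod p) O (cx f ^ (q.1 : ℕ) * cy f ^ (q.2 : ℕ))) ∘ₗ
        LinearMap.proj (q, (⟨i, h.1⟩, ⟨l, h.2⟩))
    else 0
  have hα : ∀ i l v, α i l v ∈ fil (ZMod p) (cx f) (cy f) w (A + w * d) := by
    intro i l v
    simp only [α]
    split_ifs with h
    · rw [LinearMap.sum_apply]
      refine sum_mem fun q _ => Submodule.smul_mem _ _ (monomial_mem_fil ?_)
      have := Nat.mul_le_mul_left w q.2.2.le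
      have := q.1.2
      omega
    · simp
  set m := A + w * d + M * (w * d) + B + w * d with hm
  let lin : ℕ → ℕ → V →ₗ[ZMod p] O := fun j l => ∑ i ∈ Finset.range B,
    LinearMap.mulLeft (ZMod p) (cx f ^ i) ∘ₗ (((D : O →ₗ[ZMod p] O) ^ j) ∘ₗ α i l -
      LinearMap.mulLeft (ZMod p) (quotCoeff f l) ∘ₗ ((D : O →ₗ[ZMod p] O) ^ j) ∘ₗ α i (d - 1))
  have hlin : ∀ j l v, lin j l v = ∑ i ∈ Finset.range B, cx f ^ i * (D^[j] (α i l v) -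
        quotCoeff f l * D^[j] (α i (d - 1) v)) := by
    intro j l v
    simp [lin, LinearMap.sum_apply, Module.End.pow_apply]
  have hlinm : ∀ j < M, ∀ l v, lin j l v ∈ fil (ZMod p) (cx f) (cy f) w m := by
    intro j hj l v
    rw [hlin]
    refine sum_mem fun i hi => ?_
    have hjw : j * (w * d) ≤ M * (w * d) := Nat.mul_le_mul_right _ hj.le
    have h1 := pow_mem_fil (left_mem_fil (K := ZMod p) (x := cx f) (y := cy f) (w := w) le_rfl) i
    have h2 := hD _ _ (hα i l v) j
    have h3 := mul_mem_fil (quotCoeff_mem_fil hf hw l) (hD _ _ (hα i (d - 1) v) j)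
    rw [Finset.mem_range] at hi
    refine fil_mono ?_ (mul_mem_fil h1 (sub_mem (fil_mono ?_ h2) (fil_mono le_rfl h3)))
    · rw [← hd_def]; omega
    · rw [← hd_def]; omega
  let L : V →ₗ[ZMod p] (Fin M × Fin (d - 1) → fil (ZMod p) (cx f) (cy f) w m) :=
    LinearMap.pi fun q => (lin q.1 q.2).codRestrict _ fun v => hlinm _ q.1.2 _ v
  obtain ⟨hfin, hrank⟩ := finrank_fil_le hf hw m
  have hker : LinearMap.ker L ≠ ⊥ := by
    refine LinearMap.ker_ne_bot_of_finrank_lt ?_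
    rw [Module.finrank_pi_fintype, Module.finrank_fintype_fun_eq_card]
    simp only [Finset.sum_const, Finset.card_univ, Fintype.card_prod, Fintype.card_fin, smul_eq_mul]
    refine lt_of_le_of_lt ?_ hAB
    rw [mul_assoc]
    exact Nat.mul_le_mul_left _ (Nat.mul_le_mul_left _ hrank)
  obtain ⟨v, hv, hv0⟩ := Submodule.exists_mem_ne_zero_of_ne_bot hker
  refine ⟨fun i l => α i l v, fun i l => hα i l v, ?_, ?_⟩
  · obtain ⟨⟨⟨u, k⟩, ⟨i, l⟩⟩, hq⟩ := Function.ne_iff.1 hv0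
    refine ⟨i, i.2, l, l.2, fun h0 => hq ?_⟩
    simp only [α, i.2, l.2, and_self, dite_true] at h0
    rw [LinearMap.sum_apply] at h0
    let P : (ZMod p)[X][X] := ∑ q : Fin A × Fin d, C (C (v (q, (i, l))) * X ^ (q.1 : ℕ)) * X ^ (q.2 : ℕ)
    have hP : AdjoinRoot.mk f P = 0 := by
      rw [← h0, map_sum]
      refine Finset.sum_congr rfl fun q _ => ?_
      rw [map_mul, map_pow, AdjoinRoot.mk_X, AdjoinRoot.mk_C, map_mul, map_pow]
      have hz : ∀ z, AdjoinRoot.of f (C z) = algebraMap (ZMod p) (AdjoinRoot f) z := fun _ => rfl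
      simp only [hz, Algebra.smul_def, mul_assoc, LinearMap.comp_apply, LinearMap.toSpanSingleton_apply]
      rfl
    have hPd : P.degree < f.degree := by
      rw [degree_eq_natDegree hf.ne_zero]
      refine (degree_sum_le _ _).trans_lt ?_
      rw [Finset.sup_lt_iff (WithBot.bot_lt_coe _)]
      intro q _
      refine (degree_C_mul_X_pow_le _ _).trans_lt ?_
      exact_mod_cast q.2.2
    have hP0 : P = 0 := by
      by_contra h
      exact AdjoinRoot.mk_ne_zero_of_degree_lt hf h hPd hP
    have := congr_arg (fun P => (P.coeff (k : ℕ)).coeff (u : ℕ)) hP0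
    simp only [P, finsetSum_coeff, coeff_C_mul, coeff_X_pow, mul_ite, mul_one, mul_zero,
      coeff_zero] at this
    rw [Finset.sum_eq_single (u, k)] at this
    · rw [if_pos rfl, coeff_C_mul, coeff_X_pow, if_pos rfl, mul_one] at this
      exact this
    · intro q _ hne
      split_ifs with h1
      · rw [coeff_C_mul, coeff_X_pow, if_neg, mul_zero]
        intro h2
        exact hne (Prod.ext (Fin.ext h2.symm) (Fin.ext h1.symm))
      · simp
    · simp
  · intro j hj l hl
    rw [← hlin]
    have := congr_fun (LinearMap.mem_ker.1 hv) (⟨j, hj⟩, ⟨l, hl⟩)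
    simpa [L] using congr_arg Subtype.val this

lemma iterate_derivation_mul_pow (D : Derivation (ZMod p) (AdjoinRoot f) (AdjoinRoot f)) (a u : AdjoinRoot f)
    (j : ℕ) : D^[j] (a * u ^ p) = D^[j] a * u ^ p := by
  have h0 : (p : AdjoinRoot f) = 0 := by
    rw [← map_natCast (algebraMap (ZMod p) (AdjoinRoot f)) p]; simp
  induction j with
  | zero => rfl
  | succ j ih =>
    rw [Function.iterate_succ_apply', ih, Function.iterate_succ_apply', Derivation.leibniz,
      Derivation.leibniz_pow]
    simp [h0, mul_comm]

theorem card_mul_le_of_pointless (hf : f.Monic) (hw : ∀ i, (f.coeff i).natDegree ≤ w)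
    (hd : 1 ≤ f.natDegree)
    (hirr : ∀ (E : Type) [Field E] [Algebra (ZMod p) E],
      Irreducible (f.map (mapRingHom (algebraMap (ZMod p) E))))
    (hS : Pointless f ρ S) {A B M : ℕ} (hM : M < p)
    (hmp : 2 * f.natDegree * (A + w * f.natDegree) < p)
    (hAB : M * ((f.natDegree - 1) * ((A + w * f.natDegree + M * (w * f.natDegree) + B
      + w * f.natDegree + 1) * f.natDegree)) < A * f.natDegree * (B * f.natDegree)) :
    M * S.card ≤ A + w * f.natDegree + p * B + p * (w * f.natDegree) := by
  set d := f.natDegree with hd_def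
  have hirrf : Irreducible f := by
    have := hirr (ZMod p)
    rwa [Algebra.algebraMap_self, mapRingHom_id, Polynomial.map_id] at this
  have : IsDomain (AdjoinRoot f) := AdjoinRoot.isDomain_of_prime hirrf.prime
  obtain ⟨D, hDx, hD⟩ := exists_derivation_fil hf hw
  obtain ⟨a, ha, hne, hcond⟩ := exists_auxiliary hf hw D hD hAB
  set G : (ZMod p)[X] := ∏ s ∈ S, (X - C s) with hG
  set g := AdjoinRoot.of f G with hg
  set aux := ∑ l ∈ Finset.range d, ∑ i ∈ Finset.range B, a i l * cx f ^ (p * i) * cy f ^ (p * l)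
    with haux
  have hx : g ∣ cx f ^ p - cx f := by
    have := map_dvd (AdjoinRoot.of f) (prod_dvd_X_pow_sub_X S)
    rwa [map_sub, map_pow] at this
  have haux0 : aux ≠ 0 := frobenius_sum_ne_zero hf hw hirr hmp (eval₂_frobenius f) a ha hne
  have hdvd : ∀ j < M, g ∣ D^[j] aux := by
    intro j hj
    have e1 : D^[j] aux = ∑ l ∈ Finset.range d, ∑ i ∈ Finset.range B,
        D^[j] (a i l) * (cx f ^ p) ^ i * (cy f ^ p) ^ l := by
      have hit : ∀ z, D^[j] z = ((D : AdjoinRoot f →ₗ[ZMod p] AdjoinRoot f) ^ j) z := fun z => by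
        rw [Module.End.pow_apply]; rfl
      rw [hit, haux, map_sum]
      refine Finset.sum_congr rfl fun l _ => ?_
      rw [map_sum]
      refine Finset.sum_congr rfl fun i _ => ?_
      have : a i l * cx f ^ (p * i) * cy f ^ (p * l) = a i l * (cx f ^ i * cy f ^ l) ^ p := by ring
      rw [← hit, this, iterate_derivation_mul_pow]
      ring
    rw [← Ideal.mem_span_singleton, ← Ideal.Quotient.eq_zero_iff_mem] at hx ⊢
    have hq := dvd_sum_quotCoeff hf hS
    rw [← hG, ← hg, ← Ideal.mem_span_singleton, ← Ideal.Quotient.eq_zero_iff_mem] at hq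
    set π := Ideal.Quotient.mk (Ideal.span {g}) with hπ
    rw [map_sub, sub_eq_zero, map_pow] at hx
    have hrange : d = (d - 1) + 1 := by omega
    have hq' : π (cy f ^ p) ^ (d - 1) = - ∑ l ∈ Finset.range (d - 1), π (quotCoeff f l) * π (cy f ^ p) ^ l := by
      rw [← hd_def, hrange, Finset.sum_range_succ, hd_def, quotCoeff_last hf hd, one_mul, map_add] at hq
      rw [← hd_def] at hq
      rw [← map_pow, eq_neg_of_add_eq_zero_right hq, map_sum]
      simp only [map_mul, map_pow]
    have key : ∑ l ∈ Finset.range (d - 1), π (∑ i ∈ Finset.range B, cx f ^ i * (D^[j] (a i l) -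
        quotCoeff f l * D^[j] (a i (d - 1)))) * π (cy f ^ p) ^ l = 0 :=
      Finset.sum_eq_zero fun l hl => by
        rw [hcond j hj l (Finset.mem_range.1 hl), map_zero, zero_mul]
    rw [e1, ← key, map_sum, hrange, Finset.sum_range_succ, ← hrange]
    simp only [map_sum, map_mul, map_pow, hx, map_sub] at hq' ⊢
    simp only [← Finset.sum_mul, hq']
    rw [mul_neg, ← sub_eq_add_neg, Finset.mul_sum, ← Finset.sum_sub_distrib]
    refine Finset.sum_congr rfl fun l _ => ?_
    rw [Finset.sum_mul, Finset.sum_mul, Finset.sum_mul, ← Finset.sum_sub_distrib]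
    refine Finset.sum_congr rfl fun i _ => ?_
    ring
  have hunit : IsUnit ((M.factorial : ℕ) : AdjoinRoot f) := by
    have : IsUnit ((M.factorial : ℕ) : ZMod p) := by
      rw [isUnit_iff_ne_zero, Ne, ZMod.natCast_eq_zero_iff, (Fact.out : p.Prime).dvd_factorial]
      omega
    have := this.map (algebraMap (ZMod p) (AdjoinRoot f))
    rwa [map_natCast] at this
  obtain ⟨b, hb⟩ := pow_dvd_of_iterate_derivation D (isCoprime_derivation hS D hDx) M hunit hdvd
  have hfil : aux ∈ fil (ZMod p) (cx f) (cy f) w (A + w * d + p * B + p * (w * d)) := by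
    refine sum_mem fun l hl => sum_mem fun i hi => ?_
    rw [Finset.mem_range] at hl hi
    have h2 : p * l * w ≤ p * (w * d) := by
      rw [mul_assoc, mul_comm w]; exact Nat.mul_le_mul_left _ (Nat.mul_le_mul_right _ hl.le)
    have h1 : p * i * 1 ≤ p * B := by rw [mul_one]; exact Nat.mul_le_mul_left _ hi.le
    refine fil_mono ?_ (mul_mem_fil (mul_mem_fil (ha i l) (pow_mem_fil (left_mem_fil le_rfl) (p * i)))
      (pow_mem_fil (right_mem_fil le_rfl) _))
    rw [← hd_def]
    omega
  obtain ⟨k, hk⟩ : ∃ k, (AdjoinRoot.modByMonicHom hf aux).coeff k ≠ 0 := by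
    by_contra! h
    refine haux0 ?_
    rw [← AdjoinRoot.mk_leftInverse hf aux]
    have : AdjoinRoot.modByMonicHom hf aux = 0 := by ext k : 1; rw [h k, coeff_zero]
    rw [this, map_zero]
  have h1 := natDegree_coeff_modByMonicHom_le hf hw hfil k
  have h2 : G ^ M ∣ (AdjoinRoot.modByMonicHom hf aux).coeff k := by
    have : aux = (G ^ M) • b := by
      rw [hb, Algebra.smul_def, AdjoinRoot.algebraMap_eq, map_pow]
    rw [this, map_smul, coeff_smul, smul_eq_mul]
    exact Dvd.intro _ rfl
  have h3 := natDegree_le_of_dvd h2 hk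
  rw [natDegree_pow, hG, natDegree_prod_of_monic _ _ fun s _ => monic_X_sub_C s] at h3
  simp only [natDegree_X_sub_C, Finset.sum_const, smul_eq_mul, mul_one] at h3
  exact h3.trans h1

end PointCount

namespace PointCount
open Polynomial

/-- A weak form of the Lang–Weil lower bound for plane curves. -/
theorem exists_le_card_points (d w : ℕ) (hd : 1 ≤ d) : ∃ p₀ : ℕ, ∀ (p : ℕ) [Fact p.Prime], p₀ < p →
    ∀ (f : (ZMod p)[X][X]) (ρ : (ZMod p)[X]), f.Monic → f.natDegree = d →
      (∀ i, (f.coeff i).natDegree ≤ w) →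
      (∀ (E : Type) [Field E] [Algebra (ZMod p) E],
        Irreducible (f.map (mapRingHom (algebraMap (ZMod p) E)))) →
      ρ ≠ 0 → (∃ U V : (ZMod p)[X][X], f * U + derivative f * V = C ρ) →
      p ≤ 4 * d * (({s : ZMod p | ρ.eval s ≠ 0 ∧ ∃ c, (f.eval (C c)).eval s = 0} : Set (ZMod p)).ncard
        + ρ.natDegree) := by
  classical
  set q := 2 * (1 + w * d) with hq
  set M := d * q with hM
  set B := (d - 1) * q + 1 with hB
  set A := q * (d - 1) * (w * d + M * (w * d) + B + w * d + 1) + 1 with hA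
  refine ⟨4 * d * (A + w * d) + M, fun p _ hp f ρ hf hfd hw hirr hρ hdvd => ?_⟩
  set S : Finset (ZMod p) := {s : ZMod p | ρ.eval s ≠ 0 ∧ ∀ c, (f.eval (C c)).eval s ≠ 0} with hSdef
  have hS : Pointless f ρ S := ⟨hdvd, fun s hs => ((Finset.mem_filter.1 hs).2).1,
    fun s hs => ((Finset.mem_filter.1 hs).2).2⟩
  have h1 : 4 * d * (A + w * d) = 2 * (2 * d * (A + w * d)) := by ring
  have key := card_mul_le_of_pointless hf hw (hfd ▸ hd) hirr hS (A := A) (B := B) (M := M) (by omega)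
    (by rw [hfd]; omega) (by
      rw [hfd]
      obtain ⟨e, rfl⟩ : ∃ e, d = e + 1 := ⟨d - 1, by omega⟩
      simp only [add_tsub_cancel_right] at hA hB ⊢
      set T := w * (e + 1) + M * (w * (e + 1)) + B + w * (e + 1) + 1 with hT
      have e1 : A + w * (e + 1) + M * (w * (e + 1)) + B + w * (e + 1) + 1 = A + T := by omega
      rw [e1, hB, hM]
      have : A * (e + 1) * ((e * q + 1) * (e + 1)) =
        (e + 1) * q * (e * ((A + T) * (e + 1))) + (e + 1) * (e + 1) * (A - q * e * T) := by
        have : A - q * e * T = 1 := by omega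
        rw [this, hA]; ring
      have h3 : A - q * e * T = 1 := by omega
      rw [this, h3]
      have : 0 < (e + 1) * (e + 1) := by positivity
      omega)
  rw [hfd] at key
  have hpA : 4 * (A + w * d) ≤ p := by
    have : 4 * (A + w * d) ≤ 4 * d * (A + w * d) := Nat.mul_le_mul_right _ (by omega)
    omega
  have hS4 : 4 * d * S.card + p ≤ 4 * d * p := by
    have hq0 : 0 < q := by omega
    refine Nat.le_of_mul_le_mul_left ?_ hq0
    have e2 : q * (4 * d * S.card + p) = 4 * (M * S.card) + q * p := by rw [hM]; ring
    have e3 : 4 * (M * S.card) ≤ p + 4 * (p * B) + 4 * (p * (w * d)) := by omega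
    obtain ⟨e, rfl⟩ : ∃ e, d = e + 1 := ⟨d - 1, by omega⟩
    have e4 : p + 4 * (p * B) + 4 * (p * (w * (e + 1))) + q * p ≤ q * (4 * (e + 1) * p) := by
      rw [hB, add_tsub_cancel_right]
      have : 4 * (p * (e * q + 1)) + 4 * (p * (w * (e + 1))) = 4 * e * q * p + 2 * q * p := by
        rw [hq]; ring
      have h5 : q * (4 * (e + 1) * p) = 4 * e * q * p + 2 * q * p + q * p + q * p := by ring
      have h6 : p ≤ q * p := Nat.le_mul_of_pos_left _ hq0
      omega
    omega
  set T : Finset (ZMod p) := {s : ZMod p | ρ.eval s ≠ 0 ∧ ∃ c, (f.eval (C c)).eval s = 0} with hT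
  have hTset : ({s : ZMod p | ρ.eval s ≠ 0 ∧ ∃ c, (f.eval (C c)).eval s = 0} : Set (ZMod p)) = ↑T := by
    ext; simp [hT]
  rw [hTset, Set.ncard_coe_finset]
  have hcover : (Finset.univ : Finset (ZMod p)) ⊆ (S ∪ T) ∪ ρ.roots.toFinset := by
    intro s _
    simp only [Finset.mem_union, hSdef, hT, Finset.mem_filter, Finset.mem_univ, true_and,
      Multiset.mem_toFinset, mem_roots hρ, IsRoot.def]
    by_cases h : ρ.eval s = 0
    · exact Or.inr h
    · by_cases h' : ∃ c, (f.eval (C c)).eval s = 0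
      · exact Or.inl (Or.inr ⟨h, h'⟩)
      · exact Or.inl (Or.inl ⟨h, not_exists.1 h'⟩)
  have hcard := (Finset.card_le_card hcover).trans ((Finset.card_union_le _ _).trans
    (Nat.add_le_add_right (Finset.card_union_le _ _) _))
  rw [Finset.card_univ, ZMod.card] at hcard
  have hroots := (Multiset.toFinset_card_le ρ.roots).trans (card_roots' ρ)
  have := Nat.mul_le_mul_left (4 * d) (hcard.trans (Nat.add_le_add_left hroots _))
  rw [mul_add, mul_add] at this
  rw [mul_add]
  omega

end PointCount

namespace PointCount
open Polynomial IntermediateField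

section FiniteClosure

variable {K L : Type*} [Field K] [Field L] [Algebra K L]

lemma linearIndependent_adjoin_of_isAlgebraic {s : Set L}
    (hs : AlgebraicIndependent K ((↑) : s → L)) {ι : Type*} {b : ι → algebraicClosure K L}
    (hb : LinearIndependent K b) :
    LinearIndependent (Algebra.adjoin K s) (fun i => (b i : L)) := by
  rw [linearIndependent_iff']
  intro t g hg i hi
  have hP : ∀ i, ∃ P : MvPolynomial s K, MvPolynomial.aeval ((↑) : s → L) P = g i := by
    intro i
    have h := (g i).2
    have e := Algebra.adjoin_range_eq_range_aeval K ((↑) : s → L)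
    rw [Subtype.range_coe] at e
    have h' : (g i : L) ∈ (MvPolynomial.aeval ((↑) : s → L) : _ →ₐ[K] L).range := e ▸ h
    exact h'
  choose P hP using hP
  have hQ : MvPolynomial.aeval ((↑) : s → L)
      (∑ i ∈ t, MvPolynomial.C (b i) * MvPolynomial.map (algebraMap K (algebraicClosure K L)) (P i))
        = 0 := by
    rw [map_sum, ← hg]
    refine Finset.sum_congr rfl fun i _ => ?_
    rw [map_mul, MvPolynomial.aeval_map_algebraMap, hP, MvPolynomial.aeval_C, mul_comm,
      Subalgebra.smul_def, smul_eq_mul]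
    rfl
  have hQ0 := (hs.algebraicClosure).eq_zero_of_aeval_eq_zero _ hQ
  have hPi : P i = 0 := by
    ext m
    have h := congr_arg (MvPolynomial.coeff m) hQ0
    rw [MvPolynomial.coeff_sum] at h
    simp only [MvPolynomial.coeff_C_mul, MvPolynomial.coeff_map, MvPolynomial.coeff_zero] at h ⊢
    refine linearIndependent_iff'.1 hb t (fun i => MvPolynomial.coeff m (P i)) ?_ i hi
    rw [← h]
    exact Finset.sum_congr rfl fun i _ => by rw [Algebra.smul_def, mul_comm]
  ext
  rw [← hP i, hPi, map_zero]
  rfl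

open scoped IntermediateField.algebraAdjoinAdjoin in
/-- The algebraic closure of the base field in a finitely generated extension is finite. -/
theorem finite_algebraicClosure (K L : Type*) [Field K] [Field L] [Algebra K L]
    [Algebra.EssFiniteType K L] : Module.Finite K (algebraicClosure K L) := by
  obtain ⟨s, hs⟩ := exists_finset_isTranscendenceBasis K L
  have h1 : Algebra.IsAlgebraic (adjoin K (s : Set L)) L := by
    have e : Set.range ((↑) : s → L) = (s : Set L) := Subtype.range_coe
    exact e ▸ hs.isAlgebraic_field
  have h2 : Algebra.EssFiniteType (adjoin K (s : Set L)) L := Algebra.EssFiniteType.of_comp K _ L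
  have h3 : Module.Finite (adjoin K (s : Set L)) L :=
    Algebra.finite_of_essFiniteType_of_isAlgebraic
  let b := Module.Basis.ofVectorSpace K (algebraicClosure K L)
  have h4 := linearIndependent_adjoin_of_isAlgebraic (s := (s : Set L)) hs.1 b.linearIndependent
  rw [LinearIndependent.iff_fractionRing (Algebra.adjoin K (s : Set L)) (adjoin K (s : Set L))] at h4
  have := h4.finite
  exact Module.Finite.of_basis b

end FiniteClosure

lemma isAlgebraic_of_forall {A F L : Type*} [CommRing A] [IsDomain A] [Field F] [Field L] [Algebra A L]
    [Algebra F L] (h : ∀ c : F, IsAlgebraic A (algebraMap F L c)) {z : L} (hz : IsAlgebraic F z) :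
    IsAlgebraic A z := by
  let i : F →+* Subalgebra.algebraicClosure A L := (algebraMap F L).codRestrict _ h
  let _ : Algebra F (Subalgebra.algebraicClosure A L) := i.toAlgebra
  have : IsScalarTower F (Subalgebra.algebraicClosure A L) L := .of_algebraMap_eq fun _ => rfl
  have h1 : IsAlgebraic (Subalgebra.algebraicClosure A L) z := hz.extendScalars i.injective
  exact h1.restrictScalars A

section Zariski

lemma exists_eq_div_of_eval₂_eq_zero {K E : Type*} [Field K] [Field E] [Algebra K E]
    (hK : ∀ z : E, IsAlgebraic K z → z ∈ (algebraMap K E).range)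
    {z : FractionRing E[X]} {q : K[X][X]} (hq : q ≠ 0)
    (hz : q.eval₂ ((algebraMap E[X] (FractionRing E[X])).comp (mapRingHom (algebraMap K E))) z = 0) :
    ∃ P Q : K[X], Q ≠ 0 ∧ algebraMap E[X] (FractionRing E[X]) (Q.map (algebraMap K E)) * z =
      algebraMap _ _ (P.map (algebraMap K E)) := by
  let _ : Algebra K[X] E[X] := Polynomial.algebra K E
  have hz' : IsAlgebraic K[X] z := ⟨q, hq, hz⟩
  obtain ⟨Q, hQ, hQz⟩ := hz'.exists_integral_multiple
  have h1 : IsIntegral E[X] (Q • z) := hQz.tower_top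
  obtain ⟨P, hP⟩ := IsIntegrallyClosed.isIntegral_iff.1 h1
  rw [← hP] at hQz
  have h2 : IsIntegral K[X] P := by
    refine (isIntegral_algHom_iff (IsScalarTower.toAlgHom K[X] E[X] (FractionRing E[X]))
      (IsFractionRing.injective E[X] (FractionRing E[X]))).1 hQz
  have h3 : P ∈ lifts (algebraMap K E) := by
    rw [lifts_iff_coeff_lifts]
    intro n
    exact hK _ (isIntegral_iff_isIntegral_coeff.1 h2 n).isAlgebraic
  obtain ⟨P', hP'⟩ := (mem_lifts _).1 h3
  refine ⟨P', Q, hQ, ?_⟩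
  rw [hP', hP, Algebra.smul_def, IsScalarTower.algebraMap_apply K[X] E[X]]
  rfl

variable {K L : Type*} [Field K] [Field L] [Algebra K L]

lemma mem_adjoin_of_mem_adjoin (hK : ∀ z : L, IsAlgebraic K z → z ∈ (algebraMap K L).range)
    (E : IntermediateField K L) {v : L} (hv : Transcendental E v) {z : L}
    (hz : z ∈ adjoin E {v}) (hzv : IsAlgebraic K⟮v⟯ z) : z ∈ K⟮v⟯ := by
  obtain ⟨P, Q, rfl⟩ := (mem_adjoin_simple_iff E z).1 hz
  have hE : ∀ z : E, IsAlgebraic K z → z ∈ (algebraMap K E).range := fun z hz => by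
    obtain ⟨a, ha⟩ := hK (z : L) (hz.algHom E.val)
    exact ⟨a, Subtype.ext ha⟩
  have hinj : Function.Injective (aeval v : E[X] →ₐ[E] L) := transcendental_iff_injective.1 hv
  let ι : FractionRing E[X] →+* L := IsFractionRing.lift (g := (aeval v : E[X] →ₐ[E] L).toRingHom) hinj
  have hι : ∀ q, ι (algebraMap _ _ q) = aeval v q := fun q => IsFractionRing.lift_algebraMap _ _
  have hz' : aeval v P / aeval v Q = ι (algebraMap _ _ P / algebraMap _ _ Q) := by
    rw [map_div₀, hι, hι]
  let _ : Algebra K[X] L := (aeval v : K[X] →ₐ[K] L).toAlgebra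
  have hvK : Function.Injective (aeval v : K[X] →ₐ[K] L) := by
    refine transcendental_iff_injective.1 (hv.restrictScalars (algebraMap K E).injective)
  have h1 : IsAlgebraic K[X] (aeval v P / aeval v Q) := by
    refine isAlgebraic_of_forall (fun c => ?_) hzv
    obtain ⟨r, s, hrs⟩ := (mem_adjoin_simple_iff K _).1 c.2
    have : algebraMap K⟮v⟯ L c = algebraMap K[X] L r / algebraMap K[X] L s := hrs
    rw [this, div_eq_mul_inv]
    have : FaithfulSMul K[X] L := (faithfulSMul_iff_algebraMap_injective _ _).2 hvK
    exact (isAlgebraic_algebraMap r).mul (isAlgebraic_algebraMap s).inv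
  obtain ⟨q, hq0, hq⟩ := h1
  have h2 : q.eval₂ ((algebraMap E[X] (FractionRing E[X])).comp (mapRingHom (algebraMap K E)))
      (algebraMap _ _ P / algebraMap _ _ Q) = 0 := by
    refine ι.injective ?_
    rw [hom_eval₂, map_zero, ← hz', ← hq, aeval_def]
    congr 1
    ext a
    · simp only [RingHom.comp_apply, hι, coe_mapRingHom, map_C, aeval_C]
      exact (aeval_C (R := K) v a).symm
    · simp only [RingHom.comp_apply, hι, coe_mapRingHom, map_X, aeval_X]
      exact (aeval_X (R := K) v).symm
  obtain ⟨A, B, hB, hAB⟩ := exists_eq_div_of_eval₂_eq_zero hE hq0 h2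
  have := congr_arg ι hAB
  rw [map_mul, hι, hι, ← hz', aeval_map_algebraMap, aeval_map_algebraMap] at this
  have hB' : aeval v B ≠ 0 := fun h => hB (hvK (by rw [h, map_zero]))
  exact (mem_adjoin_simple_iff K _).2 ⟨A, B, by rw [eq_div_iff hB', mul_comm, this]⟩

end Zariski
end PointCount

namespace PointCount
open Polynomial IntermediateField

section Zariski

variable {K L : Type*} [Field K] [Field L] [Algebra K L]

lemma not_forall_isAlgebraic_adjoin_simple {x : Fin 2 → L} (hx : AlgebraicIndependent K x) (u : L) :
    ¬ ∀ i, IsAlgebraic K⟮u⟯ (x i) := by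
  intro h
  let E := algebraicClosure K⟮u⟯ L
  let u' : E := algebraMap K⟮u⟯ E (AdjoinSimple.gen K u)
  have hu' : (u' : L) = u := rfl
  have h1 : Algebra.IsAlgebraic (Algebra.adjoin K {u'}) E := by
    refine ⟨fun z => isAlgebraic_of_forall (F := K⟮u⟯) (fun c => ?_)
      (isAlgebraic_algebraMap_iff (A := L) E.val.injective |>.1 (mem_algebraicClosure_iff.1 z.2))⟩
    obtain ⟨r, s, hrs⟩ := (mem_adjoin_simple_iff K _).1 c.2
    have h2 : algebraMap K⟮u⟯ E c = aeval u' r / aeval u' s := by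
      have e : ∀ q : K[X], ((aeval u' q : E) : L) = aeval u q := fun q =>
        (aeval_algHom_apply (E.val.restrictScalars K) u' q).symm
      refine Subtype.ext ?_
      rw [IntermediateField.coe_div, e, e, ← hrs]
      rfl
    rw [h2, div_eq_mul_inv]
    have h3 : ∀ q : K[X], IsAlgebraic (Algebra.adjoin K {u'}) (aeval u' q : E) := fun q =>
      isAlgebraic_algebraMap (⟨_, aeval_mem_adjoin_singleton K u'⟩ : Algebra.adjoin K {u'})
    exact (h3 r).mul (h3 s).inv
  have h2 := Algebra.IsAlgebraic.trdeg_le_cardinalMk K ({u'} : Set E)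
  let y : Fin 2 → E := fun i => ⟨x i, mem_algebraicClosure_iff.2 (h i)⟩
  have hy : AlgebraicIndependent K y := AlgebraicIndependent.of_comp (E.val.restrictScalars K) hx
  have h3 := hy.lift_cardinalMk_le_trdeg.trans (Cardinal.lift_le.2 h2)
  simp at h3

/-- A finitely generated regular extension of transcendence degree at least two contains
a transcendental element `x` such that `K(x)` is algebraically closed in it. -/
theorem exists_transcendental_isAlgebraicallyClosed [CharZero K] [Algebra.EssFiniteType K L]
    (hK : ∀ z : L, IsAlgebraic K z → z ∈ (algebraMap K L).range) {x : Fin 2 → L}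
    (hx : AlgebraicIndependent K x) :
    ∃ u : L, Transcendental K u ∧ ∀ z : L, IsAlgebraic K⟮u⟯ z → z ∈ K⟮u⟯ := by
  have : CharZero L := charZero_of_injective_algebraMap (algebraMap K L).injective
  let u : ℕ → L := fun c => x 0 + c * x 1
  let M := adjoin K {x 0, x 1}
  have h0 : x 0 ∈ M := subset_adjoin _ _ (by simp)
  have h1 : x 1 ∈ M := subset_adjoin _ _ (by simp)
  have hu : ∀ c, K⟮u c⟯ ≤ M := fun c => adjoin_simple_le_iff.2
    (add_mem h0 (mul_mem (_root_.natCast_mem _ _) h1))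
  let E := algebraicClosure M L
  have : Algebra.EssFiniteType M L := Algebra.EssFiniteType.of_comp K M L
  have : Module.Finite M E := finite_algebraicClosure M L
  have : Finite (IntermediateField M E) :=
    Field.finite_intermediateField_of_exists_primitive_element M E (Field.exists_primitive_element M E)
  obtain ⟨c, c', hcc, hV⟩ := Finite.exists_ne_map_eq_of_infinite
    (fun c : ℕ => adjoin M {z : E | IsAlgebraic K⟮u c⟯ (z : L)})
  let E' := (algebraicClosure K⟮u c'⟯ L).restrictScalars K
  have hE' : ∀ z, z ∈ E' ↔ IsAlgebraic K⟮u c'⟯ z := fun z => mem_algebraicClosure_iff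
  have hc : (c : L) - c' ≠ 0 := sub_ne_zero.2 (by exact_mod_cast hcc)
  have huE : u c' ∈ E' := (hE' _).2 (isAlgebraic_algebraMap (AdjoinSimple.gen K (u c')))
  have key : ∀ G : IntermediateField K L, u c ∈ G → u c' ∈ G → x 0 ∈ G ∧ x 1 ∈ G := by
    intro G h h'
    have e1 : x 1 = (u c - u c') / (c - c') := by
      rw [eq_div_iff hc]; simp only [u]; ring
    have hx1 : x 1 ∈ G := by
      rw [e1]
      exact div_mem (sub_mem h h') (sub_mem (_root_.natCast_mem _ _) (_root_.natCast_mem _ _))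
    have e0 : x 0 = u c' - c' * x 1 := by simp only [u]; ring
    exact ⟨by rw [e0]; exact sub_mem h' (mul_mem (_root_.natCast_mem _ _) hx1), hx1⟩
  have hMle : M ≤ (adjoin E' {u c}).restrictScalars K := by
    have := key ((adjoin E' {u c}).restrictScalars K) (mem_adjoin_simple_self E' (u c))
      ((adjoin E' {u c}).algebraMap_mem ⟨u c', huE⟩)
    refine adjoin_le_iff.2 ?_
    rintro z (rfl | rfl)
    · exact this.1
    · exact this.2
  have htr : Transcendental E' (u c) := by
    intro halg
    have h2 : u c ∈ E' := by
      rw [hE']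
      exact isAlgebraic_of_forall (F := E') (fun c => (hE' _).1 c.2) halg
    have := key E' h2 huE
    refine not_forall_isAlgebraic_adjoin_simple hx (u c') fun i => ?_
    fin_cases i
    · exact (hE' _).1 this.1
    · exact (hE' _).1 this.2
  refine ⟨u c, htr.restrictScalars (algebraMap K E').injective, fun z hz => ?_⟩
  refine mem_adjoin_of_mem_adjoin hK E' htr ?_ hz
  have hzM : IsAlgebraic M z := by
    refine isAlgebraic_of_forall (F := K⟮u c⟯) (fun w => ?_) hz
    exact isAlgebraic_algebraMap (⟨w, hu c w.2⟩ : M)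
  have hzV : (⟨z, mem_algebraicClosure_iff.2 hzM⟩ : E) ∈ adjoin M {z : E | IsAlgebraic K⟮u c⟯ (z : L)} :=
    subset_adjoin _ _ hz
  rw [show adjoin M {z : E | IsAlgebraic K⟮u c⟯ (z : L)} = adjoin M {z : E | IsAlgebraic K⟮u c'⟯ (z : L)}
    from hV] at hzV
  have : ∀ w : E, w ∈ adjoin M {z : E | IsAlgebraic K⟮u c'⟯ (z : L)} → (w : L) ∈ adjoin E' {u c} := by
    intro w hw
    refine adjoin_induction (E := E) M (s := {z : E | IsAlgebraic K⟮u c'⟯ (z : L)})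
      (p := fun w _ => (w : L) ∈ adjoin E' {u c}) ?_ ?_ ?_ ?_ ?_ hw
    · exact fun w hw => (adjoin E' {u c}).algebraMap_mem ⟨w, (hE' _).2 hw⟩
    · exact fun m => hMle m.2
    · exact fun _ _ _ _ h h' => add_mem h h'
    · exact fun _ _ h => inv_mem h
    · exact fun _ _ _ _ h h' => mul_mem h h'
  exact this _ hzV

end Zariski
end PointCount

namespace PointCount
open Polynomial

/-- `A` has at least a constant times `p ^ s` points over `𝔽_p`, even outside
any given hypersurface, for all large primes `p` satisfying `P`. -/
def ManyPoints (P : ℕ → Prop) (s : ℕ) (A : Type) [CommRing A] : Prop :=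
  ∀ δ : A, δ ≠ 0 → ∃ ε : ℝ, 0 < ε ∧ ∃ p₀ : ℕ, ∀ (p : ℕ) [Fact p.Prime], p₀ < p → P p →
    ∃ S : Finset (A →+* ZMod p), (∀ ψ ∈ S, ψ δ ≠ 0) ∧ ε * (p : ℝ) ^ s ≤ S.card

section ManyPoints

variable {P : ℕ → Prop} {s : ℕ} {A B : Type} [CommRing A] [CommRing B]

lemma ManyPoints.of_fibration [Algebra A B] (hA : ManyPoints P s A)
    (H : ∀ b : B, b ≠ 0 → ∃ a : A, a ≠ 0 ∧ ∃ c : ℝ, 0 < c ∧ ∃ p₀ : ℕ, ∀ (p : ℕ) [Fact p.Prime],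
      p₀ < p → ∀ ψ : A →+* ZMod p, ψ a ≠ 0 → ∃ T : Finset (B →+* ZMod p),
        (∀ φ ∈ T, φ b ≠ 0 ∧ φ.comp (algebraMap A B) = ψ) ∧ c * p ≤ T.card) :
    ManyPoints P (s + 1) B := by
  classical
  intro b hb
  obtain ⟨a, ha, c, hc, p₁, h₁⟩ := H b hb
  obtain ⟨ε, hε, p₂, h₂⟩ := hA a ha
  refine ⟨ε * c, mul_pos hε hc, max p₁ p₂, fun p _ hp hP => ?_⟩
  obtain ⟨S, hS, hScard⟩ := h₂ p (lt_of_le_of_lt (le_max_right _ _) hp) hP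
  have h₃ : ∀ ψ : S, ∃ T : Finset (B →+* ZMod p),
      (∀ φ ∈ T, φ b ≠ 0 ∧ φ.comp (algebraMap A B) = ψ) ∧ c * p ≤ T.card := fun ψ =>
    h₁ p (lt_of_le_of_lt (le_max_left _ _) hp) ψ (hS ψ ψ.2)
  choose T hT hTcard using h₃
  refine ⟨S.attach.biUnion T, ?_, ?_⟩
  · intro φ hφ
    obtain ⟨ψ, -, hψ⟩ := Finset.mem_biUnion.1 hφ
    exact (hT ψ φ hψ).1
  · rw [Finset.card_biUnion]
    · have h : ∑ ψ ∈ S.attach, c * (p : ℝ) ≤ ∑ ψ ∈ S.attach, ((T ψ).card : ℝ) :=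
        Finset.sum_le_sum fun ψ _ => hTcard ψ
      rw [Finset.sum_const, Finset.card_attach, nsmul_eq_mul] at h
      push_cast
      refine le_trans ?_ h
      calc ε * c * (p : ℝ) ^ (s + 1) = (ε * p ^ s) * (c * p) := by ring
        _ ≤ _ := by gcongr
    · intro ψ _ ψ' _ hne
      refine Finset.disjoint_left.2 fun φ h h' => hne ?_
      exact Subtype.ext ((hT ψ φ h).2.symm.trans (hT ψ' φ h').2)

lemma manyPoints_zero_of_isIntegral [IsDomain A] [CharZero A] [Algebra.IsIntegral ℤ A]
    (hP : ∀ (p : ℕ) [Fact p.Prime], P p → Nonempty (A →+* ZMod p)) : ManyPoints P 0 A := by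
  intro δ hδ
  have h := Ideal.comap_ne_bot_of_integral_mem (R := ℤ) hδ (Ideal.mem_span_singleton_self δ)
    (Algebra.IsIntegral.isIntegral δ)
  obtain ⟨n, hn, hn0⟩ := Submodule.exists_mem_ne_zero_of_ne_bot h
  obtain ⟨a, ha⟩ := Ideal.mem_span_singleton.1 (Ideal.mem_comap.1 hn)
  refine ⟨1, one_pos, n.natAbs, fun p _ hp h => ?_⟩
  obtain ⟨ψ⟩ := hP p h
  refine ⟨{ψ}, ?_, by simp⟩
  intro ψ' _ h0
  have : ψ' (algebraMap ℤ A n) = 0 := by rw [ha, map_mul, h0, zero_mul]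
  rw [eq_intCast, map_intCast, ZMod.intCast_zmod_eq_zero_iff_dvd, Int.natCast_dvd] at this
  exact absurd (Nat.le_of_dvd (Int.natAbs_pos.2 hn0) this) (not_le.2 hp)

lemma ManyPoints.polynomial [IsDomain A] (hA : ManyPoints P s A) : ManyPoints P (s + 1) A[X] := by
  classical
  refine hA.of_fibration fun b hb => ⟨b.leadingCoeff, leadingCoeff_ne_zero.2 hb, 1 / 2, by norm_num,
    2 * b.natDegree, fun p _ hp ψ hψ => ?_⟩
  have hbψ : b.map ψ ≠ 0 := fun h => hψ (by
    rw [leadingCoeff, ← coeff_map, h, coeff_zero])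
  let T : Finset (ZMod p) := Finset.univ.filter fun x => (b.map ψ).eval x ≠ 0
  have hinj : Function.Injective (fun x : ZMod p => (eval₂RingHom ψ x : A[X] →+* ZMod p)) := by
    intro x y h
    have := RingHom.congr_fun h X
    simpa using this
  refine ⟨T.image fun x => eval₂RingHom ψ x, ?_, ?_⟩
  · intro φ hφ
    obtain ⟨x, hx, rfl⟩ := Finset.mem_image.1 hφ
    refine ⟨?_, ?_⟩
    · simpa [T, eval_map] using hx
    · ext a; simp
  · rw [Finset.card_image_of_injective _ hinj]
    have h1 : T.card + (b.map ψ).roots.toFinset.card ≥ p := by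
      have : (Finset.univ : Finset (ZMod p)) ⊆ T ∪ (b.map ψ).roots.toFinset := by
        intro x _
        by_cases hx : (b.map ψ).eval x = 0 <;> simp [T, hx, hbψ]
      have := (Finset.card_le_card this).trans (Finset.card_union_le _ _)
      simpa [ZMod.card] using this
    have h2 : (b.map ψ).roots.toFinset.card ≤ b.natDegree :=
      (Multiset.toFinset_card_le _).trans ((card_roots' _).trans natDegree_map_le)
    have h3 : (p : ℝ) ≤ 2 * T.card := by
      have : p ≤ 2 * T.card := by omega
      exact_mod_cast this
    linarith

lemma exists_ne_zero_dvd_of_adjoinRoot [IsDomain A] {f : A[X]} (hf : f.Monic) [IsDomain (AdjoinRoot f)]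
    {b : AdjoinRoot f} (hb : b ≠ 0) : ∃ ν : A, ν ≠ 0 ∧ b ∣ AdjoinRoot.of f ν := by
  have hintg : IsIntegral A b := by
    have := hf.finite_adjoinRoot
    exact Algebra.IsIntegral.isIntegral b
  have h := Ideal.comap_ne_bot_of_integral_mem (R := A) hb (Ideal.mem_span_singleton_self b) hintg
  obtain ⟨ν, hν, hν0⟩ := Submodule.exists_mem_ne_zero_of_ne_bot h
  exact ⟨ν, hν0, Ideal.mem_span_singleton.1 (Ideal.mem_comap.1 hν)⟩

lemma ManyPoints.adjoinRoot [IsDomain A] [CharZero A] (hA : ManyPoints P s A) {f : A[X][X]}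
    (hf : f.Monic) (hd : 1 ≤ f.natDegree) [IsDomain (AdjoinRoot f)] {δ : A} (hδ : δ ≠ 0)
    (hirr : ∀ (k : Type) [Field k] (ψ : A →+* k), ψ δ ≠ 0 → Irreducible (f.map (mapRingHom ψ))) :
    ManyPoints P (s + 1) (AdjoinRoot f) := by
  classical
  have hf' : AdjoinRoot.mk f (derivative f) ≠ 0 := by
    intro h
    rw [AdjoinRoot.mk_eq_zero] at h
    have h0 : derivative f ≠ 0 := by
      intro h0
      rw [derivative_eq_zero] at h0
      omega
    exact hf.not_dvd_of_degree_lt h0 (degree_derivative_lt hf.ne_zero) h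
  obtain ⟨w, hw⟩ : ∃ w, ∀ i, (f.coeff i).natDegree ≤ w := by
    refine ⟨f.support.sup fun i => (f.coeff i).natDegree, fun i => ?_⟩
    by_cases hi : i ∈ f.support
    · exact Finset.le_sup (f := fun i => (f.coeff i).natDegree) hi
    · rw [notMem_support_iff.1 hi]; simp
  obtain ⟨ρ, hρ, v, hv⟩ := exists_ne_zero_dvd_of_adjoinRoot hf hf'
  obtain ⟨V, rfl⟩ := AdjoinRoot.mk_surjective v
  obtain ⟨U, hU⟩ : f ∣ C ρ - derivative f * V := by
    rw [← AdjoinRoot.mk_eq_zero, map_sub, map_mul, ← hv, AdjoinRoot.mk_C, sub_self]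
  have hUV : f * U + derivative f * V = C ρ := by rw [← hU]; ring
  obtain ⟨p₁, hp₁⟩ := exists_le_card_points f.natDegree w hd
  let _ : Algebra A (AdjoinRoot f) := ((AdjoinRoot.of f).comp C).toAlgebra
  refine hA.of_fibration fun b hb => ?_
  obtain ⟨ν, hν, b', hb'⟩ := exists_ne_zero_dvd_of_adjoinRoot hf hb
  refine ⟨δ * (ν * ρ).leadingCoeff, mul_ne_zero hδ (leadingCoeff_ne_zero.2 (mul_ne_zero hν hρ)),
    1 / (8 * f.natDegree), by positivity, max p₁ (8 * f.natDegree * (ν * ρ).natDegree),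
    fun p _ hp ψ hψ => ?_⟩
  rw [map_mul] at hψ
  have hψ1 := left_ne_zero_of_mul hψ
  have hψ2 := right_ne_zero_of_mul hψ
  have hρψ : (ν * ρ).map ψ ≠ 0 := fun h => hψ2 (by
    rw [leadingCoeff, ← coeff_map, h, coeff_zero])
  have key := hp₁ p (lt_of_le_of_lt (le_max_left _ _) hp) (f.map (mapRingHom ψ)) ((ν * ρ).map ψ)
    (hf.map _) (hf.natDegree_map _)
    (fun i => by
      rw [coeff_map]
      exact natDegree_map_le.trans (hw i))
    (fun E _ _ => by
      rw [map_map, mapRingHom_comp]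
      refine hirr E _ ?_
      rw [RingHom.comp_apply]
      exact (map_ne_zero_iff _ (algebraMap (ZMod p) E).injective).2 hψ1)
    hρψ
    ⟨(C ν * U).map (mapRingHom ψ), (C ν * V).map (mapRingHom ψ), by
      rw [derivative_map, ← Polynomial.map_mul, ← Polynomial.map_mul, ← Polynomial.map_add]
      have : f * (C ν * U) + derivative f * (C ν * V) = C (ν * ρ) := by
        rw [C_mul, ← hUV]; ring
      rw [this, map_C, coe_mapRingHom]⟩
  set Z : Set (ZMod p) := {s | ((ν * ρ).map ψ).eval s ≠ 0 ∧
    ∃ c, ((f.map (mapRingHom ψ)).eval (C c)).eval s = 0} with hZ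
  have hroot : ∀ x : Z, ∃ c : ZMod p, f.eval₂ (eval₂RingHom ψ (x : ZMod p)) c = 0 := by
    rintro ⟨x, -, c, hc⟩
    refine ⟨c, ?_⟩
    rw [eval_map, ← coe_evalRingHom x, hom_eval₂] at hc
    refine Eq.trans ?_ hc
    congr 1
    · ext <;> simp
    · simp
  choose c hc using hroot
  let Φ : Z → AdjoinRoot f →+* ZMod p := fun x => AdjoinRoot.lift (eval₂RingHom ψ (x : ZMod p)) (c x) (hc x)
  have hΦ : ∀ x q, Φ x (AdjoinRoot.of f q) = (q.map ψ).eval (x : ZMod p) := fun x q => by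
    simp only [Φ, AdjoinRoot.lift_of, coe_eval₂RingHom, eval_map]
  have hinj : Function.Injective Φ := by
    intro x y h
    have := RingHom.congr_fun h (AdjoinRoot.of f X)
    rw [hΦ, hΦ, map_X, eval_X, eval_X] at this
    exact Subtype.ext this
  refine ⟨Finset.univ.image Φ, ?_, ?_⟩
  · intro φ hφ
    obtain ⟨x, -, rfl⟩ := Finset.mem_image.1 hφ
    refine ⟨fun h => x.2.1 ?_, ?_⟩
    · rw [← hΦ, map_mul, map_mul, hb', map_mul, h, zero_mul, zero_mul]
    · ext a
      change Φ x (AdjoinRoot.of f (C a)) = _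
      rw [hΦ, map_C, eval_C]
  · rw [Finset.card_image_of_injective _ hinj, Finset.card_univ, ← Nat.card_eq_fintype_card,
      Nat.card_coe_set_eq]
    have h2 : ((ν * ρ).map ψ).natDegree ≤ (ν * ρ).natDegree := natDegree_map_le
    have h3 : p ≤ 8 * f.natDegree * Z.ncard := by
      have h4 := lt_of_le_of_lt (le_max_right _ _) hp
      have h5 := key.trans (Nat.mul_le_mul_left _ (Nat.add_le_add_left h2 _))
      have h6 : 8 * f.natDegree * (ν * ρ).natDegree = 2 * (4 * f.natDegree * (ν * ρ).natDegree) := by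
        ring
      have h7 : 8 * f.natDegree * Z.ncard = 2 * (4 * f.natDegree * Z.ncard) := by ring
      rw [mul_add] at h5
      omega
    have h3' : (p : ℝ) ≤ 8 * f.natDegree * Z.ncard := by exact_mod_cast h3
    rw [one_div, inv_mul_le_iff₀ (by positivity)]
    exact h3'

end ManyPoints
end PointCount

namespace PointCount
open Polynomial

lemma exists_common_denominator {R B L : Type*} [CommRing R] [CommRing B] [IsDomain B] [Field L]
    [Algebra B L] [IsFractionRing B L] [Algebra.FiniteType ℤ R] (i : R →+* L) :
    ∃ s : B, s ≠ 0 ∧ ∀ r, ∃ (k : ℕ) (b : B), i r * algebraMap B L s ^ k = algebraMap B L b := by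
  classical
  obtain ⟨G, hG⟩ := Algebra.FiniteType.out (R := ℤ) (A := R)
  obtain ⟨s, hs⟩ := IsLocalization.exist_integer_multiples_of_finset (nonZeroDivisors B) (G.image i)
  refine ⟨s, nonZeroDivisors.ne_zero s.2, fun r => ?_⟩
  have hr : r ∈ Algebra.adjoin ℤ (G : Set R) := hG ▸ Algebra.mem_top
  induction hr using Algebra.adjoin_induction with
  | mem x hx =>
    obtain ⟨b, hb⟩ := hs (i x) (Finset.mem_image_of_mem _ hx)
    refine ⟨1, b, ?_⟩
    rw [hb, Algebra.smul_def, pow_one, mul_comm]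
  | algebraMap n => exact ⟨0, n, by simp⟩
  | add x y _ _ hx hy =>
    obtain ⟨k, b, hb⟩ := hx
    obtain ⟨l, c, hc⟩ := hy
    refine ⟨k + l, b * s ^ l + c * s ^ k, ?_⟩
    rw [map_add, map_add, map_mul, map_mul, ← hb, ← hc, map_pow, map_pow]
    ring
  | mul x y _ _ hx hy =>
    obtain ⟨k, b, hb⟩ := hx
    obtain ⟨l, c, hc⟩ := hy
    refine ⟨k + l, b * c, ?_⟩
    rw [map_mul, map_mul, ← hb, ← hc]
    ring

/-- Having many points is a birational invariant. -/
lemma ManyPoints.of_isFractionRing {P : ℕ → Prop} {n : ℕ} {R B L : Type} [CommRing R] [CommRing B]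
    [IsDomain R] [IsDomain B] [Field L] [Algebra B L] [IsFractionRing B L] [Algebra R L]
    [IsFractionRing R L] [Algebra.FiniteType ℤ R] [Algebra.FiniteType ℤ B]
    (hB : ManyPoints P n B) : ManyPoints P n R := by
  classical
  intro δ hδ
  obtain ⟨s, hs, hsR⟩ := exists_common_denominator (R := R) (B := B) (algebraMap R L)
  obtain ⟨r, hr, hrB⟩ := exists_common_denominator (R := B) (B := R) (algebraMap B L)
  have hjinj := IsFractionRing.injective B L
  have hiinj := IsFractionRing.injective R L
  let Bs := Localization.Away s
  have hsu : IsUnit (algebraMap B L s) := (map_ne_zero_iff _ hjinj |>.2 hs).isUnit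
  let κ : Bs →+* L := IsLocalization.Away.lift s hsu
  have hκ : ∀ b, κ (algebraMap B Bs b) = algebraMap B L b := fun b =>
    IsLocalization.Away.lift_eq s hsu b
  have hκinj : Function.Injective κ := by
    rw [injective_iff_map_eq_zero]
    intro z hz
    obtain ⟨⟨b, c⟩, hbc⟩ := IsLocalization.surj (Submonoid.powers s) z
    have h := congr_arg κ hbc
    rw [map_mul, hz, zero_mul, hκ] at h
    have hb : b = 0 := hjinj (by rw [map_zero]; exact h.symm)
    rw [hb, map_zero] at hbc
    exact (IsLocalization.map_units Bs c).mul_left_eq_zero.1 hbc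
  have hrange : ∀ x : R, ∃ z : Bs, κ z = algebraMap R L x := by
    intro x
    obtain ⟨k, b, hb⟩ := hsR x
    obtain ⟨u, hu⟩ := (IsLocalization.Away.algebraMap_isUnit (S := Bs) s)
    refine ⟨algebraMap B Bs b * ↑(u⁻¹ ^ k), ?_⟩
    have : κ (↑(u⁻¹ ^ k)) * algebraMap B L s ^ k = 1 := by
      rw [← hκ s, ← hu, ← map_pow, ← map_mul, ← Units.val_pow_eq_pow_val, ← Units.val_mul, inv_pow,
        inv_mul_cancel, Units.val_one, map_one]
    rw [map_mul, hκ, ← hb, mul_assoc, mul_comm (_ ^ k), this, mul_one]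
  choose θ₀ hθ₀ using hrange
  let θ : R →+* Bs :=
    { toFun := θ₀
      map_one' := hκinj (by rw [hθ₀, map_one, map_one])
      map_zero' := hκinj (by rw [hθ₀, map_zero, map_zero])
      map_add' := fun x y => hκinj (by rw [hθ₀, map_add, map_add, hθ₀, hθ₀])
      map_mul' := fun x y => hκinj (by rw [hθ₀, map_mul, map_mul, hθ₀, hθ₀]) }
  have hθ : ∀ x, κ (θ x) = algebraMap R L x := hθ₀
  have hnum : ∀ x : R, x ≠ 0 → ∃ b : B, b ≠ 0 ∧ ∀ (p : ℕ) [Fact p.Prime] (Φ : Bs →+* ZMod p),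
      Φ (algebraMap B Bs b) ≠ 0 → Φ (θ x) ≠ 0 := by
    intro x hx
    obtain ⟨k, b, hb⟩ := hsR x
    have hb' : θ x * algebraMap B Bs s ^ k = algebraMap B Bs b :=
      hκinj (by rw [map_mul, map_pow, hκ, hκ, hθ, hb])
    refine ⟨b, ?_, fun p _ Φ hΦ h => hΦ ?_⟩
    · rintro rfl
      rw [map_zero] at hb
      exact mul_ne_zero ((map_ne_zero_iff _ hiinj).2 hx) (pow_ne_zero _ hsu.ne_zero) hb
    · rw [← hb', map_mul, h, zero_mul]
  obtain ⟨b₁, hb₁, h₁⟩ := hnum δ hδ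
  obtain ⟨b₂, hb₂, h₂⟩ := hnum r hr
  obtain ⟨ε, hε, p₀, hp₀⟩ := hB (s * b₁ * b₂) (mul_ne_zero (mul_ne_zero hs hb₁) hb₂)
  refine ⟨ε, hε, p₀, fun p _ hp hP => ?_⟩
  obtain ⟨S, hS, hcard⟩ := hp₀ p hp hP
  have hS' : ∀ φ ∈ S, IsUnit (φ s) ∧ φ b₁ ≠ 0 ∧ φ b₂ ≠ 0 := by
    intro φ hφ
    have := hS φ hφ
    rw [map_mul, map_mul] at this
    exact ⟨(left_ne_zero_of_mul (left_ne_zero_of_mul this)).isUnit,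
      right_ne_zero_of_mul (left_ne_zero_of_mul this), right_ne_zero_of_mul this⟩
  let Φ : S → Bs →+* ZMod p := fun φ => IsLocalization.Away.lift s (hS' φ φ.2).1
  have hΦ : ∀ φ b, Φ φ (algebraMap B Bs b) = φ.1 b := fun φ b => IsLocalization.Away.lift_eq s _ b
  have hinj : Function.Injective (fun φ => (Φ φ).comp θ) := by
    intro φ φ' h
    refine Subtype.ext (RingHom.ext fun b => ?_)
    obtain ⟨k, x, hx⟩ := hrB b
    have hx' : algebraMap B Bs b * θ r ^ k = θ x :=
      hκinj (by rw [map_mul, map_pow, hκ, hθ, hθ, hx])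
    have h3 : ∀ y, Φ φ (θ y) = Φ φ' (θ y) := fun y => RingHom.congr_fun h y
    have h4 := h3 x
    rw [← hx', map_mul, map_mul, map_pow, map_pow, hΦ, hΦ, ← h3 r] at h4
    refine mul_right_cancel₀ (pow_ne_zero k (h₂ p (Φ φ) ?_)) h4
    rw [hΦ]
    exact (hS' φ φ.2).2.2
  refine ⟨Finset.univ.image fun φ => (Φ φ).comp θ, ?_, ?_⟩
  · intro ψ hψ
    obtain ⟨φ, -, rfl⟩ := Finset.mem_image.1 hψ
    refine h₁ p (Φ φ) ?_
    rw [hΦ]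
    exact (hS' φ φ.2).2.1
  · rw [Finset.card_image_of_injective _ hinj, Finset.card_univ, Fintype.card_coe]
    exact hcard

end PointCount

namespace PointCount
open Polynomial

section Specialization

lemma exists_C_mem_span {A E σ : Type*} [CommRing A] [IsDomain A] [Field E] [IsAlgClosed E] [Finite σ]
    [Algebra A E] [FaithfulSMul A E] (s : Set (MvPolynomial σ A))
    (h : ∀ v : σ → E, ∃ q ∈ s, MvPolynomial.aeval v q ≠ 0) :
    ∃ δ : A, δ ≠ 0 ∧ MvPolynomial.C δ ∈ Ideal.span s := by
  let K := FractionRing A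
  let _ : Algebra K E := FractionRing.liftAlgebra A E
  have : IsScalarTower A K E := FractionRing.isScalarTower_liftAlgebra A E
  let _ : Algebra (MvPolynomial σ A) (MvPolynomial σ K) := MvPolynomial.algebraMvPolynomial
  let I := (Ideal.span s).map (algebraMap (MvPolynomial σ A) (MvPolynomial σ K))
  have h1 : MvPolynomial.zeroLocus E I = ∅ := by
    rw [Set.eq_empty_iff_forall_notMem]
    intro v hv
    obtain ⟨q, hq, hqv⟩ := h v
    refine hqv ?_
    have := hv _ (Ideal.mem_map_of_mem _ (Ideal.subset_span hq))
    rwa [MvPolynomial.algebraMap_def, MvPolynomial.aeval_map_algebraMap] at this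
  have h2 : I = ⊤ := by
    rw [← Ideal.radical_eq_top, ← MvPolynomial.vanishingIdeal_zeroLocus_eq_radical (K := E), h1,
      MvPolynomial.vanishingIdeal_empty]
  have h3 : ¬ Disjoint (((nonZeroDivisors A).map (MvPolynomial.C (σ := σ)) : Submonoid _) : Set _)
      (Ideal.span s : Set (MvPolynomial σ A)) := fun h =>
    (IsLocalization.map_algebraMap_ne_top_iff_disjoint _ (MvPolynomial σ K) (Ideal.span s)).2 h h2
  obtain ⟨_, ⟨δ, hδ, rfl⟩, hmem⟩ := Set.not_disjoint_iff.1 h3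
  exact ⟨δ, nonZeroDivisors.ne_zero hδ, hmem⟩

lemma coeff_coeff_swap {k : Type*} [CommRing k] (f : k[X][X]) (i j : ℕ) :
    ((Bivariate.swap f).coeff i).coeff j = (f.coeff j).coeff i := by
  induction f using Polynomial.induction_on' with
  | add f g hf hg => simp [hf, hg]
  | monomial n q =>
    induction q using Polynomial.induction_on' with
    | add f g hf hg => rw [map_add, map_add, coeff_add, coeff_add, hf, hg, coeff_add, coeff_add]
    | monomial m r =>
      rw [Bivariate.swap_monomial_monomial]
      simp only [coeff_monomial]
      split_ifs <;> simp_all [coeff_monomial]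

lemma natDegree_swap_le_iff {k : Type*} [CommRing k] {f : k[X][X]} {w : ℕ} :
    (Bivariate.swap f).natDegree ≤ w ↔ ∀ i, (f.coeff i).natDegree ≤ w := by
  simp only [natDegree_le_iff_coeff_eq_zero]
  constructor
  · intro h i j hj
    rw [← coeff_coeff_swap, h j hj, coeff_zero]
  · intro h j hj
    ext i
    rw [coeff_coeff_swap, h i j hj, coeff_zero]

lemma natDegree_coeff_le_of_mul_eq {k : Type*} [CommRing k] [IsDomain k] {f g h : k[X][X]} {w : ℕ}
    (hf : f ≠ 0) (hgh : g * h = f) (hw : ∀ i, (f.coeff i).natDegree ≤ w) (i : ℕ) :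
    (g.coeff i).natDegree ≤ w := by
  refine natDegree_swap_le_iff.1 (le_trans ?_ (natDegree_swap_le_iff.2 hw)) i
  rw [← hgh, map_mul, natDegree_mul]
  · exact Nat.le_add_right _ _
  · rw [map_ne_zero_iff _ Bivariate.swap.injective]; rintro rfl; simp [hf.symm] at hgh
  · rw [map_ne_zero_iff _ Bivariate.swap.injective]; rintro rfl; simp [hf.symm] at hgh

/-- The monic bivariate polynomial of degree `a` with coefficients given by `u`. -/
noncomputable def monicOf {k : Type*} [CommRing k] {a w : ℕ} (u : Fin a → Fin (w + 1) → k) : k[X][X] :=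
  X ^ a + ∑ i : Fin a, C (∑ j : Fin (w + 1), C (u i j) * X ^ (j : ℕ)) * X ^ (i : ℕ)

variable {k : Type*} [CommRing k] {a w : ℕ}

lemma degree_monicOf_sum_lt (u : Fin a → Fin (w + 1) → k) :
    (∑ i : Fin a, C (∑ j : Fin (w + 1), C (u i j) * X ^ (j : ℕ)) * X ^ (i : ℕ) : k[X][X]).degree < a := by
  refine (degree_sum_le _ _).trans_lt ((Finset.sup_lt_iff (WithBot.bot_lt_coe a)).2 fun i _ => ?_)
  exact (degree_C_mul_X_pow_le _ _).trans_lt (WithBot.coe_lt_coe.2 i.2)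

lemma natDegree_monicOf [Nontrivial k] (u : Fin a → Fin (w + 1) → k) : (monicOf u).natDegree = a := by
  refine natDegree_eq_of_degree_eq_some ?_
  rw [monicOf, degree_add_eq_left_of_degree_lt, degree_X_pow]
  rw [degree_X_pow]
  exact degree_monicOf_sum_lt u

lemma map_monicOf {l : Type*} [CommRing l] (φ : k →+* l) (u : Fin a → Fin (w + 1) → k) :
    (monicOf u).map (mapRingHom φ) = monicOf fun i j => φ (u i j) := by
  simp [monicOf, Polynomial.map_sum]

lemma monicOf_coeff {g : k[X][X]} (hg : g.Monic) (ha : g.natDegree = a)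
    (hw : ∀ i, (g.coeff i).natDegree ≤ w) :
    monicOf (fun (i : Fin a) (j : Fin (w + 1)) => (g.coeff i).coeff j) = g := by
  conv_rhs => rw [hg.as_sum, ha]
  rw [monicOf, ← Fin.sum_univ_eq_sum_range (fun i => C (g.coeff i) * X ^ i)]
  congr 1
  refine Finset.sum_congr rfl fun i _ => ?_
  congr 2
  rw [Fin.sum_univ_eq_sum_range (fun j => C ((g.coeff i).coeff j) * X ^ j),
    ← as_sum_range_C_mul_X_pow' _ (Nat.lt_succ_of_le (hw i))]

/-- Absolute irreducibility is preserved under specialisation outside a hypersurface. -/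
theorem exists_irreducible_map {A E : Type} [CommRing A] [IsDomain A] [Field E] [IsAlgClosed E]
    [Algebra A E] [FaithfulSMul A E] {f : A[X][X]} (hf : f.Monic)
    (hirr : Irreducible (f.map (mapRingHom (algebraMap A E)))) :
    ∃ δ : A, δ ≠ 0 ∧ ∀ (k : Type) [Field k] (ψ : A →+* k), ψ δ ≠ 0 →
      Irreducible (f.map (mapRingHom ψ)) := by
  classical
  obtain ⟨w, hw⟩ : ∃ w, ∀ i, (f.coeff i).natDegree ≤ w := by
    refine ⟨f.support.sup fun i => (f.coeff i).natDegree, fun i => ?_⟩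
    by_cases hi : i ∈ f.support
    · exact Finset.le_sup (f := fun i => (f.coeff i).natDegree) hi
    · rw [notMem_support_iff.1 hi]; simp
  have key : ∀ a b : ℕ, 0 < a → 0 < b → ∃ δ : A, δ ≠ 0 ∧ ∀ (k : Type) [Field k] (ψ : A →+* k),
      ψ δ ≠ 0 → ∀ g h : k[X][X], g.Monic → h.Monic → g.natDegree = a → h.natDegree = b →
        g * h ≠ f.map (mapRingHom ψ) := by
    intro a b ha hb
    let σ := (Fin a ⊕ Fin b) × Fin (w + 1)
    let G : (MvPolynomial σ A)[X][X] :=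
      monicOf (fun (i : Fin a) (j : Fin (w + 1)) => MvPolynomial.X (Sum.inl i, j))
    let H : (MvPolynomial σ A)[X][X] :=
      monicOf (fun (i : Fin b) (j : Fin (w + 1)) => MvPolynomial.X (Sum.inr i, j))
    let Q := G * H - f.map (mapRingHom MvPolynomial.C)
    have hQ : ∀ {l : Type} [CommRing l] (φ : MvPolynomial σ A →+* l), Q.map (mapRingHom φ) =
        monicOf (fun (i : Fin a) (j : Fin (w + 1)) => φ (MvPolynomial.X (Sum.inl i, j))) *
        monicOf (fun (i : Fin b) (j : Fin (w + 1)) => φ (MvPolynomial.X (Sum.inr i, j))) -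
        f.map (mapRingHom (φ.comp MvPolynomial.C)) := by
      intro l _ φ
      rw [Polynomial.map_sub, Polynomial.map_mul, map_monicOf, map_monicOf, Polynomial.map_map,
        mapRingHom_comp]
    obtain ⟨δ, hδ, hmem⟩ := exists_C_mem_span (E := E)
      (Set.range fun ij : ℕ × ℕ => (Q.coeff ij.1).coeff ij.2) (fun v => by
        by_contra! hv
        have h0 : Q.map (mapRingHom (MvPolynomial.aeval v : _ →ₐ[A] E).toRingHom) = 0 := by
          ext i j
          simpa [coeff_map] using hv _ ⟨(i, j), rfl⟩
        rw [hQ, sub_eq_zero] at h0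
        have e : (MvPolynomial.aeval v : MvPolynomial σ A →ₐ[A] E).toRingHom.comp MvPolynomial.C =
          algebraMap A E := by ext; simp
        rw [e] at h0
        rcases hirr.isUnit_or_isUnit h0.symm with hu | hu
        · have := natDegree_eq_zero_of_isUnit hu
          rw [natDegree_monicOf] at this
          omega
        · have := natDegree_eq_zero_of_isUnit hu
          rw [natDegree_monicOf] at this
          omega)
    refine ⟨δ, hδ, fun k _ ψ hψ g h hg hh hga hhb hgh => hψ ?_⟩
    have hwψ : ∀ i, ((f.map (mapRingHom ψ)).coeff i).natDegree ≤ w := fun i => by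
      rw [coeff_map]
      exact natDegree_map_le.trans (hw i)
    have hne : f.map (mapRingHom ψ) ≠ 0 := (hf.map _).ne_zero
    have hwg := natDegree_coeff_le_of_mul_eq hne hgh hwψ
    have hwh := natDegree_coeff_le_of_mul_eq hne ((mul_comm h g).trans hgh) hwψ
    let v : σ → k := fun x => Sum.elim (fun i : Fin a => (g.coeff i).coeff x.2)
      (fun i : Fin b => (h.coeff i).coeff x.2) x.1
    have h0 : Q.map (mapRingHom (MvPolynomial.eval₂Hom ψ v)) = 0 := by
      rw [hQ]
      simp only [MvPolynomial.coe_eval₂Hom, MvPolynomial.eval₂_X, MvPolynomial.eval₂Hom_comp_C, v,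
        Sum.elim_inl, Sum.elim_inr]
      rw [monicOf_coeff hg hga hwg, monicOf_coeff hh hhb hwh, hgh, sub_self]
    have h1 : Ideal.span (Set.range fun ij : ℕ × ℕ => (Q.coeff ij.1).coeff ij.2) ≤
        RingHom.ker (MvPolynomial.eval₂Hom ψ v) := by
      rw [Ideal.span_le]
      rintro _ ⟨⟨i, j⟩, rfl⟩
      have := congr_arg (fun q => (q.coeff i).coeff j) h0
      simpa [coeff_map] using this
    simpa using h1 hmem
  have hd : 0 < f.natDegree := by
    by_contra h0
    have := hf.natDegree_eq_zero.1 (by omega : f.natDegree = 0)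
    rw [this, Polynomial.map_one] at hirr
    exact hirr.not_isUnit isUnit_one
  choose! δ hδ hkey using key
  refine ⟨∏ ab ∈ (Finset.range (f.natDegree + 1) ×ˢ Finset.range (f.natDegree + 1)).filter
    (fun ab => 0 < ab.1 ∧ 0 < ab.2), δ ab.1 ab.2, ?_, ?_⟩
  · exact Finset.prod_ne_zero_iff.2 fun ab hab =>
      hδ _ _ (Finset.mem_filter.1 hab).2.1 (Finset.mem_filter.1 hab).2.2
  · intro k _ ψ hψ
    rw [map_prod, Finset.prod_ne_zero_iff] at hψ
    have hfψ := hf.map (mapRingHom ψ)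
    have hdψ : (f.map (mapRingHom ψ)).natDegree = f.natDegree := hf.natDegree_map _
    rw [hfψ.irreducible_iff_natDegree']
    refine ⟨fun h1 => ?_, fun g h hg hh hgh hmem => ?_⟩
    · rw [h1, natDegree_one] at hdψ
      omega
    · rw [Finset.mem_Ioc] at hmem
      have hsum := hg.natDegree_mul hh
      rw [hgh, hdψ] at hsum
      rw [hdψ] at hmem
      have hg0 : 0 < g.natDegree := by omega
      refine hkey _ _ hg0 hmem.1 k ψ (hψ (g.natDegree, h.natDegree) ?_) g h hg hh rfl rfl hgh
      simp only [Finset.mem_filter, Finset.mem_product, Finset.mem_range]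
      omega

end Specialization
end PointCount

namespace PointCount
open Polynomial

/-- The minimal polynomial of an element over a regular extension is absolutely irreducible. -/
theorem irreducible_map_algebraicClosure {K L : Type} [Field K] [Field L] [Algebra K L] [CharZero L]
    (hK : ∀ z : L, IsAlgebraic K z → z ∈ (algebraMap K L).range) {x y : L} (hx : Transcendental K x)
    {f : K[X][X]} (hf : f.Monic) (hxy : f.eval₂ (aeval x : K[X] →ₐ[K] L).toRingHom y = 0)
    (hmin : ∀ g : K[X][X], g.Monic → g.eval₂ (aeval x : K[X] →ₐ[K] L).toRingHom y = 0 →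
      f.natDegree ≤ g.natDegree) :
    Irreducible (f.map (mapRingHom (algebraMap K (algebraicClosure K (AlgebraicClosure L))))) := by
  set Ω := AlgebraicClosure L
  set E := algebraicClosure K Ω
  set x₀ := algebraMap L Ω x
  set y₀ := algebraMap L Ω y
  have hx₀ : Transcendental E x₀ := by
    intro h
    have h1 : IsAlgebraic K x₀ :=
      isAlgebraic_of_forall (F := E) (fun c => mem_algebraicClosure_iff.1 c.2) h
    exact hx ((isAlgebraic_algebraMap_iff (algebraMap L Ω).injective).1 h1)
  let _ : Algebra E[X] Ω := (aeval x₀ : E[X] →ₐ[E] Ω).toAlgebra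
  have hinj : Function.Injective (algebraMap E[X] Ω) := transcendental_iff_injective.1 hx₀
  have : FaithfulSMul E[X] Ω := (faithfulSMul_iff_algebraMap_injective _ _).2 hinj
  have hev : ∀ q : K[X][X], (q.map (mapRingHom (algebraMap K E))).eval₂ (algebraMap E[X] Ω) y₀ =
      algebraMap L Ω (q.eval₂ (aeval x : K[X] →ₐ[K] L).toRingHom y) := by
    intro q
    rw [eval₂_map, hom_eval₂]
    congr 1
    ext a
    · have e1 : (algebraMap E[X] Ω) (C (algebraMap K E a)) = algebraMap K Ω a := by
        change aeval x₀ (C (algebraMap K E a)) = _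
        rw [aeval_C]
        rfl
      simp [e1, IsScalarTower.algebraMap_apply K L Ω]
    · have e1 : (algebraMap E[X] Ω) X = x₀ := aeval_X (R := E) x₀
      simp [e1, x₀]
  have hy₀ : IsIntegral E[X] y₀ :=
    ⟨f.map (mapRingHom (algebraMap K E)), hf.map _, by rw [hev, hxy, map_zero]⟩
  set g := minpoly E[X] y₀
  have hg : g.Monic := minpoly.monic hy₀
  have hfix : ∀ (σ : Ω ≃ₐ[L] Ω) (i j : ℕ), σ ((g.coeff i).coeff j : E) = ((g.coeff i).coeff j : E) := by
    intro σ i j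
    have hσE : ∀ z : E, σ (z : Ω) ∈ E := fun z =>
      mem_algebraicClosure_iff.2 ((mem_algebraicClosure_iff.1 z.2).algHom
        (σ.restrictScalars K : Ω →ₐ[K] Ω))
    let τ : E →+* E := (((σ : Ω →ₐ[L] Ω) : Ω →+* Ω).comp (algebraMap E Ω)).codRestrict E hσE
    have hτ : ∀ z, (τ z : Ω) = σ z := fun z => rfl
    have h1 : (g.map (mapRingHom τ)).eval₂ (algebraMap E[X] Ω) y₀ = 0 := by
      have h2 : σ (g.eval₂ (algebraMap E[X] Ω) y₀) = 0 := by
        have : g.eval₂ (algebraMap E[X] Ω) y₀ = 0 := minpoly.aeval E[X] y₀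
        rw [this, map_zero]
      rw [← h2, eval₂_map]
      have h3 := hom_eval₂ g (algebraMap E[X] Ω) ((σ : Ω →ₐ[L] Ω) : Ω →+* Ω) y₀
      refine Eq.trans ?_ h3.symm
      have h4 : ((σ : Ω →ₐ[L] Ω) : Ω →+* Ω) y₀ = y₀ := σ.commutes y
      rw [h4]
      congr 1
      ext a
      · have e1 : ∀ a : E, (algebraMap E[X] Ω) (C a) = a := fun a => aeval_C (R := E) x₀ a
        simp [e1, hτ]
      · have e1 : (algebraMap E[X] Ω) X = x₀ := aeval_X (R := E) x₀
        simp [e1, x₀]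
    have h5 : g ∣ g.map (mapRingHom τ) := minpoly.isIntegrallyClosed_dvd hy₀ h1
    have h6 := eq_of_monic_of_dvd_of_natDegree_le hg (hg.map (mapRingHom τ)) h5
      (hg.natDegree_map _).le
    have h7 := congr_arg (fun q : E[X][X] => (((q.coeff i).coeff j : E) : Ω)) h6
    simpa [coeff_map, hτ] using h7
  have hGal : IsGalois L Ω := IsAlgClosure.isGalois L Ω
  have hlift : g ∈ lifts (mapRingHom (algebraMap K E)) := by
    rw [lifts_iff_coeff_lifts]
    intro i
    have h1 : g.coeff i ∈ lifts (algebraMap K E) := by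
      rw [lifts_iff_coeff_lifts]
      intro j
      have h2 : (((g.coeff i).coeff j : E) : Ω) ∈ (⊥ : IntermediateField L Ω) :=
        (InfiniteGalois.mem_bot_iff_fixed _).2 fun σ => hfix σ i j
      obtain ⟨l, hl⟩ := IntermediateField.mem_bot.1 h2
      have h3 : IsAlgebraic K l := by
        rw [← isAlgebraic_algebraMap_iff (algebraMap L Ω).injective, hl]
        exact mem_algebraicClosure_iff.1 (Subtype.prop _)
      obtain ⟨c, hc⟩ := hK l h3
      refine ⟨c, Subtype.ext ?_⟩
      rw [← hl, ← hc]
      exact (IsScalarTower.algebraMap_apply K L Ω c)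
    exact h1
  obtain ⟨g₀, hg₀, hdeg, hmon⟩ := lifts_and_natDegree_eq_and_monic hlift hg
  have h1 : g₀.eval₂ (aeval x : K[X] →ₐ[K] L).toRingHom y = 0 := by
    refine (algebraMap L Ω).injective ?_
    rw [← hev, hg₀, map_zero]
    exact minpoly.aeval E[X] y₀
  have h2 := hmin g₀ hmon h1
  have h3 : g ∣ f.map (mapRingHom (algebraMap K E)) :=
    minpoly.isIntegrallyClosed_dvd hy₀ (by
      rw [aeval_def, hev, hxy, map_zero])
  have h4 := eq_of_monic_of_dvd_of_natDegree_le hg (hf.map (mapRingHom (algebraMap K E))) h3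
    (by rw [hf.natDegree_map, ← hdeg]; exact h2)
  rw [h4]
  exact minpoly.irreducible hy₀

end PointCount

namespace PointCount
open Polynomial IntermediateField

section Models

lemma exists_map_eq_C_mul {A : Type*} (K : Type*) [CommRing A] [IsDomain A] [Field K] [Algebra A K]
    [IsFractionRing A K] (q : K[X]) :
    ∃ (a : A) (q' : A[X]), a ≠ 0 ∧ q'.map (algebraMap A K) = C (algebraMap A K a) * q := by
  obtain ⟨b, hb, h⟩ := IsLocalization.integerNormalization_spec (nonZeroDivisors A) q
  exact ⟨b, _, nonZeroDivisors.ne_zero hb, by rw [h, Algebra.smul_def]; rfl⟩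

lemma exists_map_mapRingHom_eq_C_mul {A : Type*} (K : Type*) [CommRing A] [IsDomain A] [Field K]
    [Algebra A K] [IsFractionRing A K] (q : K[X][X]) :
    ∃ (a : A) (q' : A[X][X]), a ≠ 0 ∧
      q'.map (mapRingHom (algebraMap A K)) = C (C (algebraMap A K a)) * q := by
  let _ : Algebra A[X] K[X] := Polynomial.algebra A K
  have : IsLocalization ((nonZeroDivisors A).map (C : A →+* A[X])) K[X] :=
    Polynomial.isLocalization (nonZeroDivisors A) K
  obtain ⟨_, ⟨a, ha, rfl⟩, h⟩ := IsLocalization.integerNormalization_spec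
    ((nonZeroDivisors A).map (C : A →+* A[X])) q
  refine ⟨a, _, nonZeroDivisors.ne_zero ha, h.trans ?_⟩
  rw [show (C a : A[X]) • q = (algebraMap A[X] K[X] (C a)) • q from (algebraMap_smul _ _ _).symm,
    ← C_mul']
  exact congr_arg (fun c => C c * q) (map_C (algebraMap A K))

/-- `L` is an extension of transcendence degree `n` of the fraction field of a finitely generated
ring with many points, the latter being algebraically closed in `L`. -/
def HasModel (P : ℕ → Prop) (s n : ℕ) (L : Type) [Field L] : Prop :=
  ∃ (A : Type) (_ : CommRing A) (_ : IsDomain A) (_ : Algebra A L), FaithfulSMul A L ∧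
    Algebra.FiniteType ℤ A ∧ ManyPoints P s A ∧
    (∀ z : L, IsAlgebraic A z → ∃ a b : A, b ≠ 0 ∧ z * algebraMap A L b = algebraMap A L a) ∧
    Algebra.trdeg A L = n

lemma mem_range_of_isAlgebraic {A K L : Type*} [CommRing A] [IsDomain A] [Field K] [Field L] [Algebra A K]
    [IsFractionRing A K] [Algebra K L] [Algebra A L] [IsScalarTower A K L]
    (hA : ∀ z : L, IsAlgebraic A z → ∃ a b : A, b ≠ 0 ∧ z * algebraMap A L b = algebraMap A L a) {z : L}
    (hz : IsAlgebraic K z) : z ∈ (algebraMap K L).range := by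
  obtain ⟨a, b, hb, h⟩ := hA z ((IsFractionRing.isAlgebraic_iff A K L).2 hz)
  refine ⟨algebraMap A K a / algebraMap A K b, ?_⟩
  have hb' : algebraMap A L b ≠ 0 := by
    rw [IsScalarTower.algebraMap_apply A K L]
    exact (map_ne_zero_iff _ (algebraMap K L).injective).2
      ((map_ne_zero_iff _ (IsFractionRing.injective A K)).2 hb)
  rw [map_div₀, ← IsScalarTower.algebraMap_apply, ← IsScalarTower.algebraMap_apply, ← h,
    mul_div_cancel_right₀ _ hb']

lemma trdeg_polynomial_add_one {A L : Type} [CommRing A] [IsDomain A] [Field L] [Algebra A L]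
    {n : ℕ} (hn : Algebra.trdeg A L = (n + 1 : ℕ)) [Algebra A[X] L] [IsScalarTower A A[X] L]
    [FaithfulSMul A[X] L] : Algebra.trdeg A[X] L = n := by
  have h := trdeg_add_eq A A[X] (A := L)
  rw [Polynomial.trdeg_of_isDomain, hn, Nat.cast_add, Nat.cast_one, add_comm] at h
  exact Cardinal.eq_of_add_eq_add_right h Cardinal.one_lt_aleph0

lemma HasModel.succ {P : ℕ → Prop} {s n : ℕ} {L : Type} [Field L] [CharZero L]
    [Algebra.EssFiniteType ℤ L] (h : HasModel P s (n + 2) L) : HasModel P (s + 1) (n + 1) L := by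
  obtain ⟨A, _, _, _, _, _, hA, hcl, htr⟩ := h
  let K := FractionRing A
  let _ : Algebra K L := FractionRing.liftAlgebra A L
  have : IsScalarTower A K L := FractionRing.isScalarTower_liftAlgebra A L
  have : CharZero K := (algebraMap K L).charZero
  have : Algebra.EssFiniteType K L := Algebra.EssFiniteType.of_comp ℤ K L
  have hinjA : Function.Injective (algebraMap A L) := FaithfulSMul.algebraMap_injective A L
  obtain ⟨x, hx⟩ : ∃ x : Fin 2 → L, AlgebraicIndependent K x := by
    obtain ⟨T, hT⟩ := exists_isTranscendenceBasis A L
    have hcard := hT.cardinalMk_eq_trdeg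
    rw [htr] at hcard
    have h2 : Cardinal.mk (Fin 2) ≤ Cardinal.mk T := by
      rw [hcard, Cardinal.mk_fin]
      exact_mod_cast Nat.le_add_left 2 n
    obtain ⟨e⟩ := h2
    have : Algebra.IsAlgebraic A K := IsLocalization.isAlgebraic K (nonZeroDivisors A)
    exact ⟨fun i => (e i : L), (hT.1.extendScalars K).comp e e.injective⟩
  obtain ⟨u, hu, hucl⟩ := exists_transcendental_isAlgebraicallyClosed
    (fun z hz => mem_range_of_isAlgebraic (A := A) (K := K) hcl hz) hx
  have huA : Transcendental A u := fun h => hu (h.extendScalars (IsFractionRing.injective A K))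
  let _ : Algebra A[X] L := (aeval u : A[X] →ₐ[A] L).toAlgebra
  have hmap : ∀ q, algebraMap A[X] L q = aeval u q := fun _ => rfl
  have : IsScalarTower A A[X] L := .of_algebraMap_eq fun a => (aeval_C (R := A) u a).symm
  have hinj : Function.Injective (algebraMap A[X] L) := transcendental_iff_injective.1 huA
  have : FaithfulSMul A[X] L := (faithfulSMul_iff_algebraMap_injective _ _).2 hinj
  refine ⟨A[X], inferInstance, inferInstance, inferInstance, this, ?_, hA.polynomial, ?_,
    trdeg_polynomial_add_one htr⟩
  · exact Algebra.FiniteType.trans (S := A) inferInstance inferInstance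
  · intro z hz
    have hz' : IsAlgebraic K⟮u⟯ z := by
      have h1 : ∀ q : A[X], algebraMap A[X] L q ∈ K⟮u⟯ := by
        intro q
        rw [hmap, ← aeval_map_algebraMap K]
        exact (mem_adjoin_simple_iff K _).2 ⟨q.map (algebraMap A K), 1, by simp⟩
      let _ : Algebra A[X] K⟮u⟯ := ((algebraMap A[X] L).codRestrict _ h1).toAlgebra
      have : IsScalarTower A[X] K⟮u⟯ L := .of_algebraMap_eq fun _ => rfl
      refine hz.extendScalars (fun q q' hq => hinj (congr_arg Subtype.val hq))
    obtain ⟨r, t, hrt⟩ := (mem_adjoin_simple_iff K _).1 (hucl z hz')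
    by_cases ht : aeval u t = 0
    · rw [ht, div_zero] at hrt
      exact ⟨0, 1, one_ne_zero, by simp [hrt]⟩
    obtain ⟨a, r', ha, har⟩ := exists_map_eq_C_mul (A := A) K r
    obtain ⟨b, t', hb, hbt⟩ := exists_map_eq_C_mul (A := A) K t
    have e1 : ∀ q : A[X], algebraMap A[X] L q = aeval u (q.map (algebraMap A K)) := fun q => by
      rw [aeval_map_algebraMap, hmap]
    refine ⟨C b * r', C a * t', mul_ne_zero (C_ne_zero.2 ha) ?_, ?_⟩
    · rintro rfl
      rw [Polynomial.map_zero] at hbt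
      have hb' : algebraMap A K b ≠ 0 := (map_ne_zero_iff _ (IsFractionRing.injective A K)).2 hb
      rcases mul_eq_zero.1 hbt.symm with h | h
      · exact hb' (C_eq_zero.1 h)
      · rw [h, map_zero] at ht
        exact ht rfl
    · rw [e1, e1, Polynomial.map_mul, Polynomial.map_mul, har, hbt, hrt, map_C, map_C]
      simp only [map_mul]
      field_simp

end Models
end PointCount

namespace PointCount
open Polynomial IntermediateField

section IntegralGenerator

/-- A finitely generated algebraic field extension of a domain of characteristic zero is generated
by an integral element whose minimal polynomial has coefficients in that domain. -/
lemma exists_monic_generator (D L : Type) [CommRing D] [IsDomain D] [Field L] [CharZero L]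
    [Algebra D L] [FaithfulSMul D L] [Algebra.IsAlgebraic D L] [Algebra.EssFiniteType D L] :
    ∃ (y : L) (f : D[X]), f.Monic ∧ (∀ g : D[X], aeval y g = 0 ↔ f ∣ g) ∧
      ∀ z : L, ∃ (g : D[X]) (d : D), d ≠ 0 ∧ z * algebraMap D L d = aeval y g := by
  let K := FractionRing D
  let _ : Algebra K L := FractionRing.liftAlgebra D L
  have : IsScalarTower D K L := FractionRing.isScalarTower_liftAlgebra D L
  have hDL : Function.Injective (algebraMap D L) := FaithfulSMul.algebraMap_injective D L
  have hDK : Function.Injective (algebraMap D K) := IsFractionRing.injective D K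
  have : CharZero K := (algebraMap K L).charZero
  have : Algebra.EssFiniteType K L := Algebra.EssFiniteType.of_comp D K L
  have : Algebra.IsAlgebraic K L := (IsFractionRing.comap_isAlgebraic_iff (A := D)).1 ‹_›
  have : Module.Finite K L := Algebra.finite_of_essFiniteType_of_isAlgebraic
  obtain ⟨y₀, hy₀⟩ := Field.exists_primitive_element K L
  have hdeg₀ := (Field.primitive_element_iff_minpoly_natDegree_eq K y₀).1 hy₀
  set m := minpoly K y₀
  have hm : m.Monic := minpoly.monic (IsIntegral.of_finite K y₀)
  obtain ⟨⟨c, hc⟩, hcm⟩ := IsLocalization.exist_integer_multiples_of_finset (nonZeroDivisors D)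
    (S := K) m.coeffs
  have hc0 : c ≠ 0 := nonZeroDivisors.ne_zero hc
  have hcL : algebraMap D L c ≠ 0 := (map_ne_zero_iff _ hDL).2 hc0
  set y : L := algebraMap D L c * y₀
  have hy : K⟮y⟯ = ⊤ := by
    rw [eq_top_iff, ← hy₀, adjoin_simple_le_iff]
    have h1 : algebraMap D L c ∈ K⟮y⟯ := by
      rw [IsScalarTower.algebraMap_apply D K L]
      exact K⟮y⟯.algebraMap_mem _
    have h2 : y₀ = y / algebraMap D L c := by simp only [y]; field_simp
    rw [h2]
    exact div_mem (mem_adjoin_simple_self K y) h1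
  have hdeg := (Field.primitive_element_iff_minpoly_natDegree_eq K y).1 hy
  have hmin : minpoly K y = m.scaleRoots (algebraMap D K c) := by
    have hmon : (m.scaleRoots (algebraMap D K c)).Monic := (monic_scaleRoots_iff _).2 hm
    refine (eq_of_monic_of_dvd_of_natDegree_le (minpoly.monic (IsIntegral.of_finite K y)) hmon
      (minpoly.dvd K y ?_) ?_).symm
    · have := scaleRoots_aeval_eq_zero (r := algebraMap D K c) (minpoly.aeval K y₀)
      rwa [← IsScalarTower.algebraMap_apply] at this
    · rw [natDegree_scaleRoots, hdeg, hdeg₀]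
  have hlift : m.scaleRoots (algebraMap D K c) ∈ lifts (algebraMap D K) := by
    rw [lifts_iff_coeff_lifts]
    intro n
    rw [coeff_scaleRoots]
    by_cases h0 : m.coeff n = 0
    · exact ⟨0, by simp [h0]⟩
    rcases (le_natDegree_of_ne_zero h0).eq_or_lt with h | h
    · exact ⟨1, by rw [h, hm.coeff_natDegree]; simp⟩
    obtain ⟨a, ha⟩ := hcm (m.coeff n) (coeff_mem_coeffs h0)
    obtain ⟨k, hk⟩ := Nat.exists_eq_add_of_lt h
    refine ⟨a * c ^ k, ?_⟩
    have e : m.natDegree - n = k + 1 := by omega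
    change algebraMap D K a = c • m.coeff n at ha
    rw [e, map_mul, ha, map_pow, Algebra.smul_def]
    ring
  obtain ⟨f, hfm, -, hf⟩ := lifts_and_natDegree_eq_and_monic hlift
    ((monic_scaleRoots_iff _).2 hm)
  refine ⟨y, f, hf, fun g => ?_, fun z => ?_⟩
  · rw [← map_dvd_map _ hDK hf, hfm, ← hmin, minpoly.dvd_iff, aeval_map_algebraMap]
  · have hz : z ∈ K⟮y⟯.toSubalgebra := by rw [hy]; exact mem_top
    rw [adjoin_simple_toSubalgebra_of_isAlgebraic (Algebra.IsAlgebraic.isAlgebraic y),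
      Algebra.adjoin_singleton_eq_range_aeval] at hz
    obtain ⟨q, rfl⟩ := hz
    obtain ⟨a, q', ha, hq⟩ := exists_map_eq_C_mul (A := D) K q
    refine ⟨q', a, ha, ?_⟩
    rw [← aeval_map_algebraMap K, hq, map_mul, aeval_C, ← IsScalarTower.algebraMap_apply, mul_comm]
    rfl

end IntegralGenerator

section EndStep

lemma finiteType_int_of_finiteType (A B : Type*) [CommRing A] [CommRing B] [Algebra A B]
    [hA : Algebra.FiniteType ℤ A] [hB : Algebra.FiniteType A B] : Algebra.FiniteType ℤ B :=
  hA.trans hB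

theorem HasModel.manyPoints {P : ℕ → Prop} {s : ℕ} {R L : Type} [CommRing R] [IsDomain R]
    [Algebra.FiniteType ℤ R] [Field L] [CharZero L] [Algebra R L] [IsFractionRing R L]
    [Algebra.EssFiniteType ℤ L] (h : HasModel P s 1 L) : ManyPoints P (s + 1) R := by
  obtain ⟨A, _, _, _, _, _, hA, hcl, htr⟩ := h
  have hinjA : Function.Injective (algebraMap A L) := FaithfulSMul.algebraMap_injective A L
  have : CharZero A := (algebraMap A L).charZero_iff hinjA |>.2 inferInstance
  let K := FractionRing A
  let _ : Algebra K L := FractionRing.liftAlgebra A L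
  have : IsScalarTower A K L := FractionRing.isScalarTower_liftAlgebra A L
  have hAK : Function.Injective (algebraMap A K) := IsFractionRing.injective A K
  have : Algebra.Transcendental A L := trdeg_ne_zero_iff.1 (by rw [htr]; simp)
  obtain ⟨x, hx⟩ := Algebra.Transcendental.transcendental (R := A) (A := L)
  have hxK : Transcendental K x := fun h => hx ((IsFractionRing.isAlgebraic_iff A K L).2 h)
  let _ : Algebra A[X] L := (aeval x : A[X] →ₐ[A] L).toAlgebra
  have hmap : ∀ q, algebraMap A[X] L q = aeval x q := fun _ => rfl
  have : IsScalarTower A A[X] L := .of_algebraMap_eq fun a => (aeval_C (R := A) x a).symm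
  have hinj : Function.Injective (algebraMap A[X] L) := transcendental_iff_injective.1 hx
  have : FaithfulSMul A[X] L := (faithfulSMul_iff_algebraMap_injective _ _).2 hinj
  have : Algebra.EssFiniteType A[X] L := Algebra.EssFiniteType.of_comp ℤ A[X] L
  have : Algebra.IsAlgebraic A[X] L :=
    trdeg_eq_zero_iff.1 (by simpa using trdeg_polynomial_add_one (n := 0) htr)
  obtain ⟨y, f, hf, hdvd, hgen⟩ := exists_monic_generator A[X] L
  have hfy : f.eval₂ (algebraMap A[X] L) y = 0 := (hdvd f).2 dvd_rfl
  have hd : 1 ≤ f.natDegree := by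
    refine Nat.one_le_iff_ne_zero.2 fun h0 => ?_
    rw [hf.natDegree_eq_zero.1 h0] at hfy
    simp at hfy
  let ι : AdjoinRoot f →+* L := AdjoinRoot.lift (algebraMap A[X] L) y hfy
  have hι : Function.Injective ι := by
    rw [injective_iff_map_eq_zero]
    intro b hb
    obtain ⟨g, rfl⟩ := AdjoinRoot.mk_surjective b
    rw [AdjoinRoot.lift_mk] at hb
    exact AdjoinRoot.mk_eq_zero.2 ((hdvd g).1 hb)
  have : IsDomain (AdjoinRoot f) := hι.isDomain ι
  let _ : Algebra (AdjoinRoot f) L := ι.toAlgebra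
  have : FaithfulSMul (AdjoinRoot f) L := (faithfulSMul_iff_algebraMap_injective _ _).2 hι
  have : IsFractionRing (AdjoinRoot f) L := by
    refine IsFractionRing.of_field _ _ fun z => ?_
    obtain ⟨g, d, hd0, h⟩ := hgen z
    refine ⟨AdjoinRoot.mk f g, AdjoinRoot.of f d, ?_⟩
    have e1 : algebraMap (AdjoinRoot f) L (AdjoinRoot.mk f g) = aeval y g := AdjoinRoot.lift_mk hfy g
    have e2 : algebraMap (AdjoinRoot f) L (AdjoinRoot.of f d) = algebraMap A[X] L d :=
      AdjoinRoot.lift_of hfy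
    rw [e1, e2, ← h, mul_div_cancel_right₀ _ ((map_ne_zero_iff _ hinj).2 hd0)]
  have : Algebra.FiniteType A[X] (AdjoinRoot f) :=
    Algebra.FiniteType.of_surjective (AdjoinRoot.mkₐ f) AdjoinRoot.mk_surjective
  have := finiteType_int_of_finiteType A A[X]
  have := finiteType_int_of_finiteType A[X] (AdjoinRoot f)
  have hcomp : ∀ g : A[X][X], (g.map (mapRingHom (algebraMap A K))).eval₂
      (aeval x : K[X] →ₐ[K] L).toRingHom y = aeval y g := by
    intro g
    rw [eval₂_map, aeval_def]
    congr 1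
    ext a
    · simp [hmap, IsScalarTower.algebraMap_apply A K L]
    · simp [hmap]
  have hmapinj : Function.Injective (mapRingHom (algebraMap A K)) := map_injective _ hAK
  have hirr := irreducible_map_algebraicClosure (K := K) (L := L)
    (fun z hz => mem_range_of_isAlgebraic (A := A) (K := K) hcl hz) hxK (y := y)
    (f := f.map (mapRingHom (algebraMap A K))) (hf.map _) (by rw [hcomp]; exact hfy) (by
      intro g hg hgy
      obtain ⟨a, g', ha, hg'⟩ := exists_map_mapRingHom_eq_C_mul (A := A) K g
      have hg0 : aeval y g' = 0 := by rw [← hcomp, hg', eval₂_mul, hgy, mul_zero]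
      have ha' : (C (algebraMap A K a) : K[X]) ≠ 0 := C_ne_zero.2 ((map_ne_zero_iff _ hAK).2 ha)
      have h0 : g' ≠ 0 := by
        rintro rfl
        rw [Polynomial.map_zero] at hg'
        exact mul_ne_zero (C_ne_zero.2 ha') hg.ne_zero hg'.symm
      rw [natDegree_map_eq_of_injective hmapinj, ← natDegree_C_mul ha', ← hg',
        natDegree_map_eq_of_injective hmapinj]
      exact natDegree_le_of_dvd ((hdvd g').1 hg0) h0)
  let E := algebraicClosure K (AlgebraicClosure L)
  have : IsAlgClosed E := (algebraicClosure.isAlgClosure K (AlgebraicClosure L)).isAlgClosed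
  let _ : Algebra A E := ((algebraMap K E).comp (algebraMap A K)).toAlgebra
  have : FaithfulSMul A E := (faithfulSMul_iff_algebraMap_injective _ _).2
    ((algebraMap K E).injective.comp hAK)
  obtain ⟨δ, hδ, hδirr⟩ := exists_irreducible_map (A := A) (E := E) hf (by
    rw [Polynomial.map_map] at hirr
    convert hirr using 2
    ext a
    · simp [RingHom.algebraMap_toAlgebra]
      rfl
    · simp)
  exact (hA.adjoinRoot hf hd hδ hδirr).of_isFractionRing (L := L)

end EndStep
end PointCount

namespace PointCount
open Polynomial IntermediateField

section Base

lemma hasModel_integralClosure {t : ℕ} {F L : Type} [Field F] [Algebra ℚ F] [Module.Finite ℚ F]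
    [Field L] [CharZero L] [Algebra F L] (hF : ∀ z : L, IsAlgebraic ℚ z → z ∈ (algebraMap F L).range)
    (ht : Algebra.trdeg ℚ L = t) : HasModel (SplitsCompletely F) 0 t L := by
  have : CharZero F := algebraRat.charZero F
  have : IsFractionRing (integralClosure ℤ F) F :=
    integralClosure.isFractionRing_of_finite_extension ℚ F
  have : Module.Finite ℤ (integralClosure ℤ F) := IsIntegralClosure.finite ℤ ℚ F _
  have : Algebra.IsIntegral ℤ (integralClosure ℤ F) := inferInstance
  have hinj : Function.Injective (algebraMap (integralClosure ℤ F) L) :=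
    (algebraMap F L).injective.comp Subtype.val_injective
  have hf : FaithfulSMul (integralClosure ℤ F) L := (faithfulSMul_iff_algebraMap_injective _ _).2 hinj
  have : CharZero (integralClosure ℤ F) := inferInstance
  refine ⟨integralClosure ℤ F, inferInstance, inferInstance, inferInstance, hf, inferInstance, ?_, ?_,
    ?_⟩
  · refine manyPoints_zero_of_isIntegral fun p _ hp => ?_
    by_contra h
    rw [not_nonempty_iff] at h
    rw [SplitsCompletely, Nat.card_of_isEmpty] at hp
    exact Module.finrank_pos.ne hp
  · intro z hz
    have hz' : IsAlgebraic ℤ z := hz.restrictScalars ℤ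
    obtain ⟨c, rfl⟩ := hF z (hz'.extendScalars (algebraMap ℤ ℚ).injective_int)
    obtain ⟨a, b, hb, rfl⟩ := IsFractionRing.div_surjective (A := integralClosure ℤ F) c
    have hb0 : algebraMap (integralClosure ℤ F) F b ≠ 0 :=
      IsFractionRing.to_map_ne_zero_of_mem_nonZeroDivisors hb
    refine ⟨a, b, nonZeroDivisors.ne_zero hb, ?_⟩
    rw [IsScalarTower.algebraMap_apply (integralClosure ℤ F) F L,
      IsScalarTower.algebraMap_apply (integralClosure ℤ F) F L, ← map_mul,
      div_mul_cancel₀ _ hb0]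
  · have : Algebra.IsAlgebraic ℤ ℚ := IsLocalization.isAlgebraic ℚ (nonZeroDivisors ℤ)
    have h1 := trdeg_add_eq ℤ (integralClosure ℤ F) (A := L)
    have h2 := trdeg_add_eq ℤ ℚ (A := L)
    rw [trdeg_eq_zero, zero_add] at h1 h2
    rw [h1, ← h2, ht]

theorem HasModel.manyPoints_add {P : ℕ → Prop} {R L : Type} [CommRing R] [IsDomain R]
    [Algebra.FiniteType ℤ R] [Field L] [CharZero L] [Algebra R L] [IsFractionRing R L]
    [Algebra.EssFiniteType ℤ L] {n s : ℕ} (h : HasModel P s (n + 1) L) :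
    ManyPoints P (s + n + 1) R := by
  induction n generalizing s with
  | zero => exact h.manyPoints
  | succ n ih => simpa [add_assoc, add_comm, add_left_comm] using ih h.succ

theorem manyPoints_splitsCompletely {R L : Type} [CommRing R] [IsDomain R]
    [Algebra.FiniteType ℤ R] [Field L] [CharZero L] [Algebra R L] [IsFractionRing R L]
    {t : ℕ} (ht : 1 ≤ t) {x : Fin t → L} (hx : IsTranscendenceBasis ℚ x)
    (F : IntermediateField ℚ L) (hF : ∀ z, z ∈ F ↔ IsAlgebraic ℚ z) :
    ManyPoints (SplitsCompletely F) t R := by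
  have : Algebra.EssFiniteType R L := Algebra.EssFiniteType.of_isLocalization _ (nonZeroDivisors R)
  have : Algebra.EssFiniteType ℤ L := Algebra.EssFiniteType.comp ℤ R L
  have : Algebra.EssFiniteType ℚ L := Algebra.EssFiniteType.of_comp ℤ ℚ L
  have hFc : F = algebraicClosure ℚ L := by
    ext z
    rw [hF, mem_algebraicClosure_iff]
  have : Module.Finite ℚ F := by
    rw [hFc]
    exact finite_algebraicClosure ℚ L
  obtain ⟨n, rfl⟩ := Nat.exists_eq_add_of_le' ht
  have htr : Algebra.trdeg ℚ L = (n + 1 : ℕ) := by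
    have := hx.lift_cardinalMk_eq_trdeg
    simpa using this.symm
  simpa using (hasModel_integralClosure (F := F) (fun z hz => ⟨⟨z, (hF z).2 hz⟩, rfl⟩)
    htr).manyPoints_add (R := R)

end Base
end PointCount

namespace PointCount

section UpperBound

open MvPolynomial

lemma card_zeros_mul_le {p s : ℕ} [Fact p.Prime] {g : MvPolynomial (Fin s) (ZMod p)} (hg : g ≠ 0) :
    (Finset.univ.filter fun ζ : Fin s → ZMod p => eval ζ g = 0).card * p ≤
      g.totalDegree * p ^ s := by
  have h := schwartz_zippel_totalDegree hg Finset.univ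
  have hp : (0 : ℚ≥0) < p := by exact_mod_cast (Fact.out : p.Prime).pos
  rw [Finset.card_univ, ZMod.card, Fintype.piFinset_univ, div_le_div_iff₀ (by positivity) hp] at h
  exact_mod_cast h

lemma totalDegree_map_le {σ A B : Type*} [CommSemiring A] [CommSemiring B] (f : A →+* B)
    (q : MvPolynomial σ A) : (map f q).totalDegree ≤ q.totalDegree :=
  Finset.sup_mono (support_map_subset f q)

lemma totalDegree_det_le {σ κ A : Type*} [CommRing A] [Fintype κ] [DecidableEq κ]
    {T : Matrix κ κ (MvPolynomial σ A)} {e : ℕ} (hT : ∀ k l, (T k l).totalDegree ≤ e) :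
    T.det.totalDegree ≤ Fintype.card κ * e := by
  rw [Matrix.det_apply]
  refine totalDegree_finsetSum_le fun π _ => ?_
  refine (totalDegree_smul_le _ _).trans ((totalDegree_finsetProd _ _).trans ?_)
  refine (Finset.sum_le_sum fun i _ => hT (π i) i).trans ?_
  simp

lemma exists_map_castRingHom_ne_zero {σ : Type*} {H : MvPolynomial σ ℤ} (hH : H ≠ 0) :
    ∃ p₀ : ℕ, ∀ p, p₀ < p → map (Int.castRingHom (ZMod p)) H ≠ 0 := by
  obtain ⟨v, hv⟩ := ne_zero_iff.1 hH
  refine ⟨(coeff v H).natAbs, fun p hp h => ?_⟩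
  have h1 := congr_arg (coeff v) h
  rw [coeff_map, coeff_zero, eq_intCast, ZMod.intCast_zmod_eq_zero_iff_dvd] at h1
  exact (Nat.le_of_dvd (Int.natAbs_pos.2 hv) (Int.natCast_dvd.1 h1)).not_gt hp

variable {σ κ J R : Type*} [Fintype κ] [CommRing R] [Algebra (MvPolynomial σ ℤ) R]

/-- In a family `b` such that `H • y j * b k` lies in the span of `b`, multiplication by a polynomial
in `y` of degree `D` is given, up to `H ^ D`, by a matrix with entries of degree `O(D)`. -/
lemma exists_matrix_of_totalDegree_le {H : MvPolynomial σ ℤ} {b : κ → R} {y : J → R}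
    {M : J → κ → κ → MvPolynomial σ ℤ}
    (hM : ∀ j k, ∑ l, M j k l • b l = H • (y j * b k)) {c : ℕ} (hc : H.totalDegree ≤ c)
    (hMc : ∀ j k l, (M j k l).totalDegree ≤ c) {D : ℕ} {f : MvPolynomial J ℤ}
    (hf : f.totalDegree ≤ D) :
    ∃ T : Matrix κ κ (MvPolynomial σ ℤ), (∀ k l, (T k l).totalDegree ≤ c * D) ∧
      ∀ k, ∑ l, T k l • b l = H ^ D • (aeval y f * b k) := by
  classical
  let Q : ℕ → R → Prop := fun D w => ∃ T : Matrix κ κ (MvPolynomial σ ℤ),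
    (∀ k l, (T k l).totalDegree ≤ c * D) ∧ ∀ k, ∑ l, T k l • b l = H ^ D • (w * b k)
  have Q1 : Q 0 1 := by
    refine ⟨1, fun k l => ?_, fun k => ?_⟩
    · rw [Matrix.one_apply]
      split_ifs <;> simp
    · simp [Matrix.one_apply]
  have Qadd : ∀ D w w', Q D w → Q D w' → Q D (w + w') := by
    rintro D w w' ⟨T, hT, h⟩ ⟨T', hT', h'⟩
    refine ⟨T + T', fun k l => (totalDegree_add _ _).trans (max_le (hT k l) (hT' k l)), fun k => ?_⟩
    simp only [Matrix.add_apply, add_smul, Finset.sum_add_distrib, h, h', add_mul, smul_add]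
  have Qmul : ∀ D w (a : ℤ), Q D w → Q D (a * w) := by
    rintro D w a ⟨T, hT, h⟩
    refine ⟨fun k l => a • T k l, fun k l => (totalDegree_smul_le _ _).trans (hT k l), fun k => ?_⟩
    simp only [smul_assoc, ← Finset.smul_sum, h]
    rw [zsmul_eq_mul, mul_assoc, mul_smul_comm]
  have QH : ∀ D w, Q D w → Q (D + 1) w := by
    rintro D w ⟨T, hT, h⟩
    refine ⟨fun k l => H * T k l, fun k l => (totalDegree_mul _ _).trans ?_, fun k => ?_⟩
    · have := hT k l
      rw [mul_add, mul_one]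
      omega
    · simp only [mul_smul, ← Finset.smul_sum, h, pow_succ']
  have Qy : ∀ D w j, Q D w → Q (D + 1) (w * y j) := by
    rintro D w j ⟨T, hT, h⟩
    refine ⟨fun k l => ∑ i, M j k i * T i l, fun k l => totalDegree_finsetSum_le fun i _ =>
      (totalDegree_mul _ _).trans ?_, fun k => ?_⟩
    · have := hT i l
      have := hMc j k i
      rw [mul_add, mul_one]
      omega
    · simp only [Finset.sum_smul, mul_smul]
      rw [Finset.sum_comm]
      simp only [← Finset.smul_sum, h]
      rw [pow_succ, mul_smul, mul_assoc, ← mul_smul_comm H, ← hM, Finset.mul_sum, Finset.smul_sum]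
      refine Finset.sum_congr rfl fun l _ => ?_
      rw [mul_smul_comm, smul_comm]
  have Qle : ∀ D D' w, D ≤ D' → Q D w → Q D' w := by
    intro D D' w hDD' h
    induction hDD' with
    | refl => exact h
    | step _ ih => exact QH _ _ ih
  have Qmon : ∀ (v : J →₀ ℕ) D w, Q D w →
      Q (D + v.sum fun _ e => e) (w * v.prod fun j e => y j ^ e) := by
    intro v
    induction v using Finsupp.induction_linear with
    | zero => simp
    | add v v' ih ih' =>
      intro D w hw
      rw [Finsupp.sum_add_index' (by simp) (by simp),
        Finsupp.prod_add_index' (by simp) (fun j _ _ => pow_add (y j) _ _), ← add_assoc, ← mul_assoc]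
      exact ih' _ _ (ih _ _ hw)
    | single j e =>
      intro D w hw
      rw [Finsupp.sum_single_index rfl, Finsupp.prod_single_index (h := fun j e => y j ^ e) (pow_zero _)]
      induction e with
      | zero => simpa using hw
      | succ e ih =>
        rw [pow_succ, ← mul_assoc, ← add_assoc]
        exact Qy _ _ j ih
  have key : ∀ S ⊆ f.support, Q D (∑ v ∈ S, aeval y (monomial v (coeff v f))) := by
    intro S hS
    induction S using Finset.induction_on with
    | empty =>
      refine ⟨0, fun k l => by simp, fun k => by simp⟩
    | insert v S hv ih =>
      rw [Finset.sum_insert hv]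
      refine Qadd _ _ _ ?_ (ih ((Finset.subset_insert _ _).trans hS))
      rw [aeval_monomial]
      exact Qle _ _ _ ((le_totalDegree (hS (Finset.mem_insert_self _ _))).trans hf)
        (by simpa using Qmul _ _ (coeff v f) (Qmon v 0 1 Q1))
  have := key _ subset_rfl
  rwa [← map_sum, ← f.as_sum] at this

lemma natCast_C_smul (p : ℕ) (w : R) : (C (p : ℤ) : MvPolynomial σ ℤ) • w = p * w := by
  rw [Algebra.smul_def]
  simp

/-- The determinant of multiplication by an element which is regular modulo `p` does not vanish
modulo `p`. -/
lemma map_det_ne_zero [DecidableEq κ] {H : MvPolynomial σ ℤ} {b : κ → R}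
    (hb : LinearIndependent (MvPolynomial σ ℤ) b)
    (hspan : ∀ w : R, ∃ (e : ℕ) (a : κ → MvPolynomial σ ℤ), ∑ l, a l • b l = H ^ e • w)
    {p : ℕ} [Fact p.Prime] (hH : map (Int.castRingHom (ZMod p)) H ≠ 0) {r : R}
    (hr : ∀ w v : R, r * w = p * v → ∃ u, w = p * u) {T : Matrix κ κ (MvPolynomial σ ℤ)} {D : ℕ}
    (hT : ∀ k, ∑ l, T k l • b l = H ^ D • (r * b k)) :
    map (Int.castRingHom (ZMod p)) T.det ≠ 0 := by
  intro h
  set red : MvPolynomial σ ℤ →+* MvPolynomial σ (ZMod p) := map (Int.castRingHom (ZMod p))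
  have hred : ∀ q, red q = 0 → ∃ u, q = C (p : ℤ) * u := fun q hq => (C_dvd_iff_zmod p q).2 hq
  rw [RingHom.map_det] at h
  obtain ⟨v', hv0, hv'⟩ := Matrix.exists_vecMul_eq_zero_iff.2 h
  have hsurj : Function.Surjective red := map_surjective _ ZMod.intCast_surjective
  choose v hv using fun k => hsurj (v' k)
  have h1 : ∀ l, ∃ u, ∑ k, v k * T k l = C (p : ℤ) * u := by
    intro l
    refine hred _ ?_
    rw [map_sum]
    simp only [map_mul, hv]
    exact congr_fun hv' l
  choose u hu using h1
  have h2 : r * (H ^ D • ∑ k, v k • b k) = p * ∑ l, u l • b l := by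
    rw [Finset.smul_sum, Finset.mul_sum, ← natCast_C_smul (σ := σ), Finset.smul_sum]
    simp only [← mul_smul, ← hu]
    simp only [Finset.sum_smul, mul_smul]
    rw [Finset.sum_comm]
    refine Finset.sum_congr rfl fun k _ => ?_
    rw [← Finset.smul_sum, hT, mul_smul_comm, mul_smul_comm, smul_comm]
  obtain ⟨w, hw⟩ := hr _ _ h2
  obtain ⟨e, a, ha⟩ := hspan w
  have h3 : ∑ k, (H ^ (e + D) * v k - C (p : ℤ) * a k) • b k = 0 := by
    simp only [sub_smul, Finset.sum_sub_distrib, mul_smul, ← Finset.smul_sum]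
    rw [pow_add, mul_smul, hw, ha, natCast_C_smul, mul_smul_comm, sub_self]
  refine hv0 (funext fun k => ?_)
  have h4 := congr_arg red (sub_eq_zero.1 (Fintype.linearIndependent_iff.1 hb _ h3 k))
  have h5 : red (C (p : ℤ)) = 0 := by simp [red]
  rw [map_mul, map_mul, h5, zero_mul, map_pow, hv] at h4
  exact (mul_eq_zero.1 h4).resolve_left (pow_ne_zero _ hH)

lemma eval_map_castRingHom {p : ℕ} (φ : R →+* ZMod p) (q : MvPolynomial σ ℤ) :
    eval (fun i => φ (algebraMap (MvPolynomial σ ℤ) R (X i))) (map (Int.castRingHom (ZMod p)) q) =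
      φ (algebraMap _ R q) := by
  have : (eval (fun i => φ (algebraMap (MvPolynomial σ ℤ) R (X i)))).comp
      (map (Int.castRingHom (ZMod p))) = φ.comp (algebraMap _ R) := by
    ext <;> simp
  exact congr_arg (fun f => f q) this

/-- A homomorphism killing `r` sends the variables to a zero of `H` or of the norm of `r`. -/
lemma eval_det_mul_eq_zero [DecidableEq κ] {H : MvPolynomial σ ℤ} {b : κ → R}
    (h1 : ∃ a : κ → MvPolynomial σ ℤ, ∑ l, a l • b l = H • (1 : R))
    {p : ℕ} [Fact p.Prime] {r : R} {T : Matrix κ κ (MvPolynomial σ ℤ)} {D : ℕ}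
    (hT : ∀ k, ∑ l, T k l • b l = H ^ D • (r * b k)) {φ : R →+* ZMod p} (hφ : φ r = 0) :
    eval (fun i => φ (algebraMap (MvPolynomial σ ℤ) R (X i)))
      (map (Int.castRingHom (ZMod p)) (T.det * H)) = 0 := by
  rw [eval_map_castRingHom, map_mul, map_mul]
  by_cases hb : (fun k => φ (b k)) = 0
  · obtain ⟨a, ha⟩ := h1
    have := congr_arg φ ha
    simp only [Algebra.smul_def, map_sum, map_mul, mul_one] at this
    rw [← this]
    have hb' : ∀ k, φ (b k) = 0 := congr_fun hb
    simp [hb']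
  · have hdet : (T.map (φ.comp (algebraMap (MvPolynomial σ ℤ) R))).det = 0 := by
      refine Matrix.exists_mulVec_eq_zero_iff.1 ⟨_, hb, funext fun k => ?_⟩
      have := congr_arg φ (hT k)
      simp only [Algebra.smul_def, map_sum, map_mul, hφ, zero_mul, mul_zero] at this
      exact this
    have := RingHom.map_det (φ.comp (algebraMap (MvPolynomial σ ℤ) R)) T
    rw [RingHom.mapMatrix_apply, hdet, RingHom.comp_apply] at this
    rw [this, zero_mul]

end UpperBound
end PointCount

namespace PointCount

section UpperBoundCount

open MvPolynomial

variable {σ κ J R : Type*} [Fintype κ] [CommRing R] [Algebra (MvPolynomial σ ℤ) R]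

lemma ringHom_ext_of_adjoin_eq_top {S : Type*} [CommRing S] {y : J → R}
    (hy : Algebra.adjoin ℤ (Set.range y) = ⊤) {φ ψ : R →+* S} (h : ∀ j, φ (y j) = ψ (y j)) :
    φ = ψ := by
  have : φ.toIntAlgHom = ψ.toIntAlgHom := by
    refine AlgHom.ext_of_adjoin_eq_top hy ?_
    rintro _ ⟨j, rfl⟩
    exact h j
  exact RingHom.ext fun r => congr_arg (fun f => f r) this

lemma finite_ringHom_zmod [Finite J] {y : J → R} (hy : Algebra.adjoin ℤ (Set.range y) = ⊤)
    (p : ℕ) [NeZero p] : Finite (R →+* ZMod p) :=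
  Finite.of_injective (fun (φ : R →+* ZMod p) j => φ (y j))
    fun _ _ h => ringHom_ext_of_adjoin_eq_top hy (congr_fun h)

lemma card_fiber_le [Fintype J] {y : J → R} (hy : Algebra.adjoin ℤ (Set.range y) = ⊤) {n : ℕ}
    {G : J → Polynomial (MvPolynomial σ ℤ)} (hG : ∀ j, (G j).Monic)
    (hGy : ∀ j, (G j).eval₂ (algebraMap _ R) (n * y j) = 0) {p : ℕ} [Fact p.Prime]
    (hpn : (n : ZMod p) ≠ 0) (ζ : σ → ZMod p) (S : Finset (R →+* ZMod p))
    (hS : ∀ φ ∈ S, ∀ i, φ (algebraMap (MvPolynomial σ ℤ) R (X i)) = ζ i) :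
    S.card ≤ ∏ j, (G j).natDegree := by
  classical
  let ev : MvPolynomial σ ℤ →+* ZMod p := (eval ζ).comp (map (Int.castRingHom (ZMod p)))
  have h1 : ∀ j, ((G j).map ev).roots.toFinset.card ≤ (G j).natDegree := fun j =>
    (Multiset.toFinset_card_le _).trans ((Polynomial.card_roots' _).trans
      Polynomial.natDegree_map_le)
  refine le_trans ?_ (Finset.prod_le_prod' fun j _ => h1 j)
  rw [← Fintype.card_piFinset]
  refine Finset.card_le_card_of_injOn (fun φ j => φ (n * y j)) (fun φ hφ => ?_) ?_
  · simp only [Finset.mem_coe, Fintype.mem_piFinset, Multiset.mem_toFinset]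
    intro j
    rw [Polynomial.mem_roots ((hG j).map _).ne_zero, Polynomial.IsRoot, Polynomial.eval_map]
    have h2 : ev = φ.comp (algebraMap (MvPolynomial σ ℤ) R) := by
      ext i
      · simp
      · simpa [ev] using (hS φ hφ i).symm
    rw [h2, ← Polynomial.hom_eval₂, hGy, map_zero]
  · intro φ _ ψ _ h
    refine ringHom_ext_of_adjoin_eq_top hy fun j => ?_
    have := congr_fun h j
    simp only [map_mul, map_natCast] at this
    exact mul_left_cancel₀ hpn this

theorem exists_card_ker_mul_le [Finite J] {s : ℕ} [Algebra (MvPolynomial (Fin s) ℤ) R] {y : J → R}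
    (hy : Algebra.adjoin ℤ (Set.range y) = ⊤) {n : ℕ} (hn : n ≠ 0)
    (hintg : ∀ j, IsIntegral (MvPolynomial (Fin s) ℤ) (n * y j)) {b : κ → R}
    (hb : LinearIndependent (MvPolynomial (Fin s) ℤ) b) {H : MvPolynomial (Fin s) ℤ} (hH : H ≠ 0)
    (h1 : ∃ a : κ → MvPolynomial (Fin s) ℤ, ∑ l, a l • b l = H • (1 : R))
    (hyb : ∀ j k, ∃ a : κ → MvPolynomial (Fin s) ℤ, ∑ l, a l • b l = H • (y j * b k)) :
    ∃ C p₀ : ℕ, ∀ (p : ℕ) [Fact p.Prime], p₀ < p → ∀ D, 1 ≤ D → ∀ f : MvPolynomial J ℤ,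
      f.totalDegree ≤ D → (∀ w v : R, aeval y f * w = p * v → ∃ u, w = p * u) →
      Nat.card {φ : R →+* ZMod p // φ (aeval y f) = 0} * p ≤ C * D * p ^ s := by
  classical
  have := Fintype.ofFinite J
  choose M hM using hyb
  choose G hG hGy using hintg
  obtain ⟨p₁, hp₁⟩ := exists_map_castRingHom_ne_zero hH
  let c := H.totalDegree + ∑ j, ∑ k, ∑ l, (M j k l).totalDegree
  have hMc : ∀ j k l, (M j k l).totalDegree ≤ c := fun j k l => by
    have e1 := Finset.single_le_sum (f := fun l => (M j k l).totalDegree) (fun _ _ => Nat.zero_le _)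
      (Finset.mem_univ l)
    have e2 := Finset.single_le_sum (f := fun k => ∑ l, (M j k l).totalDegree)
      (fun _ _ => Nat.zero_le _) (Finset.mem_univ k)
    have e3 := Finset.single_le_sum (f := fun j => ∑ k, ∑ l, (M j k l).totalDegree)
      (fun _ _ => Nat.zero_le _) (Finset.mem_univ j)
    exact ((e1.trans e2).trans e3).trans (Nat.le_add_left _ _)
  have hc : H.totalDegree ≤ c := Nat.le_add_right _ _
  have hspan : ∀ w : R, ∃ (e : ℕ) (a : κ → MvPolynomial (Fin s) ℤ), ∑ l, a l • b l = H ^ e • w := by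
    intro w
    have hw : w ∈ Algebra.adjoin ℤ (Set.range y) := hy ▸ Algebra.mem_top
    rw [Algebra.adjoin_range_eq_range_aeval] at hw
    obtain ⟨f, rfl : aeval y f = w⟩ := hw
    obtain ⟨T, -, hT⟩ := exists_matrix_of_totalDegree_le hM hc hMc (le_refl f.totalDegree)
    obtain ⟨a, ha⟩ := h1
    refine ⟨f.totalDegree + 1, fun l => ∑ k, a k * T k l, ?_⟩
    simp only [Finset.sum_smul, mul_smul]
    rw [Finset.sum_comm]
    simp only [← Finset.smul_sum, hT]
    have e1 : H • aeval y f = aeval y f * H • (1 : R) := by rw [mul_smul_comm, mul_one]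
    rw [pow_succ, mul_smul, e1, ← ha, Finset.mul_sum, Finset.smul_sum]
    refine Finset.sum_congr rfl fun k _ => ?_
    rw [mul_smul_comm, smul_comm]
  refine ⟨(∏ j, (G j).natDegree) * (Fintype.card κ * c + c), max p₁ n,
    fun p _ hp D hD f hf hreg => ?_⟩
  have hpn : (n : ZMod p) ≠ 0 := by
    rw [Ne, ZMod.natCast_eq_zero_iff]
    exact fun h => (Nat.le_of_dvd (Nat.pos_of_ne_zero hn) h).not_gt ((le_max_right _ _).trans_lt hp)
  have hHp := hp₁ p ((le_max_left _ _).trans_lt hp)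
  obtain ⟨T, hTdeg, hT⟩ := exists_matrix_of_totalDegree_le hM hc hMc hf
  have hdet := map_det_ne_zero hb hspan hHp hreg hT
  set g := map (Int.castRingHom (ZMod p)) (T.det * H)
  have hg : g ≠ 0 := by
    simp only [g, map_mul]
    exact mul_ne_zero hdet hHp
  have hgdeg : g.totalDegree ≤ (Fintype.card κ * c + c) * D := by
    refine (totalDegree_map_le _ _).trans ((totalDegree_mul _ _).trans ?_)
    have e1 := totalDegree_det_le hTdeg
    have e2 : c ≤ c * D := Nat.le_mul_of_pos_right _ hD
    rw [add_mul, mul_assoc]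
    omega
  have := finite_ringHom_zmod hy p
  have := Fintype.ofFinite (R →+* ZMod p)
  let S : Finset (R →+* ZMod p) := Finset.univ.filter fun φ => φ (aeval y f) = 0
  have hcard : Nat.card {φ : R →+* ZMod p // φ (aeval y f) = 0} = S.card := by
    rw [Nat.card_eq_fintype_card, Fintype.card_subtype]
  have hfib := Finset.card_le_mul_card_image_of_maps_to (s := S)
    (t := Finset.univ.filter fun ζ : Fin s → ZMod p => eval ζ g = 0)
    (f := fun φ i => φ (algebraMap (MvPolynomial (Fin s) ℤ) R (X i)))
    (fun φ hφ => by
      rw [Finset.mem_filter]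
      exact ⟨Finset.mem_univ _, eval_det_mul_eq_zero h1 hT (Finset.mem_filter.1 hφ).2⟩)
    (∏ j, (G j).natDegree)
    (fun ζ _ => card_fiber_le hy hG hGy hpn ζ _ fun φ hφ i =>
      congr_fun (Finset.mem_filter.1 hφ).2 i)
  rw [hcard]
  calc S.card * p ≤ (∏ j, (G j).natDegree) *
        (Finset.univ.filter fun ζ : Fin s → ZMod p => eval ζ g = 0).card * p :=
        Nat.mul_le_mul_right _ hfib
    _ ≤ (∏ j, (G j).natDegree) * (g.totalDegree * p ^ s) := by
        rw [mul_assoc]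
        exact Nat.mul_le_mul_left _ (card_zeros_mul_le hg)
    _ ≤ (∏ j, (G j).natDegree) * ((Fintype.card κ * c + c) * D * p ^ s) := by gcongr
    _ = _ := by ring

end UpperBoundCount
end PointCount

namespace PointCount

section NoetherNormalization

open MvPolynomial

variable {J R L : Type*} [CommRing R] [Field L] [CharZero L] [Algebra R L]

lemma exists_natCast_mul_mem_range {y : J → R} {z : L}
    (hz : z ∈ Algebra.adjoin ℚ (Set.range (algebraMap R L ∘ y))) :
    ∃ n : ℕ, n ≠ 0 ∧ ∃ r : R, algebraMap R L r = n * z := by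
  induction hz using Algebra.adjoin_induction with
  | mem x hx =>
    obtain ⟨j, rfl⟩ := hx
    exact ⟨1, one_ne_zero, y j, by simp⟩
  | algebraMap q =>
    refine ⟨q.den, q.den_nz, q.num, ?_⟩
    rw [map_intCast, eq_ratCast, ← Rat.cast_natCast, ← Rat.cast_mul, Rat.den_mul_eq_num,
      Rat.cast_intCast]
  | add z w _ _ hz hw =>
    obtain ⟨n, hn, r, hr⟩ := hz
    obtain ⟨n', hn', r', hr'⟩ := hw
    refine ⟨n * n', mul_ne_zero hn hn', n' * r + n * r', ?_⟩
    simp only [map_add, map_mul, map_natCast, hr, hr', Nat.cast_mul]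
    ring
  | mul z w _ _ hz hw =>
    obtain ⟨n, hn, r, hr⟩ := hz
    obtain ⟨n', hn', r', hr'⟩ := hw
    refine ⟨n * n', mul_ne_zero hn hn', r * r', ?_⟩
    simp only [map_mul, hr, hr', Nat.cast_mul]
    ring

lemma exists_algebraicIndependent_isIntegralElem [Finite J] (y : J → R) :
    ∃ (s : ℕ) (r : Fin s → R), AlgebraicIndependent ℚ (algebraMap R L ∘ r) ∧
      ∀ j, (aeval (algebraMap R L ∘ r) :
        MvPolynomial (Fin s) ℚ →ₐ[ℚ] L).toRingHom.IsIntegralElem (algebraMap R L (y j)) := by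
  let A := Algebra.adjoin ℚ (Set.range (algebraMap R L ∘ y))
  have : Algebra.FiniteType ℚ A := by
    rw [← Subalgebra.fg_iff_finiteType]
    exact Subalgebra.fg_def.2 ⟨_, Set.finite_range _, rfl⟩
  obtain ⟨s, g, hg, hintg⟩ := exists_integral_inj_algHom_of_fg ℚ A
  have h1 : ∀ i, ∃ n : ℕ, n ≠ 0 ∧ ∃ r : R, algebraMap R L r = n * (g (X i) : L) :=
    fun i => exists_natCast_mul_mem_range (g (X i)).2
  choose n hn r hr using h1
  have hn' : ∀ i, (n i : ℚ) ≠ 0 := fun i => Nat.cast_ne_zero.2 (hn i)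
  have hnL : ∀ i, (n i : L) ≠ 0 := fun i => Nat.cast_ne_zero.2 (hn i)
  let e : MvPolynomial (Fin s) ℚ →ₐ[ℚ] MvPolynomial (Fin s) ℚ := aeval fun i => C (n i : ℚ) * X i
  let e' : MvPolynomial (Fin s) ℚ →ₐ[ℚ] MvPolynomial (Fin s) ℚ :=
    aeval fun i => C (n i : ℚ)⁻¹ * X i
  have he : e'.comp e = AlgHom.id ℚ _ := by
    ext i : 1
    simp only [e, e', AlgHom.comp_apply, aeval_X, map_mul, AlgHom.id_apply, algHom_C,
      algebraMap_eq]
    rw [← mul_assoc, ← C_mul, mul_inv_cancel₀ (hn' i), C_1, one_mul]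
  have hφ : (aeval (algebraMap R L ∘ r)).comp e' = A.val.comp g := by
    ext i
    simp [e', hr, hnL i]
  refine ⟨s, r, ?_, fun j => ?_⟩
  · rw [algebraicIndependent_iff]
    intro f hf
    have h2 : e' (e f) = f := DFunLike.congr_fun he f
    rw [← h2] at hf ⊢
    have h3 : A.val (g (e f)) = 0 := (DFunLike.congr_fun hφ (e f)).symm.trans hf
    rw [Subalgebra.val_apply, ZeroMemClass.coe_eq_zero, map_eq_zero_iff g hg] at h3
    rw [h3, map_zero]
  · obtain ⟨q, hq, hqy⟩ := hintg ⟨algebraMap R L (y j), Algebra.subset_adjoin ⟨j, rfl⟩⟩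
    refine ⟨q.map e'.toRingHom, hq.map _, ?_⟩
    rw [Polynomial.eval₂_map]
    have h4 : ((aeval (algebraMap R L ∘ r)).toRingHom.comp e'.toRingHom) =
      A.val.toRingHom.comp g.toRingHom := congr_arg AlgHom.toRingHom hφ
    rw [h4]
    have h5 := congr_arg A.val.toRingHom hqy
    rw [Polynomial.hom_eval₂, map_zero] at h5
    exact h5

lemma exists_isIntegral_natCast_mul [Finite J] [IsDomain R] (y : J → R)
    (hL : Function.Injective (algebraMap R L)) {s : ℕ} [Algebra (MvPolynomial (Fin s) ℤ) R]
    (hintg : ∀ j, (aeval (fun i => algebraMap R L (algebraMap (MvPolynomial (Fin s) ℤ) R (X i))) :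
        MvPolynomial (Fin s) ℚ →ₐ[ℚ] L).toRingHom.IsIntegralElem (algebraMap R L (y j))) :
    ∃ n : ℕ, n ≠ 0 ∧ ∀ j, IsIntegral (MvPolynomial (Fin s) ℤ) (n * y j) := by
  have := Fintype.ofFinite J
  let P := MvPolynomial (Fin s) ℤ
  let Q := MvPolynomial (Fin s) ℚ
  let : Algebra P Q := algebraMvPolynomial
  let φ : Q →ₐ[ℚ] L := aeval (fun i => algebraMap R L (algebraMap P R (X i)))
  let : Algebra Q L := φ.toRingHom.toAlgebra
  let : Algebra P L := ((algebraMap R L).comp (algebraMap P R)).toAlgebra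
  have : IsScalarTower P R L := .of_algebraMap_eq fun _ => rfl
  have : IsScalarTower P Q L := by
    refine .of_algebraMap_eq' ?_
    ext i
    · exact DFunLike.congr_fun (Subsingleton.elim ((algebraMap P L).comp C)
        (((algebraMap Q L).comp (algebraMap P Q)).comp C)) _
    · change algebraMap R L (algebraMap P R (X i)) = φ (MvPolynomial.map _ (X i))
      rw [map_X]
      exact ((aeval_X (R := ℚ) (fun i => algebraMap R L (algebraMap P R (X i))) i) :).symm
  have : IsLocalization ((nonZeroDivisors ℤ).map (C (σ := Fin s))) Q :=
    MvPolynomial.isLocalization _ _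
  have h1 : ∀ j, ∃ n : ℕ, n ≠ 0 ∧ IsIntegral P (n * y j) := fun j => by
    have h2 : IsIntegral Q (algebraMap R L (y j)) := hintg j
    obtain ⟨⟨_, a, ha, rfl⟩, h3⟩ :=
      h2.exists_multiple_integral_of_isLocalization ((nonZeroDivisors ℤ).map (C (σ := Fin s)))
    refine ⟨a.natAbs, by simpa using ha, ?_⟩
    rw [← isIntegral_algebraMap_iff (B := L) hL]
    have h4 : (a : L) * algebraMap R L (y j) = (C a : P) • algebraMap R L (y j) := by
      rw [Algebra.smul_def]
      congr 1
      simp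
    have h5 : IsIntegral P ((a : L) * algebraMap R L (y j)) := h4 ▸ h3
    rw [map_mul, map_natCast]
    obtain h | h := Int.natAbs_eq a
    · rwa [h, Int.cast_natCast] at h5
    · rw [h, Int.cast_neg, Int.cast_natCast, neg_mul] at h5
      simpa using h5.neg
  choose n hn hi using h1
  refine ⟨∏ j, n j, Finset.prod_ne_zero_iff.2 fun j _ => hn j, fun j => ?_⟩
  classical
  rw [← Finset.mul_prod_erase _ _ (Finset.mem_univ j), Nat.cast_mul, mul_comm (n j : R), mul_assoc]
  refine IsIntegral.mul ?_ (hi j)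
  rw [← map_natCast (algebraMap P R)]
  exact isIntegral_algebraMap

end NoetherNormalization
end PointCount

namespace PointCount

section ExistsLattice

variable {P R L : Type*} [CommRing P] [IsDomain P] [CommRing R] [IsDomain R] [Algebra P R]
  [FaithfulSMul P R] [Algebra.IsAlgebraic P R] [Algebra.FiniteType P R]

lemma exists_linearIndependent_smul_mem_span :
    ∃ (d : ℕ) (b : Fin d → R), LinearIndependent P b ∧
      ∀ w : R, ∃ h : P, h ≠ 0 ∧ ∃ a : Fin d → P, ∑ l, a l • b l = h • w := by
  let K := FractionRing P
  let L := FractionRing R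
  have hRL : Function.Injective (algebraMap R L) := IsFractionRing.injective R L
  have : FaithfulSMul P L := by
    rw [faithfulSMul_iff_algebraMap_injective, IsScalarTower.algebraMap_eq P R L]
    exact hRL.comp (FaithfulSMul.algebraMap_injective P R)
  let : Algebra K L := FractionRing.liftAlgebra P L
  have : IsScalarTower P K L := FractionRing.isScalarTower_liftAlgebra P L
  have : Algebra.IsAlgebraic P L := (IsFractionRing.isAlgebraic_iff' P R L).1 inferInstance
  have : Algebra.IsAlgebraic K L := (IsFractionRing.comap_isAlgebraic_iff (A := P)).1 inferInstance
  have : Algebra.EssFiniteType R L := .of_isLocalization _ (nonZeroDivisors R)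
  have : Algebra.EssFiniteType P L := .comp P R L
  have : Algebra.EssFiniteType K L := .of_comp P K L
  have : Module.Finite K L := Algebra.finite_of_essFiniteType_of_isAlgebraic
  let b₀ := Module.finBasis K L
  obtain ⟨c, hc⟩ := IsLocalization.exist_integer_multiples_of_finite (nonZeroDivisors R) b₀
  obtain ⟨q, hq, c', hqc⟩ :=
    (Algebra.IsAlgebraic.isAlgebraic (R := P) (c : R)).exists_nonzero_dvd c.2
  choose b' hb' using hc
  have hqK : IsUnit (algebraMap P K q) := by
    rwa [isUnit_iff_ne_zero, Ne, map_eq_zero_iff _ (IsFractionRing.injective P K)]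
  let b₁ := b₀.isUnitSMul (fun _ => hqK)
  have hb₁ : ∀ i, b₁ i = algebraMap R L (c' * b' i) := fun i => by
    rw [Module.Basis.isUnitSMul_apply, map_mul, hb', algebraMap_smul, Algebra.smul_def,
      Algebra.smul_def, IsScalarTower.algebraMap_apply P R L, hqc, map_mul]
    ring
  refine ⟨_, fun i => c' * b' i, ?_, fun w => ?_⟩
  · have h1 : LinearIndependent P b₁ := b₁.linearIndependent.restrict_scalars (by
      simpa [Algebra.smul_def] using IsFractionRing.injective P K)
    have h2 : (b₁ : _ → L) = (IsScalarTower.toAlgHom P R L).toLinearMap ∘ fun i => c' * b' i :=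
      funext hb₁
    rw [h2] at h1
    exact h1.of_comp _
  · obtain ⟨h, hh⟩ := IsLocalization.exist_integer_multiples_of_finite (nonZeroDivisors P)
      (b₁.repr (algebraMap R L w))
    choose a ha using hh
    refine ⟨h, nonZeroDivisors.ne_zero h.2, a, hRL ?_⟩
    have h3 := b₁.sum_repr (algebraMap R L w)
    rw [map_sum, Algebra.smul_def, map_mul, ← IsScalarTower.algebraMap_apply, ← Algebra.smul_def,
      ← h3, Finset.smul_sum]
    refine Finset.sum_congr rfl fun i _ => ?_
    rw [Algebra.smul_def, map_mul, ← hb₁, ← IsScalarTower.algebraMap_apply,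
      IsScalarTower.algebraMap_apply P K L, ha, ← Algebra.smul_def, smul_assoc]

end ExistsLattice

section UpperBound

open MvPolynomial

theorem exists_card_ker_aeval_mul_le {J R L : Type*} [Finite J] [CommRing R] [IsDomain R] [Field L]
    [CharZero L] [Algebra R L] [IsFractionRing R L] {y : J → R}
    (hy : Algebra.adjoin ℤ (Set.range y) = ⊤) {t : ℕ} (ht : Algebra.trdeg ℚ L = t) :
    ∃ C p₀ : ℕ, ∀ (p : ℕ) [Fact p.Prime], p₀ < p → ∀ D, 1 ≤ D → ∀ f : MvPolynomial J ℤ,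
      f.totalDegree ≤ D → (∀ w v : R, aeval y f * w = p * v → ∃ u, w = p * u) →
      Nat.card {φ : R →+* ZMod p // φ (aeval y f) = 0} * p ≤ C * D * p ^ t := by
  classical
  have := Fintype.ofFinite J
  have hRL : Function.Injective (algebraMap R L) := IsFractionRing.injective R L
  obtain ⟨s, r, hr, hintg⟩ := exists_algebraicIndependent_isIntegralElem (L := L) y
  have hst : s ≤ t := by
    have := hr.lift_cardinalMk_le_trdeg
    rw [ht] at this
    simpa using this
  have hrZ : AlgebraicIndependent ℤ r :=
    (hr.restrictScalars (R := ℤ) Int.cast_injective).of_comp (IsScalarTower.toAlgHom ℤ R L)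
  let P := MvPolynomial (Fin s) ℤ
  let : Algebra P R := (aeval r).toRingHom.toAlgebra
  have hX : ∀ i, algebraMap P R (X i) = r i := fun i => aeval_X r i
  have : FaithfulSMul P R := (faithfulSMul_iff_algebraMap_injective P R).2 hrZ
  obtain ⟨n, hn, hny⟩ := exists_isIntegral_natCast_mul (L := L) y hRL (s := s) (by
    simp only [P] at hX
    simp only [hX]
    exact hintg)
  have : CharZero R := (algebraMap R L).charZero
  have : Algebra.IsAlgebraic P R := by
    refine ⟨fun w => ?_⟩
    have hw : w ∈ Algebra.adjoin ℤ (Set.range y) := hy ▸ Algebra.mem_top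
    induction hw using Algebra.adjoin_induction with
    | mem w hw =>
      obtain ⟨j, rfl⟩ := hw
      refine IsAlgebraic.of_mul (y := (n : R)) (by simpa using hn) ?_ (hny j).isAlgebraic
      simpa using isAlgebraic_algebraMap (A := R) (n : P)
    | algebraMap a => simpa using isAlgebraic_algebraMap (A := R) (a : P)
    | add _ _ _ _ h1 h2 => exact h1.add h2
    | mul _ _ _ _ h1 h2 => exact h1.mul h2
  have : Algebra.FiniteType ℤ R := ⟨⟨Finset.univ.image y, by simpa using hy⟩⟩
  have : Algebra.FiniteType P R := .of_restrictScalars_finiteType ℤ P R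
  obtain ⟨d, b, hb, hspan⟩ := exists_linearIndependent_smul_mem_span (P := P) (R := R)
  let v : Option (J × Fin d) → R := fun o => o.elim 1 fun q => y q.1 * b q.2
  choose h hh hv using fun o => hspan (v o)
  have hH : ∀ o, ∃ a : Fin d → P, ∑ l, a l • b l = (∏ o, h o) • v o := fun o => by
    obtain ⟨a, ha⟩ := hv o
    refine ⟨fun l => (∏ o ∈ Finset.univ.erase o, h o) * a l, ?_⟩
    rw [← Finset.prod_erase_mul _ _ (Finset.mem_univ o), mul_smul, ← ha, Finset.smul_sum]
    simp only [mul_smul]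
  obtain ⟨C, p₀, hC⟩ := exists_card_ker_mul_le hy hn hny hb
    (Finset.prod_ne_zero_iff.2 fun o _ => hh o) (hH none) (fun j k => hH (some (j, k)))
  refine ⟨C, p₀, fun p _ hp D hD f hf hreg => (hC p hp D hD f hf hreg).trans ?_⟩
  exact Nat.mul_le_mul_left _ (Nat.pow_le_pow_right (Fact.out : p.Prime).pos hst)

end UpperBound
end PointCount

namespace PointCount

section Assembly

open MvPolynomial

lemma exists_pow_mul_eq_intCast_of_mem_ZInvN {N : ℕ} (hN : N ≠ 0) {x : ℚ} (hx : x ∈ ZInvN N) :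
    ∃ (k : ℕ) (a : ℤ), (N : ℚ) ^ k * x = a := by
  have hN' : (N : ℚ) ≠ 0 := Nat.cast_ne_zero.2 hN
  induction hx using Subring.closure_induction with
  | mem x hx =>
    obtain rfl := Set.mem_singleton_iff.1 hx
    exact ⟨1, 1, by simp [hN']⟩
  | zero => exact ⟨0, 0, by simp⟩
  | one => exact ⟨0, 1, by simp⟩
  | add x y _ _ h1 h2 =>
    obtain ⟨k, a, h1⟩ := h1
    obtain ⟨l, b, h2⟩ := h2
    refine ⟨k + l, N ^ l * a + N ^ k * b, ?_⟩
    push_cast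
    rw [← h1, ← h2]
    ring
  | neg x _ h1 =>
    obtain ⟨k, a, h1⟩ := h1
    exact ⟨k, -a, by push_cast; rw [← h1]; ring⟩
  | mul x y _ _ h1 h2 =>
    obtain ⟨k, a, h1⟩ := h1
    obtain ⟨l, b, h2⟩ := h2
    refine ⟨k + l, a * b, ?_⟩
    push_cast
    rw [← h1, ← h2]
    ring

lemma exists_map_eq_pow_mul {N : ℕ} (hN : N ≠ 0) {σ : Type*} (f : MvPolynomial σ (ZInvN N)) :
    ∃ (k : ℕ) (g : MvPolynomial σ ℤ), g.totalDegree ≤ f.totalDegree ∧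
      map (Int.castRingHom (ZInvN N)) g = (N : MvPolynomial σ (ZInvN N)) ^ k * f := by
  choose k a hka using fun d => exists_pow_mul_eq_intCast_of_mem_ZInvN hN (f.coeff d).2
  let K := ∑ d ∈ f.support, k d
  refine ⟨K, ∑ d ∈ f.support, monomial d ((N : ℤ) ^ (K - k d) * a d), ?_, ?_⟩
  · refine totalDegree_finsetSum_le fun d hd => (totalDegree_monomial_le _ _).trans ?_
    exact le_totalDegree hd
  · have hcast : ∀ d ∈ f.support,
        (((N : ℤ) ^ (K - k d) * a d : ℤ) : ZInvN N) = (N : ZInvN N) ^ K * f.coeff d := by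
      intro d hd
      refine Subtype.ext ?_
      push_cast
      rw [← hka, ← mul_assoc, ← pow_add, Nat.sub_add_cancel
        (Finset.single_le_sum (f := k) (fun _ _ => Nat.zero_le _) hd)]
    conv_rhs => rw [f.as_sum]
    rw [map_sum, Finset.mul_sum]
    refine Finset.sum_congr rfl fun d hd => ?_
    rw [map_monomial, eq_intCast, hcast d hd, ← C_mul_monomial, map_pow, map_natCast]

lemma adjoin_option_elim_eq_top {N : ℕ} {σ R : Type*} [CommRing R] {π : MvPolynomial σ (ZInvN N) →+* R}
    (hπ : Function.Surjective π) :
    Algebra.adjoin ℤ (Set.range fun o : Option σ => π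
      (o.elim (C ⟨(N : ℚ)⁻¹, Subring.subset_closure rfl⟩) X)) = ⊤ := by
  set A := Algebra.adjoin ℤ (Set.range fun o : Option σ => π
      (o.elim (C ⟨(N : ℚ)⁻¹, Subring.subset_closure rfl⟩) X)) with hA
  have hC : ∀ (x : ℚ) (hx : x ∈ ZInvN N), π (C ⟨x, hx⟩) ∈ A := by
    intro x hx
    induction hx using Subring.closure_induction with
    | mem x hx =>
      obtain rfl := Set.mem_singleton_iff.1 hx
      exact Algebra.subset_adjoin ⟨none, rfl⟩
    | zero => exact (map_zero (π.comp C)) ▸ A.zero_mem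
    | one => exact (map_one (π.comp C)) ▸ A.one_mem
    | add x y hx hy h1 h2 =>
      exact (map_add (π.comp C) ⟨x, hx⟩ ⟨y, hy⟩) ▸ A.add_mem h1 h2
    | neg x hx h1 => exact (map_neg (π.comp C) ⟨x, hx⟩) ▸ A.neg_mem h1
    | mul x y hx hy h1 h2 =>
      exact (map_mul (π.comp C) ⟨x, hx⟩ ⟨y, hy⟩) ▸ A.mul_mem h1 h2
  rw [eq_top_iff]
  rintro r -
  obtain ⟨f, rfl⟩ := hπ r
  induction f using MvPolynomial.induction_on with
  | C a => exact hC a a.2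
  | add f g hf hg => exact map_add π f g ▸ A.add_mem hf hg
  | mul_X f i hf =>
    exact map_mul π f (X i) ▸
      A.mul_mem hf (Algebra.subset_adjoin ⟨some i, rfl⟩)

lemma exists_eq_mul_of_tmul_mem_nonZeroDivisors {R : Type*} [CommRing R]
    {p : ℕ} {r : R}
    (hr : r ⊗ₜ[ℤ] (1 : ZMod p) ∈ nonZeroDivisors (R ⊗[ℤ] ZMod p)) {w v : R} (h : r * w = p * v) :
    ∃ u, w = p * u := by
  have h1 : w ⊗ₜ[ℤ] (1 : ZMod p) = 0 := by
    refine (mem_nonZeroDivisors_iff.1 hr).1 _ ?_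
    rw [Algebra.TensorProduct.tmul_mul_tmul, h, mul_one, ← nsmul_eq_mul, TensorProduct.smul_tmul,
      nsmul_eq_mul, mul_one, ZMod.natCast_self, TensorProduct.tmul_zero]
  let π := Ideal.Quotient.mk (Ideal.span {(p : R)})
  have hp : (p : R ⧸ Ideal.span {(p : R)}) = 0 := by
    rw [← map_natCast π]
    exact Ideal.Quotient.eq_zero_iff_mem.2 (Ideal.mem_span_singleton_self _)
  let c : ZMod p →+* R ⧸ Ideal.span {(p : R)} := ZMod.castHom (ringChar.dvd hp) _
  have h2 := Algebra.TensorProduct.productMap_apply_tmul π.toIntAlgHom c.toIntAlgHom w 1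
  rw [h1, map_zero, map_one, mul_one] at h2
  exact Ideal.mem_span_singleton.1 (Ideal.Quotient.eq_zero_iff_mem.1 h2.symm)

end Assembly
end PointCount

namespace PointCount

section Regularity

lemma exists_eq_mul_of_pow_mul {R : Type*} [CommRing R] {p N : ℕ} (hpN : p.Coprime N) {r : R}
    (hr : ∀ w v : R, r * w = p * v → ∃ u, w = p * u) {k : ℕ} {w v : R}
    (h : (N : R) ^ k * r * w = p * v) : ∃ u, w = p * u := by
  obtain ⟨u, hu⟩ := hr (N ^ k * w) v (by rw [← h]; ring)
  obtain ⟨a, b, hab⟩ : IsCoprime (p : R) ((N : R) ^ k) := by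
    have := Nat.isCoprime_iff_coprime.2 (hpN.pow_right k)
    simpa using this.map (Int.castRingHom R)
  refine ⟨a * w + b * u, ?_⟩
  linear_combination -w * hab + b * hu

end Regularity

section PointCountRatio

theorem exists_card_ker_lt {N m : ℕ} (hN : N ≠ 0) {R L : Type} [CommRing R] [IsDomain R] [Field L]
    [CharZero L] [Algebra R L] [IsFractionRing R L] {π : MvPolynomial (Fin m) (ZInvN N) →+* R}
    (hπ : Function.Surjective π) {t : ℕ} (ht : 1 ≤ t) {x : Fin t → L}
    (hx : IsTranscendenceBasis ℚ x) (F : IntermediateField ℚ L)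
    (hF : ∀ z, z ∈ F ↔ IsAlgebraic ℚ z) :
    ∃ C p₀ : ℝ, ∀ p : ℕ, p.Prime → p₀ < p → SplitsCompletely F p →
      ∀ D : ℕ, 1 ≤ D → ∀ f : MvPolynomial (Fin m) (ZInvN N), f.totalDegree ≤ D →
        (∀ w v : R, π f * w = p * v → ∃ u, w = p * u) →
        (Nat.card {φ : R →+* ZMod p // φ (π f) = 0} : ℝ) <
          (C * D / p) * (Nat.card (R →+* ZMod p) : ℝ) := by
  classical
  let y : Option (Fin m) → R := fun o => π
    (o.elim (MvPolynomial.C ⟨(N : ℚ)⁻¹, Subring.subset_closure rfl⟩) MvPolynomial.X)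
  have hy : Algebra.adjoin ℤ (Set.range y) = ⊤ := adjoin_option_elim_eq_top hπ
  have : Algebra.FiniteType ℤ R := ⟨⟨Finset.univ.image y, by simpa using hy⟩⟩
  have htr : Algebra.trdeg ℚ L = t := by
    have := hx.lift_cardinalMk_eq_trdeg
    simpa using this.symm
  obtain ⟨C₁, p₁, hup⟩ := exists_card_ker_aeval_mul_le (L := L) hy htr
  obtain ⟨ε, hε, p₂, hlow⟩ :=
    manyPoints_splitsCompletely (R := R) ht hx F hF 1 one_ne_zero
  refine ⟨C₁ / ε + 1, max (max p₁ p₂) N, fun p hp hp₀ hsplit D hD f hf hreg => ?_⟩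
  simp only [max_lt_iff, Nat.cast_lt] at hp₀
  obtain ⟨⟨hp₁, hp₂⟩, hpN⟩ := hp₀
  have : Fact p.Prime := ⟨hp⟩
  have hcop : p.Coprime N := (Nat.coprime_of_lt_prime hN hpN hp)
  obtain ⟨k, g, hg, hgf⟩ := exists_map_eq_pow_mul hN f
  let g' := MvPolynomial.rename some g
  have hg' : MvPolynomial.aeval y g' = (N : R) ^ k * π f := by
    have h1 : π.comp (MvPolynomial.map (Int.castRingHom (ZInvN N))) =
        (MvPolynomial.aeval (y ∘ some)).toRingHom :=
      MvPolynomial.ringHom_ext (fun a => by simp) (fun i => by simp [y])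
    have h2 := DFunLike.congr_fun h1 g
    rw [RingHom.comp_apply, hgf, map_mul, map_pow, map_natCast] at h2
    rw [MvPolynomial.aeval_rename]
    exact h2.symm
  have hcount := hup p hp₁ D hD g' ((MvPolynomial.totalDegree_rename_le _ _).trans (hg.trans hf))
    fun w v h => exists_eq_mul_of_pow_mul hcop
      hreg (hg' ▸ h)
  obtain ⟨S, -, hS⟩ := hlow p hp₂ hsplit
  have hfin : Finite (R →+* ZMod p) := finite_ringHom_zmod hy p
  have hSle : (S.card : ℝ) ≤ Nat.card (R →+* ZMod p) := by
    rw [← Nat.card_eq_finsetCard]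
    exact_mod_cast Finite.card_subtype_le (· ∈ S)
  have hker : Nat.card {φ : R →+* ZMod p // φ (π f) = 0} ≤
      Nat.card {φ : R →+* ZMod p // φ (MvPolynomial.aeval y g') = 0} :=
    Nat.card_le_card_of_injective
      (fun φ => ⟨φ.1, by rw [hg', map_mul, φ.2, mul_zero]⟩)
      fun _ _ h => Subtype.ext (congr_arg (fun ψ => ψ.1) h)
  have hp' : (0 : ℝ) < p := Nat.cast_pos.2 hp.pos
  have hD' : (0 : ℝ) < D := Nat.cast_pos.2 hD
  set T : ℝ := (Nat.card (R →+* ZMod p) : ℝ)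
  have hT : ε * (p : ℝ) ^ t ≤ T := hS.trans hSle
  have hT0 : 0 < T := (mul_pos hε (pow_pos hp' t)).trans_le hT
  have hup' : (Nat.card {φ : R →+* ZMod p // φ (π f) = 0} : ℝ) * p ≤
      C₁ * D * (p : ℝ) ^ t := by
    exact_mod_cast (Nat.mul_le_mul_right p hker).trans hcount
  have hpt : (p : ℝ) ^ t ≤ T / ε := by rwa [le_div_iff₀ hε, mul_comm]
  rw [div_mul_eq_mul_div, lt_div_iff₀ hp']
  calc _ ≤ C₁ * D * (p : ℝ) ^ t := hup'
    _ ≤ C₁ * D * (T / ε) := by gcongr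
    _ < C₁ * D * (T / ε) + D * T := lt_add_of_pos_right _ (mul_pos hD' hT0)
    _ = (C₁ / ε + 1) * D * T := by ring

end PointCountRatio
end PointCount

namespace PointCount

theorem exists_card_ker_lt_of_fractionRing {N m : ℕ} (hN : N ≠ 0) {R : Type} [CommRing R]
    [IsDomain R] [CharZero (FractionRing R)] {π : MvPolynomial (Fin m) (ZInvN N) →+* R}
    (hπ : Function.Surjective π) {t : ℕ} (ht : 1 ≤ t) {x : Fin t → FractionRing R}
    (hx : IsTranscendenceBasis ℚ x) (F : IntermediateField ℚ (FractionRing R))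
    (hF : ∀ z, z ∈ F ↔ IsAlgebraic ℚ z) :
    ∃ C p₀ : ℝ, ∀ p : ℕ, p.Prime → p₀ < p → SplitsCompletely F p →
      ∀ D : ℕ, 1 ≤ D → ∀ f : MvPolynomial (Fin m) (ZInvN N), f.totalDegree ≤ D →
        (∀ w v : R, π f * w = p * v → ∃ u, w = p * u) →
        (Nat.card {φ : R →+* ZMod p // φ (π f) = 0} : ℝ) <
          (C * D / p) * (Nat.card (R →+* ZMod p) : ℝ) :=
  exists_card_ker_lt hN hπ ht hx F hF

theorem exists_eq_mul_of_mk_tmul_mem_nonZeroDivisors {A σ : Type*} [CommRing A]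
    {I : Ideal (MvPolynomial σ A)} {p : ℕ} {r : MvPolynomial σ A}
    (hr : Ideal.Quotient.mk I r ⊗ₜ[ℤ] (1 : ZMod p) ∈
      nonZeroDivisors ((MvPolynomial σ A ⧸ I) ⊗[ℤ] ZMod p))
    {w v : MvPolynomial σ A ⧸ I} (h : Ideal.Quotient.mk I r * w = p * v) : ∃ u, w = p * u :=
  exists_eq_mul_of_tmul_mem_nonZeroDivisors hr h

end PointCount

theorem stmt15 (N m : ℕ) (hN : 1 ≤ N) (hm : 1 ≤ m)
    (I : Ideal (MvPolynomial (Fin m) ↥(ZInvN N))) (hI : I.IsPrime)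
    -- the quotient `R = ℤ[1/N][y₁,…,y_m]/I` is a domain
    [IsDomain (MvPolynomial (Fin m) ↥(ZInvN N) ⧸ I)]
    [CharZero (FractionRing (MvPolynomial (Fin m) ↥(ZInvN N) ⧸ I))]
    -- `t ≥ 1` is the transcendence degree of `Frac(R)` over `ℚ`
    (t : ℕ) (ht : 1 ≤ t)
    (x : Fin t → FractionRing (MvPolynomial (Fin m) ↥(ZInvN N) ⧸ I))
    (hx : IsTranscendenceBasis ℚ x)
    -- `F` is the algebraic closure of `ℚ` inside `Frac(R)`
    (F : IntermediateField ℚ (FractionRing (MvPolynomial (Fin m) ↥(ZInvN N) ⧸ I)))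
    (hF : ∀ z, z ∈ F ↔ IsAlgebraic ℚ z) :
    ∃ C p₀ : ℝ, ∀ p : ℕ, p.Prime → p₀ < p → SplitsCompletely F p →
      ∀ D : ℕ, 1 ≤ D → ∀ f : MvPolynomial (Fin m) ↥(ZInvN N), f.totalDegree ≤ D →
        ((Ideal.Quotient.mk I f) ⊗ₜ[ℤ] (1 : ZMod p)) ∈
            nonZeroDivisors ((MvPolynomial (Fin m) ↥(ZInvN N) ⧸ I) ⊗[ℤ] ZMod p) →
        (Nat.card {φ : (MvPolynomial (Fin m) ↥(ZInvN N) ⧸ I) →+* ZMod p //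
            φ (Ideal.Quotient.mk I f) = 0} : ℝ)
          < (C * D / p) *
            (Nat.card ((MvPolynomial (Fin m) ↥(ZInvN N) ⧸ I) →+* ZMod p) : ℝ) := by
  have hN0 : N ≠ 0 := by omega
  obtain ⟨C, p₀, h⟩ := PointCount.exists_card_ker_lt_of_fractionRing hN0
    (Ideal.Quotient.mk_surjective (I := I)) ht hx F hF
  refine ⟨C, p₀, fun p hp hp₀ hs D hD f hf hreg => h p hp hp₀ hs D hD f hf fun w v hwv => ?_⟩
  exact PointCount.exists_eq_mul_of_mk_tmul_mem_nonZeroDivisors hreg hwv
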